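/- Uniqueness for the physical-vacuum free boundary problem (Theorem 1.1): Fix d ≥ 1, κ > 0, T > 0. For i = 1,2 let r_i : [0,T]×ℝ^d → ℝ and v_i : [0,T]×ℝ^d → ℝ^d be continuous, set Ω_t^i := {x ∈ ℝ^d : r_i(t,x) > 0}, and assume: (i) r_i(t,·) is Lipschitz in x uniformly in t and is a nondegenerate defining function, i.e. there are constants 0 < c ≤ C with c·dist(x, complement of Ω_t^i) ≤ r_i(t,x) ≤ C·dist(x, complement of Ω_t^i) for all x ∈ Ω_t^i and t ∈ [0,T] (the paper derives this from the initial-time nondegeneracy |∇r_i(0,·)| > 0 on ∂Ω_0^i); (ii) v_i(t,·) is C¹ on Ω_t^i with sup_t ‖∇v_i(t,·)‖_{L^∞(Ω_t^i)} < ∞, and sup_t ‖∇r_i(t,·)‖_{C̃^{0,1/2}(Ω_t^i)} < ∞, the adapted Hölder norm taken with weight r_i(t,·); (iii) r_i and v_i are differentiable in t at points of Ω_t^i and satisfy there ∂_t r_i + v_i·∇r_i + κ r_i (∇·v_i) = 0 and ∂_t v_i + (v_i·∇)v_i + ∇r_i = 0. If r₁(0,·) = r₂(0,·) and v₁(0,·)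 = v₂(0,·), then for every t ∈ [0,T] one has Ω_t^1 = Ω_t^2, and r₁(t,·) = r₂(t,·), v₁(t,·) = v₂(t,·) on this common domain. -/

import Mathlib

open MeasureTheory Set Metric
open scoped NNReal

/-- The divergence `∇ · v` of a vector field on `ℝ^d`. -/
noncomputable def vdiv {d : ℕ}
    (v : EuclideanSpace ℝ (Fin d) → EuclideanSpace ℝ (Fin d))
    (x : EuclideanSpace ℝ (Fin d)) : ℝ :=
  ∑ i, @inner ℝ _ _ (fderiv ℝ v x (EuclideanSpace.single i 1)) (EuclideanSpace.single i 1)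

namespace PhysicalVacuum

open Filter Topology

section Segment

variable {W : Type*} [NormedAddCommGroup W] [NormedSpace ℝ W] [FiniteDimensional ℝ W]
  [MeasurableSpace W] [BorelSpace W]

lemma ae_ae_line {μ : Measure W} [μ.IsAddHaarMeasure] {P : W → Prop} (h : ∀ᵐ q ∂μ, P q) (ξ : W) :
    ∀ᵐ p ∂μ, ∀ᵐ s : ℝ, P (p + s • ξ) := by
  set N := toMeasurable μ {q | ¬ P q} with hN
  have hN0 : μ N = 0 := by rw [hN, measure_toMeasurable]; exact h
  have hNm : MeasurableSet N := measurableSet_toMeasurable _ _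
  have hsub : ∀ q, q ∉ N → P q := fun q hq => by
    by_contra h'
    exact hq (subset_toMeasurable _ _ h')
  have hmeas : MeasurableSet {x : W × ℝ | x.1 + x.2 • ξ ∉ N} := by
    have : Measurable fun x : W × ℝ => x.1 + x.2 • ξ := by fun_prop
    exact (this hNm).compl
  have h1 : ∀ᵐ p ∂μ, ∀ᵐ s : ℝ, p + s • ξ ∉ N := by
    rw [Measure.ae_ae_comm (p := fun p s => p + s • ξ ∉ N) hmeas]
    refine Eventually.of_forall fun s => ?_
    rw [ae_iff]
    simp only [not_not]
    have := measure_preimage_add_right μ (s • ξ) N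
    rw [hN0] at this
    exact this
  filter_upwards [h1] with p hp
  filter_upwards [hp] with s hs using hsub _ hs

lemma segment_estimate_real {μ : Measure W} [μ.IsAddHaarMeasure] {g : W → ℝ} {O : Set W}
    (hO : IsOpen O) (hc : Convex ℝ O) {K : ℝ≥0} (hg : LipschitzOnWith K g O) (ξ : W) (m ε : ℝ)
    (hae : ∀ᵐ q ∂μ, q ∈ O → |fderiv ℝ g q ξ - m| ≤ ε) {p : W} (hp : p ∈ O) (hpξ : p + ξ ∈ O) :
    |g (p + ξ) - g p - m| ≤ ε := by
  have hdiff : ∀ᵐ q ∂μ, q ∈ O → DifferentiableAt ℝ g q := by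
    filter_upwards [hg.ae_differentiableWithinAt_of_mem (μ := μ)] with q hq hqO
    exact (hq hqO).differentiableAt (hO.mem_nhds hqO)
  have hgood := ae_ae_line (hae.and hdiff) ξ
  have key : ∀ᵐ q ∂μ, q ∈ O → q + ξ ∈ O → |g (q + ξ) - g q - m| ≤ ε := by
    filter_upwards [hgood] with q hq hqO hqξ
    have hseg : ∀ s ∈ Icc (0:ℝ) 1, q + s • ξ ∈ O := fun s hs => by
      have := hc.add_smul_sub_mem hqO hqξ hs
      simpa using this
    set φ : ℝ → ℝ := fun s => g (q + s • ξ) - s * m with hφ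
    have hLip : LipschitzOnWith (K * ‖ξ‖₊ + ‖m‖₊) φ (uIcc 0 1) := by
      rw [uIcc_of_le zero_le_one]
      refine LipschitzOnWith.sub (f := fun s : ℝ => g (q + s • ξ)) (g := fun s : ℝ => s * m) ?_ ?_
      · apply LipschitzOnWith.of_dist_le_mul
        intro s hs s' hs'
        refine (hg.dist_le_mul _ (hseg s hs) _ (hseg s' hs')).trans ?_
        rw [dist_add_left, dist_eq_norm, ← sub_smul, norm_smul, dist_eq_norm]
        push_cast
        apply le_of_eq; ring
      · apply LipschitzOnWith.of_dist_le_mul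
        intro s hs s' hs'
        rw [dist_eq_norm, ← sub_mul, norm_mul, dist_eq_norm]
        push_cast
        apply le_of_eq; ring
    have hle_int := hLip.absolutelyContinuousOnInterval.integral_deriv_eq_sub
    have hb : ‖∫ s in (0:ℝ)..1, deriv φ s‖ ≤ ε * |1 - 0| := by
      apply intervalIntegral.norm_integral_le_of_norm_le_const_ae
      filter_upwards [hq] with s hs hs01
      rw [uIoc_of_le zero_le_one] at hs01
      have hsO := hseg s ⟨hs01.1.le, hs01.2⟩
      have hd : HasDerivAt φ (fderiv ℝ g (q + s • ξ) ξ - m) s := by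
        have h1 : HasDerivAt (fun s : ℝ => q + s • ξ) ξ s := by
          simpa using ((hasDerivAt_id s).smul_const ξ).const_add q
        have h2 := (hs.2 hsO).hasFDerivAt.comp_hasDerivAt s h1
        have h3 := h2.sub ((hasDerivAt_id s).mul_const m)
        rw [one_mul] at h3
        exact h3
      rw [hd.deriv]
      exact hs.1 hsO
    rw [hle_int] at hb
    simp only [hφ, sub_zero, abs_one, mul_one, one_smul, zero_smul, add_zero, zero_mul,
      one_mul, Real.norm_eq_abs] at hb
    rw [show g (q + ξ) - g q - m = g (q + ξ) - m - g q by ring]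
    exact hb
  have hcont : ContinuousAt (fun q => |g (q + ξ) - g q - m|) p := by
    have h1 := hg.continuousOn.continuousAt (hO.mem_nhds hp)
    have h2 : ContinuousAt (fun q => g (q + ξ)) p :=
      ContinuousAt.comp (f := fun q => q + ξ) (g := g)
        (hg.continuousOn.continuousAt (hO.mem_nhds hpξ)) (by fun_prop)
    exact ((h2.sub h1).sub continuousAt_const).abs
  refine le_of_tendsto_of_frequently hcont.tendsto ?_
  have hdense := Measure.dense_of_ae key
  have : ∃ᶠ q in 𝓝 p, q ∈ O → q + ξ ∈ O → |g (q + ξ) - g q - m| ≤ ε :=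
    mem_closure_iff_frequently.1 (hdense p)
  have e1 : ∀ᶠ q in 𝓝 p, q ∈ O := hO.mem_nhds hp
  have e2 : ∀ᶠ q in 𝓝 p, q + ξ ∈ O :=
    (show ContinuousAt (fun q => q + ξ) p by fun_prop).preimage_mem_nhds (hO.mem_nhds hpξ)
  exact (this.and_eventually (e1.and e2)).mono fun q hq => hq.1 hq.2.1 hq.2.2

lemma segment_estimate {F : Type*} [NormedAddCommGroup F] [InnerProductSpace ℝ F]
    [FiniteDimensional ℝ F]
    {μ : Measure W} [μ.IsAddHaarMeasure] {g : W → F} {O : Set W}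
    (hO : IsOpen O) (hc : Convex ℝ O) {K : ℝ≥0} (hg : LipschitzOnWith K g O) (ξ : W) (m : F) (ε : ℝ)
    (hae : ∀ᵐ q ∂μ, q ∈ O → ‖fderiv ℝ g q ξ - m‖ ≤ ε) {p : W} (hp : p ∈ O) (hpξ : p + ξ ∈ O) :
    ‖g (p + ξ) - g p - m‖ ≤ ε := by
  have hdiff : ∀ᵐ q ∂μ, q ∈ O → DifferentiableAt ℝ g q := by
    filter_upwards [hg.ae_differentiableWithinAt_of_mem (μ := μ)] with q hq hqO
    exact (hq hqO).differentiableAt (hO.mem_nhds hqO)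
  have hε : 0 ≤ ε := by
    have h1 := mem_closure_iff_frequently.1 (Measure.dense_of_ae hae p)
    obtain ⟨q, hq⟩ := (h1.and_eventually (hO.mem_nhds hp)).exists
    exact (norm_nonneg _).trans (hq.1 hq.2)
  have main : ∀ w : F, |@inner ℝ _ _ w (g (p + ξ) - g p - m)| ≤ ‖w‖ * ε := by
    intro w
    have := segment_estimate_real (μ := μ) (g := fun q => @inner ℝ _ _ w (g q)) (K := ‖w‖₊ * K)
      hO hc ?_ ξ (@inner ℝ _ _ w m) (‖w‖ * ε) ?_ hp hpξ
    · rw [inner_sub_right, inner_sub_right]; exact this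
    · apply LipschitzOnWith.of_dist_le_mul
      intro x hx y hy
      rw [dist_eq_norm, ← inner_sub_right]
      refine (norm_inner_le_norm _ _).trans ?_
      push_cast
      rw [mul_assoc]
      exact mul_le_mul_of_nonneg_left (by rw [← dist_eq_norm]; exact hg.dist_le_mul _ hx _ hy)
        (norm_nonneg _)
    · filter_upwards [hdiff, hae] with q hq1 hq2 hqO
      have h := ((hasFDerivAt_const w q).inner ℝ (hq1 hqO).hasFDerivAt).fderiv
      rw [h]
      simp only [fderivInnerCLM_apply, ContinuousLinearMap.comp_apply,
        ContinuousLinearMap.prod_apply, _root_.zero_apply, inner_zero_left, add_zero]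
      rw [← inner_sub_right]
      refine (abs_real_inner_le_norm _ _).trans ?_
      exact mul_le_mul_of_nonneg_left (hq2 hqO) (norm_nonneg _)
  have h := main (g (p + ξ) - g p - m)
  rw [real_inner_self_eq_norm_sq, abs_of_nonneg (sq_nonneg _)] at h
  by_contra hlt
  push Not at hlt
  nlinarith

end Segment

section Power

/-- The pressure-type primitive `r^{σ+1}/(σ+1)` of `r ↦ r^σ`, extended by zero to `r ≤ 0`. -/
noncomputable def pres (σ r : ℝ) : ℝ := (max r 0) ^ (σ + 1) / (σ + 1)

/-- The relative entropy of the state `m` with respect to the (extended) state `R`. -/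
noncomputable def relEnt (σ m R : ℝ) : ℝ := pres σ R - pres σ m + m ^ σ * (m - R)

lemma hasDerivAt_pres {σ : ℝ} (hσ : 0 < σ) {r : ℝ} (hr : 0 < r) :
    HasDerivAt (pres σ) (r ^ σ) r := by
  have h : HasDerivAt (fun z : ℝ => z ^ (σ + 1) / (σ + 1)) (r ^ σ) r := by
    have := (Real.hasDerivAt_rpow_const (x := r) (p := σ + 1) (Or.inl hr.ne')).div_const (σ + 1)
    rw [add_sub_cancel_right, mul_div_cancel_left₀ _ (by linarith)] at this
    exact this
  apply h.congr_of_eventuallyEq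
  filter_upwards [lt_mem_nhds hr] with z hz
  rw [pres, max_eq_left hz.le]

lemma continuous_pres {σ : ℝ} (hσ : 0 < σ) : Continuous (pres σ) := by
  unfold pres
  exact ((Real.continuous_rpow_const (by linarith : 0 ≤ σ + 1)).comp
    (continuous_id.max continuous_const)).div_const _

lemma pres_nonneg {σ : ℝ} (hσ : 0 < σ) (r : ℝ) : 0 ≤ pres σ r := by
  unfold pres; positivity

lemma pres_of_nonpos {σ : ℝ} (hσ : 0 < σ) {r : ℝ} (hr : r ≤ 0) : pres σ r = 0 := by
  rw [pres, max_eq_right hr, Real.zero_rpow (by linarith), zero_div]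

lemma pres_eq_mul {σ : ℝ} (hσ : 0 < σ) {r : ℝ} (hr : 0 ≤ r) :
    pres σ r = r ^ σ * r / (σ + 1) := by
  rw [pres, max_eq_left hr, Real.rpow_add_one' hr (by linarith)]

lemma relEnt_convex {σ : ℝ} (hσ : 0 < σ) {m R k : ℝ} (hm : 0 < m) (hR : 0 ≤ R)
    (hlo : ∀ z, min m R ≤ z → z ≤ m → z ^ σ - m ^ σ ≤ k * (z - m))
    (hhi : ∀ z, m ≤ z → z ≤ max m R → k * (z - m) ≤ z ^ σ - m ^ σ) :
    k / 2 * (R - m) ^ 2 ≤ relEnt σ m R := by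
  set Q : ℝ → ℝ := fun z => relEnt σ m z - k / 2 * (z - m) ^ 2 with hQ
  have hQm : Q m = 0 := by simp [hQ, relEnt]
  have hcont : Continuous Q := by
    simp only [hQ, relEnt]
    have := continuous_pres hσ
    fun_prop
  have hder : ∀ z, 0 < z → HasDerivAt Q (z ^ σ - m ^ σ - k * (z - m)) z := by
    intro z hz
    have h1 := ((hasDerivAt_pres hσ hz).sub_const (pres σ m)).add
      ((((hasDerivAt_id z).const_sub m)).const_mul (m ^ σ))
    have h2 := (((hasDerivAt_id z).sub_const m).pow 2).const_mul (k / 2)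
    have h3 := h1.sub h2
    refine (h3.congr_deriv ?_).congr_of_eventuallyEq ?_
    · simp; ring
    · exact Eventually.of_forall fun z => by simp [hQ, relEnt]
  have : 0 ≤ Q R := by
    rw [← hQm]
    rcases le_total m R with h | h
    · refine monotoneOn_of_deriv_nonneg (convex_Icc m R) hcont.continuousOn ?_ ?_
        (left_mem_Icc.2 h) (right_mem_Icc.2 h) h
      · intro z hz
        rw [interior_Icc] at hz
        exact (hder z (hm.trans hz.1)).differentiableAt.differentiableWithinAt
      · intro z hz
        rw [interior_Icc] at hz
        rw [(hder z (hm.trans hz.1)).deriv]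
        have := hhi z hz.1.le (by rw [max_eq_right h]; exact hz.2.le)
        linarith
    · refine antitoneOn_of_deriv_nonpos (convex_Icc R m) hcont.continuousOn ?_ ?_
        (left_mem_Icc.2 h) (right_mem_Icc.2 h) h
      · intro z hz
        rw [interior_Icc] at hz
        exact (hder z (hR.trans_lt hz.1)).differentiableAt.differentiableWithinAt
      · intro z hz
        rw [interior_Icc] at hz
        rw [(hder z (hR.trans_lt hz.1)).deriv]
        have := hlo z (by rw [min_eq_right h]; exact hz.1.le) hz.2.le
        linarith
  simp only [hQ] at this
  linarith

lemma relEnt_of_nonpos {σ : ℝ} (hσ : 0 < σ) {m R : ℝ} (hm : 0 ≤ m) (hR : R ≤ 0) :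
    relEnt σ m R = σ / (σ + 1) * (m ^ σ * m) + m ^ σ * (-R) := by
  rw [relEnt, pres_of_nonpos hσ hR, pres_eq_mul hσ hm]
  field_simp
  ring

/-- The constant in the coercivity of the relative entropy. -/
noncomputable def cEnt (σ : ℝ) : ℝ := 2 * (σ + 1) / σ + 2

lemma cEnt_pos {σ : ℝ} (hσ : 0 < σ) : 0 < cEnt σ := by unfold cEnt; positivity

lemma exists_modulus {σ : ℝ} (hσ : 0 < σ) {m R M : ℝ} (hm : 0 < m) (hmM : m ≤ M) (hRM : R ≤ M)
    (hR : 0 ≤ R) : ∃ k : ℝ, 0 < k ∧ m ^ σ * 2 ≤ cEnt σ * M * k ∧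
    (∀ z, min m R ≤ z → z ≤ m → z ^ σ - m ^ σ ≤ k * (z - m)) ∧
    (∀ z, m ≤ z → z ≤ max m R → k * (z - m) ≤ z ^ σ - m ^ σ) := by
  have hM : 0 < M := hm.trans_le hmM
  have hc1 : 2 ≤ cEnt σ := by unfold cEnt; have : 0 ≤ 2 * (σ + 1) / σ := by positivity
                              linarith
  rcases le_total 1 σ with h1 | h1
  · refine ⟨m ^ (σ - 1), by positivity, ?_, ?_, ?_⟩
    · have e : m ^ σ = m ^ (σ - 1) * m := by
        rw [← Real.rpow_add_one hm.ne']; congr 1; ring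
      rw [e]
      have : 0 < m ^ (σ - 1) := by positivity
      have h3 : m * 2 ≤ cEnt σ * M := by nlinarith
      nlinarith
    · intro z hz hzm
      have hz0 : 0 ≤ z := (le_min hm.le hR).trans hz
      have e : m ^ σ = m ^ (σ - 1) * m := by
        rw [← Real.rpow_add_one hm.ne']; congr 1; ring
      have e2 : z ^ σ ≤ m ^ (σ - 1) * z := by
        rcases hz0.eq_or_lt with h | h
        · rw [← h, Real.zero_rpow hσ.ne']; simp
        · have : z ^ σ = z ^ (σ - 1) * z := by
            rw [← Real.rpow_add_one h.ne']; congr 1; ring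
          rw [this]
          have := Real.rpow_le_rpow hz0 hzm (by linarith : 0 ≤ σ - 1)
          nlinarith
      rw [e]; linarith
    · intro z hz _
      have hz0 : 0 < z := hm.trans_le hz
      have e : m ^ σ = m ^ (σ - 1) * m := by
        rw [← Real.rpow_add_one hm.ne']; congr 1; ring
      have e2 : m ^ (σ - 1) * z ≤ z ^ σ := by
        have : z ^ σ = z ^ (σ - 1) * z := by
          rw [← Real.rpow_add_one hz0.ne']; congr 1; ring
        rw [this]
        have := Real.rpow_le_rpow hm.le hz (by linarith : 0 ≤ σ - 1)
        nlinarith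
      rw [e]; linarith
  · have hk : 0 < σ * M ^ (σ - 1) := by positivity
    have hmono : MonotoneOn (fun z : ℝ => z ^ σ - σ * M ^ (σ - 1) * z) (Icc 0 M) := by
      refine monotoneOn_of_deriv_nonneg (convex_Icc 0 M) ?_ ?_ ?_
      · exact ((Real.continuous_rpow_const hσ.le).sub (by fun_prop)).continuousOn
      · intro z hz
        rw [interior_Icc] at hz
        have := (Real.hasDerivAt_rpow_const (x := z) (p := σ) (Or.inl hz.1.ne')).differentiableAt
        exact (this.sub (by fun_prop)).differentiableWithinAt
      · intro z hz
        rw [interior_Icc] at hz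
        have h2 := (Real.hasDerivAt_rpow_const (x := z) (p := σ) (Or.inl hz.1.ne')).sub
          ((hasDerivAt_id z).const_mul (σ * M ^ (σ - 1)))
        have h3 : deriv (fun z : ℝ => z ^ σ - σ * M ^ (σ - 1) * z) z =
            σ * z ^ (σ - 1) - σ * M ^ (σ - 1) * 1 := h2.deriv
        rw [h3]
        have := Real.rpow_le_rpow_of_nonpos hz.1 hz.2.le (by linarith : σ - 1 ≤ 0)
        nlinarith
    refine ⟨σ * M ^ (σ - 1), hk, ?_, ?_, ?_⟩
    · have e : M * M ^ (σ - 1) = M ^ σ := by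
        rw [mul_comm, ← Real.rpow_add_one hM.ne']; congr 1; ring
      have h4 : m ^ σ ≤ M ^ σ := Real.rpow_le_rpow hm.le hmM hσ.le
      have h5 : 2 ≤ cEnt σ * σ := by
        unfold cEnt; field_simp; nlinarith
      have h6 : 0 < M ^ σ := by positivity
      calc m ^ σ * 2 ≤ M ^ σ * 2 := by linarith
        _ ≤ M ^ σ * (cEnt σ * σ) := by nlinarith
        _ = cEnt σ * M * (σ * M ^ (σ - 1)) := by rw [← e]; ring
    · intro z hz hzm
      have hz0 : 0 ≤ z := (le_min hm.le hR).trans hz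
      have := hmono ⟨hz0, hzm.trans hmM⟩ ⟨hm.le, hmM⟩ hzm
      simp only at this
      linarith
    · intro z hz hzm
      have := hmono ⟨hm.le, hmM⟩ ⟨hm.le.trans hz, hzm.trans (max_le hmM hRM)⟩ hz
      simp only at this
      linarith

lemma relEnt_coercive {σ : ℝ} (hσ : 0 < σ) {m R M : ℝ} (hm : 0 ≤ m) (hmM : m ≤ M)
    (hRM : |R| ≤ M) : m ^ σ * (R - m) ^ 2 ≤ cEnt σ * M * relEnt σ m R := by
  have hM : 0 ≤ M := hm.trans hmM
  have hc := cEnt_pos hσ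
  rcases hm.eq_or_lt with h | hm'
  · rw [← h, Real.zero_rpow hσ.ne', zero_mul]
    have : relEnt σ 0 R = pres σ R := by
      rw [relEnt, pres_of_nonpos hσ le_rfl, Real.zero_rpow hσ.ne']; ring
    rw [this]
    have := pres_nonneg hσ R
    positivity
  have hR1 := abs_le.1 hRM
  rcases le_total 0 R with hR | hR
  · obtain ⟨k, hk, h1, h2, h3⟩ := exists_modulus hσ hm' hmM hR1.2 hR
    have h4 := relEnt_convex hσ hm' hR h2 h3
    calc m ^ σ * (R - m) ^ 2 = (m ^ σ * 2) * ((R - m) ^ 2 / 2) := by ring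
      _ ≤ (cEnt σ * M * k) * ((R - m) ^ 2 / 2) := by gcongr
      _ = cEnt σ * M * (k / 2 * (R - m) ^ 2) := by ring
      _ ≤ _ := by gcongr
  · rw [relEnt_of_nonpos hσ hm hR]
    have hx : 0 < m ^ σ := by positivity
    have h1 : (R - m) ^ 2 ≤ 2 * M * (m - R) := by nlinarith
    have h2 : (m - R) * 2 ≤ cEnt σ * (σ / (σ + 1) * m + -R) := by
      have e1 : cEnt σ * (σ / (σ + 1)) = 2 + 2 * σ / (σ + 1) := by
        unfold cEnt; field_simp
      have e2 : 0 ≤ 2 * σ / (σ + 1) := by positivity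
      have e3 : 2 ≤ cEnt σ := by
        unfold cEnt; have : 0 ≤ 2 * (σ + 1) / σ := by positivity
        linarith
      nlinarith
    calc m ^ σ * (R - m) ^ 2 ≤ m ^ σ * (2 * M * (m - R)) := by gcongr
      _ = m ^ σ * M * ((m - R) * 2) := by ring
      _ ≤ m ^ σ * M * (cEnt σ * (σ / (σ + 1) * m + -R)) := by gcongr
      _ = _ := by ring

lemma relEnt_nonneg {σ : ℝ} (hσ : 0 < σ) {m R : ℝ} (hm : 0 ≤ m) : 0 ≤ relEnt σ m R := by
  rcases hm.eq_or_lt with h | hm'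
  · rw [← h, relEnt, pres_of_nonpos hσ le_rfl, Real.zero_rpow hσ.ne']
    have := pres_nonneg hσ R
    linarith
  have h1 := relEnt_coercive hσ hm (M := max m |R|) (le_max_left _ _) (le_max_right _ _)
  have h2 : 0 < cEnt σ * max m |R| := mul_pos (cEnt_pos hσ) (hm'.trans_le (le_max_left _ _))
  have h3 : 0 ≤ m ^ σ * (R - m) ^ 2 := by positivity
  by_contra h
  push Not at h
  nlinarith

lemma eq_max_of_relEnt_eq_zero {σ : ℝ} (hσ : 0 < σ) {m R : ℝ} (hm : 0 ≤ m)
    (h : relEnt σ m R = 0) : m = max R 0 := by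
  rcases hm.eq_or_lt with h0 | hm'
  · subst h0
    rw [relEnt, pres_of_nonpos hσ le_rfl, Real.zero_rpow hσ.ne'] at h
    have h1 : pres σ R = 0 := by linarith
    rw [pres, div_eq_zero_iff, Real.rpow_eq_zero_iff_of_nonneg (le_max_right _ _)] at h1
    rcases h1 with h1 | h1
    · exact h1.1.symm
    · linarith
  have h1 := relEnt_coercive hσ hm (M := max m |R|) (le_max_left _ _) (le_max_right _ _)
  rw [h, mul_zero] at h1
  have h2 : 0 < m ^ σ := by positivity
  have h3 : (R - m) ^ 2 = 0 := by nlinarith [sq_nonneg (R - m)]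
  have : R = m := by nlinarith [pow_eq_zero_iff (two_ne_zero) |>.1 h3]
  rw [this, max_eq_left hm]

lemma mul_negPart_le_relEnt {σ : ℝ} (hσ : 0 < σ) {m R : ℝ} (hm : 0 ≤ m) :
    m ^ σ * max (-R) 0 ≤ relEnt σ m R := by
  rcases le_total R 0 with h | h
  · rw [max_eq_left (by linarith), relEnt_of_nonpos hσ hm h]
    have : 0 ≤ σ / (σ + 1) * (m ^ σ * m) := by positivity
    linarith
  · rw [max_eq_right (by linarith), mul_zero]
    exact relEnt_nonneg hσ hm

lemma continuous_relEnt {σ : ℝ} (hσ : 0 < σ) : Continuous fun p : ℝ × ℝ => relEnt σ p.1 p.2 := by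
  unfold relEnt
  have h1 := continuous_pres hσ
  have h2 : Continuous fun p : ℝ × ℝ => p.1 ^ σ :=
    (Real.continuous_rpow_const hσ.le).comp continuous_fst
  fun_prop

end Power

section Regularization

/-- A Lipschitz substitute `f` for `r ↦ r^σ` with primitive `P`, accurate up to `δ` on `[-M, M]`. -/
structure PowerApprox (σ M δ : ℝ) (f P : ℝ → ℝ) : Prop where
  zero_of_nonpos : ∀ r ≤ 0, f r = 0
  nonneg : ∀ r, 0 ≤ f r
  lip : ∃ K : ℝ≥0, LipschitzOnWith K f (Icc (-M) M)
  hasDerivAt : ∀ r, HasDerivAt P (f r) r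
  prim_zero : ∀ r ≤ 0, P r = 0
  diff : ∀ r, 0 < r → DifferentiableAt ℝ f r
  euler : ∀ r, 0 < r → r ≤ M → |σ * f r - r * deriv f r| ≤ δ
  close : ∀ r, |r| ≤ M → |f r - (max r 0) ^ σ| ≤ δ
  prim_close : ∀ r, |r| ≤ M → |P r - pres σ r| ≤ δ

lemma exists_shift_close {s : ℝ} (hs : 0 < s) (M : ℝ) {δ : ℝ} (hδ : 0 < δ) :
    ∀ᶠ ε in 𝓝[>] (0:ℝ), ∀ r ∈ Icc (0:ℝ) M, |(r + ε) ^ s - r ^ s| ≤ δ := by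
  have hc : Continuous fun x : ℝ => x ^ s := Real.continuous_rpow_const hs.le
  have hu := (isCompact_Icc (a := (0:ℝ)) (b := M + 1)).uniformContinuousOn_of_continuous
    hc.continuousOn
  rw [Metric.uniformContinuousOn_iff] at hu
  obtain ⟨η, hη, h⟩ := hu δ hδ
  have hmin : 0 < min η 1 := lt_min hη one_pos
  filter_upwards [Ioo_mem_nhdsGT hmin] with ε hε r hr
  have h1 : ε < η := hε.2.trans_le (min_le_left _ _)
  have h2 : ε < 1 := hε.2.trans_le (min_le_right _ _)
  have := h (r + ε) ⟨by linarith [hr.1, hε.1], by linarith [hr.2]⟩ r ⟨hr.1, by linarith [hr.2]⟩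
    (by rw [Real.dist_eq]; simp [abs_of_pos hε.1, h1])
  rw [Real.dist_eq] at this
  exact this.le

lemma exists_powerApprox {σ : ℝ} (hσ : 0 < σ) {M : ℝ} (hM : 0 < M) {δ : ℝ} (hδ : 0 < δ) :
    ∃ f P : ℝ → ℝ, PowerApprox σ M δ f P := by
  have hδ3 : 0 < δ / 3 := by positivity
  have hE1 := exists_shift_close hσ M hδ3
  have hE2 := exists_shift_close (by linarith : 0 < σ + 1) M (δ := δ / 3) hδ3
  have hpow0 : Tendsto (fun ε : ℝ => ε ^ σ) (𝓝[>] 0) (𝓝 0) := by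
    have := (Real.continuous_rpow_const hσ.le).tendsto (0:ℝ)
    rw [Real.zero_rpow hσ.ne'] at this
    exact this.mono_left nhdsWithin_le_nhds
  have hE3 : ∀ᶠ ε in 𝓝[>] (0:ℝ), ε ^ σ < δ / 3 := hpow0.eventually (gt_mem_nhds hδ3)
  have hE4 : ∀ᶠ ε in 𝓝[>] (0:ℝ), ε ^ σ * M < δ / 3 := by
    have : Tendsto (fun ε : ℝ => ε ^ σ * M) (𝓝[>] 0) (𝓝 (0 * M)) := hpow0.mul_const M
    rw [zero_mul] at this
    exact this.eventually (gt_mem_nhds hδ3)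
  have hE5 : ∀ᶠ ε in 𝓝[>] (0:ℝ), σ * ε ^ σ < δ / 3 := by
    have : Tendsto (fun ε : ℝ => σ * ε ^ σ) (𝓝[>] 0) (𝓝 (σ * 0)) := hpow0.const_mul σ
    rw [mul_zero] at this
    exact this.eventually (gt_mem_nhds hδ3)
  have hE6 : ∀ᶠ ε in 𝓝[>] (0:ℝ), σ * (ε * (M + 1) ^ (σ - 1)) < δ / 3 := by
    have : Tendsto (fun ε : ℝ => σ * (ε * (M + 1) ^ (σ - 1))) (𝓝 0) 
        (𝓝 (σ * (0 * (M + 1) ^ (σ - 1)))) := by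
      apply Continuous.tendsto; fun_prop
    rw [zero_mul, mul_zero] at this
    exact (this.mono_left nhdsWithin_le_nhds).eventually (gt_mem_nhds hδ3)
  have hE7 : ∀ᶠ ε in 𝓝[>] (0:ℝ), ε ∈ Ioo (0:ℝ) 1 := Ioo_mem_nhdsGT one_pos
  have hE8 : ∀ᶠ ε in 𝓝[>] (0:ℝ), ε ^ (σ + 1) < δ / 3 := by
    have := (Real.continuous_rpow_const (by linarith : 0 ≤ σ + 1)).tendsto (0:ℝ)
    rw [Real.zero_rpow (by linarith)] at this
    exact (this.mono_left nhdsWithin_le_nhds).eventually (gt_mem_nhds hδ3)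
  obtain ⟨ε, h1, h2, h3, h4, h5, h6, ⟨hε0, hε1⟩, h8⟩ :=
    (hE1.and (hE2.and (hE3.and (hE4.and (hE5.and (hE6.and (hE7.and hE8))))))).exists
  set f₀ : ℝ → ℝ := fun r => (r + ε) ^ σ - ε ^ σ with hf₀
  set P₀ : ℝ → ℝ := fun r => ((r + ε) ^ (σ + 1) - ε ^ (σ + 1)) / (σ + 1) - ε ^ σ * r with hP₀
  have hderf : ∀ r, -ε < r → HasDerivAt f₀ (σ * (r + ε) ^ (σ - 1)) r := by
    intro r hr
    have := ((hasDerivAt_id r).add_const ε).rpow_const (p := σ) (Or.inl (by simp; linarith))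
    have := this.sub_const (ε ^ σ)
    simpa [hf₀] using this
  have hderP : ∀ r, -ε < r → HasDerivAt P₀ (f₀ r) r := by
    intro r hr
    have := ((hasDerivAt_id r).add_const ε).rpow_const (p := σ + 1) (Or.inl (by simp; linarith))
    have := ((this.sub_const (ε ^ (σ + 1))).div_const (σ + 1)).sub
      ((hasDerivAt_id r).const_mul (ε ^ σ))
    refine this.congr_deriv ?_
    have hne : σ + 1 ≠ 0 := by linarith
    simp only [id, hf₀, add_sub_cancel_right, one_mul, mul_one]
    rw [mul_div_cancel_left₀ _ hne]
  have hf₀nn : ∀ r, 0 ≤ r → 0 ≤ f₀ r := fun r hr => by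
    have := Real.rpow_le_rpow hε0.le (by linarith : ε ≤ r + ε) hσ.le
    simp only [hf₀]; linarith
  have hf00 : f₀ 0 = 0 := by simp [hf₀]
  have hP00 : P₀ 0 = 0 := by simp [hP₀]
  refine ⟨fun r => f₀ (max r 0), fun r => P₀ (max r 0), ?_, ?_, ?_, ?_, ?_, ?_, ?_, ?_, ?_⟩
  · intro r hr; simp only [max_eq_right hr, hf00]
  · intro r; exact hf₀nn _ (le_max_right _ _)
  · have hcd : ContDiffOn ℝ 1 f₀ (Icc 0 M) := by
      intro r hr
      apply ContDiffAt.contDiffWithinAt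
      apply ContDiffAt.sub _ contDiffAt_const
      exact (contDiffAt_id.add contDiffAt_const).rpow_const_of_ne (by
        have := hr.1
        simp; linarith)
    obtain ⟨K, hK⟩ := hcd.exists_lipschitzOnWith one_ne_zero (convex_Icc 0 M) isCompact_Icc
    refine ⟨K, ?_⟩
    have h1 : LipschitzOnWith 1 (fun r : ℝ => max r 0) (Icc (-M) M) :=
      (LipschitzWith.id.max_const 0).lipschitzOnWith
    have := hK.comp h1 (fun r hr => ⟨le_max_right _ _, max_le hr.2 hM.le⟩)
    rw [mul_one] at this
    exact this
  · intro r
    rcases lt_trichotomy r 0 with hr | hr | hr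
    · rw [max_eq_right hr.le, hf00]
      apply (hasDerivAt_const r (0:ℝ)).congr_of_eventuallyEq
      filter_upwards [gt_mem_nhds hr] with z hz
      simp only [max_eq_right hz.le, hP00]
    · subst hr
      simp only [max_self, hf00]
      have hl : HasDerivWithinAt (fun r => P₀ (max r 0)) 0 (Iic 0) 0 := by
        apply (hasDerivWithinAt_const (0:ℝ) _ (0:ℝ)).congr
        · intro z hz; simp only [max_eq_right (mem_Iic.1 hz), hP00]
        · simp [hP00]
      have hr : HasDerivWithinAt (fun r => P₀ (max r 0)) 0 (Ici 0) 0 := by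
        have := (hderP 0 (by linarith)).hasDerivWithinAt (s := Ici 0)
        rw [hf00] at this
        apply this.congr
        · intro z hz; simp only [max_eq_left (mem_Ici.1 hz)]
        · simp
      have := hl.union hr
      rw [Iic_union_Ici] at this
      exact hasDerivWithinAt_univ.1 this
    · rw [max_eq_left hr.le]
      apply (hderP r (by linarith)).congr_of_eventuallyEq
      filter_upwards [lt_mem_nhds hr] with z hz
      simp only [max_eq_left hz.le]
  · intro r hr; simp only [max_eq_right hr, hP00]
  · intro r hr
    apply ((hderf r (by linarith)).congr_of_eventuallyEq _).differentiableAt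
    filter_upwards [lt_mem_nhds hr] with z hz
    simp only [max_eq_left hz.le]
  · intro r hr hrM
    have hd : deriv (fun r => f₀ (max r 0)) r = σ * (r + ε) ^ (σ - 1) := by
      apply HasDerivAt.deriv
      apply (hderf r (by linarith)).congr_of_eventuallyEq
      filter_upwards [lt_mem_nhds hr] with z hz
      simp only [max_eq_left hz.le]
    rw [hd, max_eq_left hr.le]
    have hre : 0 < r + ε := by linarith
    have e1 : (r + ε) ^ σ = (r + ε) ^ (σ - 1) * (r + ε) := by
      rw [← Real.rpow_add_one hre.ne']; congr 1; ring
    have e2 : σ * f₀ r - r * (σ * (r + ε) ^ (σ - 1)) =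
        σ * (ε * (r + ε) ^ (σ - 1)) - σ * ε ^ σ := by
      simp only [hf₀]; rw [e1]; ring
    rw [e2]
    have p1 : 0 < ε ^ σ := by positivity
    have p2 : 0 < (r + ε) ^ (σ - 1) := by positivity
    have b1 : σ * (ε * (r + ε) ^ (σ - 1)) < δ / 3 := by
      rcases le_total 1 σ with hs | hs
      · have : (r + ε) ^ (σ - 1) ≤ (M + 1) ^ (σ - 1) :=
          Real.rpow_le_rpow hre.le (by linarith) (by linarith)
        refine lt_of_le_of_lt ?_ h6
        gcongr
      · have : (r + ε) ^ (σ - 1) ≤ ε ^ (σ - 1) :=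
          Real.rpow_le_rpow_of_nonpos hε0 (by linarith) (by linarith)
        have e3 : ε * ε ^ (σ - 1) = ε ^ σ := by
          rw [mul_comm, ← Real.rpow_add_one hε0.ne']; congr 1; ring
        refine lt_of_le_of_lt ?_ h5
        rw [← e3]
        gcongr
    have b2 : 0 < σ * (ε * (r + ε) ^ (σ - 1)) := by positivity
    have b3 : 0 < σ * ε ^ σ := by positivity
    rw [abs_le]; constructor <;> linarith
  · intro r hr
    have h0 : 0 ≤ max r 0 := le_max_right _ _
    have h0M : max r 0 ≤ M := max_le (abs_le.1 hr).2 hM.le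
    have := abs_le.1 (h1 _ ⟨h0, h0M⟩)
    have p1 : 0 < ε ^ σ := by positivity
    simp only [hf₀]
    rw [abs_le]; constructor <;> linarith
  · intro r hr
    have h0 : 0 ≤ max r 0 := le_max_right _ _
    have h0M : max r 0 ≤ M := max_le (abs_le.1 hr).2 hM.le
    have h9 := h2 _ ⟨h0, h0M⟩
    have p1 : 0 < ε ^ σ := by positivity
    have p2 : 0 < ε ^ (σ + 1) := by positivity
    simp only [hP₀, pres]
    have e : ((max r 0 + ε) ^ (σ + 1) - ε ^ (σ + 1)) / (σ + 1) - ε ^ σ * max r 0 -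
        max r 0 ^ (σ + 1) / (σ + 1) = (((max r 0 + ε) ^ (σ + 1) - max r 0 ^ (σ + 1)) -
          ε ^ (σ + 1)) / (σ + 1) - ε ^ σ * max r 0 := by ring
    rw [e]
    have b1 : |((max r 0 + ε) ^ (σ + 1) - max r 0 ^ (σ + 1) - ε ^ (σ + 1)) / (σ + 1)| ≤
        δ / 3 + δ / 3 := by
      rw [abs_div, abs_of_pos (by linarith : 0 < σ + 1)]
      refine (div_le_self (abs_nonneg _) (by linarith)).trans ?_
      refine (abs_sub _ _).trans ?_
      rw [abs_of_pos p2]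
      linarith
    have b2 : |ε ^ σ * max r 0| ≤ δ / 3 := by
      rw [abs_of_nonneg (by positivity)]
      refine le_trans ?_ h4.le
      gcongr
    refine (abs_sub _ _).trans ?_
    linarith

end Regularization

section PointwiseLipschitz

set_option linter.unusedSectionVars false

variable {W F : Type*} [NormedAddCommGroup W] [NormedSpace ℝ W]
  [NormedAddCommGroup F] [NormedSpace ℝ F]

/-- Locally `K`-Lipschitz at every point of `s`, with a uniform constant but no uniform radius. -/
def PtLip (K : ℝ) (F' : W → F) (s : Set W) : Prop :=
  ∀ p ∈ s, ∀ᶠ q in 𝓝[s] p, ‖F' q - F' p‖ ≤ K * ‖q - p‖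

lemma PtLip.mono_const {K K' : ℝ} {f : W → F} {s : Set W} (h : PtLip K f s) (hK : K ≤ K') :
    PtLip K' f s := fun p hp => (h p hp).mono fun q hq => hq.trans (by gcongr)

lemma PtLip.mono {K : ℝ} {f : W → F} {s t : Set W} (h : PtLip K f s) (hts : t ⊆ s) :
    PtLip K f t := fun p hp => (h p (hts hp)).filter_mono (nhdsWithin_mono _ hts)

lemma PtLip.continuousOn {K : ℝ} {f : W → F} {s : Set W} (h : PtLip K f s) :
    ContinuousOn f s := by
  intro p hp
  rw [ContinuousWithinAt, tendsto_iff_norm_sub_tendsto_zero]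
  have h1 : Tendsto (fun q => K * ‖q - p‖) (𝓝[s] p) (𝓝 0) := by
    have : Tendsto (fun q => K * ‖q - p‖) (𝓝 p) (𝓝 (K * ‖p - p‖)) := by
      apply Continuous.tendsto; fun_prop
    rw [sub_self, norm_zero, mul_zero] at this
    exact this.mono_left nhdsWithin_le_nhds
  exact tendsto_of_tendsto_of_tendsto_of_le_of_le' tendsto_const_nhds h1
    (Eventually.of_forall fun _ => norm_nonneg _) (h p hp)

lemma PtLip.lipschitzOnWith {K : ℝ≥0} {f : W → F} {s : Set W} (h : PtLip K f s)
    (hs : Convex ℝ s) : LipschitzOnWith K f s := by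
  apply LipschitzOnWith.of_dist_le_mul
  intro x hx y hy
  rw [dist_comm (f x), dist_comm x, dist_eq_norm, dist_eq_norm]
  apply le_of_forall_pos_le_add
  intro ε hε
  have hseg : ∀ τ ∈ Icc (0:ℝ) 1, x + τ • (y - x) ∈ s := fun τ hτ => hs.add_smul_sub_mem hx hy hτ
  have hcl : Continuous fun τ : ℝ => x + τ • (y - x) := by fun_prop
  have hcont : ContinuousOn (fun τ : ℝ => f (x + τ • (y - x)) - f x) (Icc 0 1) :=
    (h.continuousOn.comp hcl.continuousOn hseg).sub continuousOn_const
  have key := image_norm_le_of_liminf_right_slope_norm_lt_deriv_boundary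
    (f := fun τ : ℝ => f (x + τ • (y - x)) - f x) (f' := fun _ => K * ‖y - x‖)
    (a := 0) (b := 1) hcont ?_ (B := fun τ => (K * ‖y - x‖ + ε) * τ)
    (B' := fun _ => K * ‖y - x‖ + ε) (by simp) (by fun_prop) ?_ ?_
  · have := key (right_mem_Icc.2 zero_le_one)
    simpa using this
  · intro τ hτ r hr
    apply Eventually.frequently
    have h1 := h _ (hseg τ ⟨hτ.1, hτ.2.le⟩)
    have h2 : Tendsto (fun τ : ℝ => x + τ • (y - x)) (𝓝[>] τ) (𝓝[s] (x + τ • (y - x))) := by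
      apply tendsto_nhdsWithin_iff.2
      refine ⟨hcl.continuousAt.tendsto.mono_left nhdsWithin_le_nhds, ?_⟩
      filter_upwards [Ioo_mem_nhdsGT hτ.2] with z hz
      exact hseg z ⟨hτ.1.trans hz.1.le, hz.2.le⟩
    filter_upwards [h2.eventually h1, self_mem_nhdsWithin] with z hz hzτ
    have hzτ' : 0 < z - τ := sub_pos.2 hzτ
    rw [slope_def_field, div_lt_iff₀ hzτ']
    refine lt_of_le_of_lt ?_ (mul_lt_mul_of_pos_right hr hzτ')
    simp only [Function.comp]
    refine (norm_sub_norm_le _ _).trans ?_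
    rw [sub_sub_sub_cancel_right]
    refine hz.trans (le_of_eq ?_)
    rw [add_sub_add_left_eq_sub, ← sub_smul, norm_smul, Real.norm_of_nonneg hzτ'.le]
    ring
  · intro τ _
    simpa using ((hasDerivAt_id τ).const_mul (K * ‖y - x‖ + ε)).hasDerivWithinAt
  · intro τ _ _
    linarith

lemma PtLip.smul {K₁ K₂ C₁ C₂ : ℝ} {g : W → ℝ} {f : W → F} {s : Set W} (hg : PtLip K₁ g s)
    (hf : PtLip K₂ f s) (hgC : ∀ p ∈ s, |g p| ≤ C₁) (hfC : ∀ p ∈ s, ‖f p‖ ≤ C₂) :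
    PtLip (K₁ * C₂ + C₁ * K₂) (fun p => g p • f p) s := by
  intro p hp
  filter_upwards [hg p hp, hf p hp, self_mem_nhdsWithin] with q h1 h2 hq
  have e : g q • f q - g p • f p = (g q - g p) • f q + g p • (f q - f p) := by
    rw [sub_smul, smul_sub]; abel
  rw [e]
  refine (norm_add_le _ _).trans ?_
  rw [norm_smul, norm_smul]
  have a1 : ‖g q - g p‖ * ‖f q‖ ≤ (K₁ * ‖q - p‖) * C₂ :=
    mul_le_mul h1 (hfC q hq) (norm_nonneg _) ((norm_nonneg _).trans h1)
  have a2 : ‖g p‖ * ‖f q - f p‖ ≤ C₁ * (K₂ * ‖q - p‖) :=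
    mul_le_mul (hgC p hp) h2 (norm_nonneg _) ((abs_nonneg _).trans (hgC p hp))
  linarith

lemma PtLip.mul {K₁ K₂ C₁ C₂ : ℝ} {g f : W → ℝ} {s : Set W} (hg : PtLip K₁ g s)
    (hf : PtLip K₂ f s) (hgC : ∀ p ∈ s, |g p| ≤ C₁) (hfC : ∀ p ∈ s, |f p| ≤ C₂) :
    PtLip (K₁ * C₂ + C₁ * K₂) (fun p => g p * f p) s := hg.smul hf hgC hfC

lemma PtLip.add {K₁ K₂ : ℝ} {g f : W → F} {s : Set W} (hg : PtLip K₁ g s)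
    (hf : PtLip K₂ f s) : PtLip (K₁ + K₂) (fun p => g p + f p) s := by
  intro p hp
  filter_upwards [hg p hp, hf p hp] with q h1 h2
  rw [add_sub_add_comm, add_mul]
  exact (norm_add_le _ _).trans (add_le_add h1 h2)

lemma PtLip.sub {K₁ K₂ : ℝ} {g f : W → F} {s : Set W} (hg : PtLip K₁ g s)
    (hf : PtLip K₂ f s) : PtLip (K₁ + K₂) (fun p => g p - f p) s := by
  intro p hp
  filter_upwards [hg p hp, hf p hp] with q h1 h2
  rw [sub_sub_sub_comm, add_mul]
  exact (norm_sub_le _ _).trans (add_le_add h1 h2)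

lemma PtLip.clm_comp {G : Type*} [NormedAddCommGroup G] [NormedSpace ℝ G] {K : ℝ} {f : W → F}
    {s : Set W} (hf : PtLip K f s) (A : F →L[ℝ] G) : PtLip (‖A‖ * K) (fun p => A (f p)) s := by
  intro p hp
  filter_upwards [hf p hp] with q h1
  rw [← map_sub]
  refine (A.le_opNorm _).trans ?_
  rw [mul_assoc]
  gcongr

lemma PtLip.half_norm_sq {F : Type*} [NormedAddCommGroup F] [InnerProductSpace ℝ F] {K C : ℝ}
    {f : W → F} {s : Set W} (hf : PtLip K f s) (hC : ∀ p ∈ s, ‖f p‖ ≤ C) :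
    PtLip (C * K) (fun p => (1 / 2 : ℝ) * ‖f p‖ ^ 2) s := by
  intro p hp
  filter_upwards [hf p hp, self_mem_nhdsWithin] with q h1 hq
  have e : (1 / 2 : ℝ) * ‖f q‖ ^ 2 - 1 / 2 * ‖f p‖ ^ 2 =
      (1 / 2) * (‖f q‖ + ‖f p‖) * (‖f q‖ - ‖f p‖) := by ring
  rw [e, norm_mul]
  have a1 : ‖(1 / 2 : ℝ) * (‖f q‖ + ‖f p‖)‖ ≤ C := by
    rw [Real.norm_of_nonneg (by positivity)]
    linarith [hC q hq, hC p hp]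
  have a2 : ‖‖f q‖ - ‖f p‖‖ ≤ K * ‖q - p‖ := (abs_norm_sub_norm_le _ _).trans h1
  rw [mul_assoc]
  exact mul_le_mul a1 a2 (norm_nonneg _) ((norm_nonneg _).trans a1)

/-- A pointwise Lipschitz function on `{m > 0}`, multiplied by a Lipschitz weight vanishing with
`m`, is pointwise Lipschitz across `{m = 0}`. -/
lemma PtLip.weight_mul {K₁ K₂ C₁ C₂ : ℝ} {m g f : W → ℝ} {s : Set W} (hm : ContinuousOn m s)
    (hg : PtLip K₁ g s)
    (hg0 : ∀ p ∈ s, m p ≤ 0 → g p = 0) (hK₁ : 0 ≤ K₁) (hK₂ : 0 ≤ K₂)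
    (hC₁ : 0 ≤ C₁) (hC₂ : 0 ≤ C₂)
    (hf : PtLip K₂ f (s ∩ {p | 0 < m p})) (hgC : ∀ p ∈ s, |g p| ≤ C₁)
    (hfC : ∀ p ∈ s, 0 < m p → |f p| ≤ C₂) :
    PtLip (K₁ * C₂ + C₁ * K₂) (fun p => g p * f p) s := by
  intro p hp
  by_cases h : 0 < m p
  · have hs : 𝓝[s ∩ {p | 0 < m p}] p = 𝓝[s] p := by
      rw [nhdsWithin_inter']
      apply inf_eq_left.2
      rw [le_principal_iff]
      exact (hm p hp).eventually (lt_mem_nhds h)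
    have := ((hg.mono inter_subset_left).mul hf (fun q hq => hgC q hq.1)
      (fun q hq => hfC q hq.1 hq.2)) p ⟨hp, h⟩
    rwa [hs] at this
  · filter_upwards [hg p hp, self_mem_nhdsWithin] with q h1 hq
    simp only [hg0 p hp (not_lt.1 h), zero_mul, sub_zero] at h1 ⊢
    by_cases h' : 0 < m q
    · rw [norm_mul]
      have : ‖g q‖ * ‖f q‖ ≤ K₁ * ‖q - p‖ * C₂ :=
        mul_le_mul h1 (hfC q hq h') (norm_nonneg _) (by positivity)
      have h3 : 0 ≤ C₁ * K₂ * ‖q - p‖ := by positivity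
      linarith
    · rw [hg0 q hq (not_lt.1 h'), zero_mul, norm_zero]
      positivity

end PointwiseLipschitz

local notation "𝔼" d => EuclideanSpace ℝ (Fin d)

section Cone

variable {d : ℕ}

/-- The truncated backward cone function. -/
noncomputable def cone (t₀ : ℝ) (x₀ : 𝔼 d) (ρ S : ℝ) (p : ℝ × 𝔼 d) : ℝ :=
  max (ρ - ‖p.2 - x₀‖ - S * (p.1 - t₀)) 0

/-- Cutting off by the cone and by `t ≥ t₀`. -/
noncomputable def cut (t₀ : ℝ) (φ G : ℝ × (𝔼 d) → ℝ) (p : ℝ × 𝔼 d) : ℝ :=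
  if t₀ ≤ p.1 then G p * φ p else 0

lemma cone_nonneg (t₀ : ℝ) (x₀ : 𝔼 d) (ρ S : ℝ) (p : ℝ × 𝔼 d) : 0 ≤ cone t₀ x₀ ρ S p :=
  le_max_right _ _

lemma cone_lipschitz (t₀ : ℝ) (x₀ : 𝔼 d) (ρ : ℝ) {S : ℝ} (hS : 0 ≤ S) (p q : ℝ × 𝔼 d) :
    |cone t₀ x₀ ρ S q - cone t₀ x₀ ρ S p| ≤ (1 + S) * ‖q - p‖ := by
  unfold cone
  refine (abs_max_sub_max_le_abs _ _ _).trans ?_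
  have h1 : |‖q.2 - x₀‖ - ‖p.2 - x₀‖| ≤ ‖q - p‖ := by
    refine (abs_norm_sub_norm_le _ _).trans ?_
    rw [sub_sub_sub_cancel_right]
    exact norm_snd_le (q - p)
  have h2 : |q.1 - p.1| ≤ ‖q - p‖ := norm_fst_le (q - p)
  have e : ρ - ‖q.2 - x₀‖ - S * (q.1 - t₀) - (ρ - ‖p.2 - x₀‖ - S * (p.1 - t₀)) =
      -(‖q.2 - x₀‖ - ‖p.2 - x₀‖) - S * (q.1 - p.1) := by ring
  rw [e]
  refine (abs_sub _ _).trans ?_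
  rw [abs_neg, abs_mul, abs_of_nonneg hS]
  nlinarith

lemma continuous_cone (t₀ : ℝ) (x₀ : 𝔼 d) (ρ S : ℝ) : Continuous (cone t₀ x₀ ρ S) := by
  unfold cone; fun_prop

lemma cone_le (t₀ : ℝ) (x₀ : 𝔼 d) {ρ S : ℝ} (hρ : 0 ≤ ρ) (hS : 0 ≤ S) {p : ℝ × 𝔼 d}
    (hp : t₀ ≤ p.1) : cone t₀ x₀ ρ S p ≤ ρ := by
  unfold cone
  have : 0 ≤ S * (p.1 - t₀) := mul_nonneg hS (by linarith)
  exact max_le (by linarith [norm_nonneg (p.2 - x₀)]) hρ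

lemma mem_of_cone_pos {t₀ t₁ : ℝ} {x₀ : 𝔼 d} {ρ ρ' S : ℝ} (hS : 0 < S) (hρ : ρ' ≤ ρ)
    (ht : ρ' ≤ S * (t₁ - t₀)) {p : ℝ × 𝔼 d} (hp : t₀ ≤ p.1) (h : 0 < cone t₀ x₀ ρ' S p) :
    p ∈ Ico t₀ t₁ ×ˢ ball x₀ ρ := by
  have h1 : 0 < ρ' - ‖p.2 - x₀‖ - S * (p.1 - t₀) := by
    by_contra h'
    rw [cone, max_eq_right (not_lt.1 h')] at h
    exact lt_irrefl _ h
  have h2 : 0 ≤ S * (p.1 - t₀) := mul_nonneg hS.le (by linarith)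
  refine ⟨⟨hp, ?_⟩, ?_⟩
  · have : S * (p.1 - t₀) < S * (t₁ - t₀) := by linarith [norm_nonneg (p.2 - x₀)]
    have := lt_of_mul_lt_mul_left this hS.le
    linarith
  · rw [mem_ball, dist_eq_norm]; linarith

lemma cut_lipschitz {t₀ t₁ : ℝ} {x₀ : 𝔼 d} {ρ ρ' S : ℝ} (hS : 0 < S) (hρ : ρ' ≤ ρ)
    (hρ0 : 0 ≤ ρ') (ht : ρ' ≤ S * (t₁ - t₀)) {G : ℝ × (𝔼 d) → ℝ} {K C : ℝ} (hC : 0 ≤ C)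
    (hK : 0 ≤ K)
    (hG : PtLip K G (Ico t₀ t₁ ×ˢ ball x₀ ρ)) (hGC : ∀ p ∈ Ico t₀ t₁ ×ˢ ball x₀ ρ, |G p| ≤ C)
    (hG0 : ∀ p : ℝ × 𝔼 d, p.1 = t₀ → 0 < cone t₀ x₀ ρ' S p → G p = 0) :
    ∃ K' : ℝ≥0, LipschitzWith K' (cut t₀ (cone t₀ x₀ ρ' S) G) := by
  set φ := cone t₀ x₀ ρ' S with hφ
  have hcont : Continuous φ := continuous_cone _ _ _ _
  suffices h : PtLip (K * ρ' + C * (1 + S)) (cut t₀ φ G) univ by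
    have hnn : 0 ≤ K * ρ' + C * (1 + S) := by positivity
    refine ⟨(K * ρ' + C * (1 + S)).toNNReal, ?_⟩
    rw [← lipschitzOnWith_univ]
    refine PtLip.lipschitzOnWith ?_ convex_univ
    rwa [Real.coe_toNNReal _ hnn]
  have hsmall : ∀ q : ℝ × 𝔼 d, |cut t₀ φ G q| ≤ C * φ q := by
    intro q
    have hφ0 : 0 ≤ φ q := cone_nonneg _ _ _ _ _
    unfold cut
    split_ifs with h
    · rcases hφ0.eq_or_lt with h0 | h0
      · rw [← h0]; simp
      · rw [abs_mul, abs_of_nonneg hφ0]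
        exact mul_le_mul_of_nonneg_right (hGC q (mem_of_cone_pos hS hρ ht h h0)) hφ0
    · rw [abs_zero]; positivity
  intro p _
  rw [nhdsWithin_univ]
  rcases lt_or_ge p.1 t₀ with hpt | hpt
  · have : ∀ᶠ q : ℝ × 𝔼 d in 𝓝 p, q.1 < t₀ :=
      continuous_fst.continuousAt.eventually (gt_mem_nhds hpt)
    filter_upwards [this] with q hq
    rw [cut, cut, if_neg (not_le.2 hq), if_neg (not_le.2 hpt), sub_zero, norm_zero]
    positivity
  rcases (cone_nonneg t₀ x₀ ρ' S p).eq_or_lt with h0 | h0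
  · refine Eventually.of_forall fun q => ?_
    have e : cut t₀ φ G p = 0 := by
      have := hsmall p
      rw [hφ, ← h0, mul_zero] at this
      exact abs_nonpos_iff.1 this
    rw [e, sub_zero]
    refine (hsmall q).trans ?_
    have h1 := cone_lipschitz t₀ x₀ ρ' hS.le p q
    rw [← h0, sub_zero, abs_of_nonneg (cone_nonneg _ _ _ _ _)] at h1
    have h2 : C * φ q ≤ C * ((1 + S) * ‖q - p‖) := mul_le_mul_of_nonneg_left h1 hC
    have h3 : 0 ≤ K * ρ' * ‖q - p‖ := by positivity
    linarith
  · have hpU := mem_of_cone_pos hS hρ ht hpt h0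
    have h1 := hG p hpU
    rw [eventually_nhdsWithin_iff] at h1
    have h2 : ∀ᶠ q in 𝓝 p, 0 < φ q := hcont.continuousAt.eventually (lt_mem_nhds h0)
    have h3 : ∀ᶠ q : ℝ × 𝔼 d in 𝓝 p, t₀ < p.1 → t₀ < q.1 := by
      by_cases h : t₀ < p.1
      · filter_upwards [continuous_fst.continuousAt.eventually (lt_mem_nhds h)] with q hq _
        exact hq
      · exact Eventually.of_forall fun q h' => absurd h' h
    filter_upwards [h1, h2, h3] with q hq1 hq2 hq3
    by_cases hqt : t₀ ≤ q.1
    · have hqU := mem_of_cone_pos hS hρ ht hqt hq2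
      rw [cut, cut, if_pos hqt, if_pos hpt]
      have e : G q * φ q - G p * φ p = (G q - G p) * φ q + G p * (φ q - φ p) := by ring
      rw [e]
      refine (norm_add_le _ _).trans ?_
      rw [norm_mul, norm_mul]
      have a1 : ‖G q - G p‖ * ‖φ q‖ ≤ K * ‖q - p‖ * ρ' := by
        refine mul_le_mul (hq1 hqU) ?_ (norm_nonneg _) (by positivity)
        rw [Real.norm_of_nonneg hq2.le]
        exact cone_le _ _ hρ0 hS.le hqt
      have a2 : ‖G p‖ * ‖φ q - φ p‖ ≤ C * ((1 + S) * ‖q - p‖) :=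
        mul_le_mul (hGC p hpU) (cone_lipschitz _ _ _ hS.le _ _) (norm_nonneg _) hC
      linarith
    · have hpe : p.1 = t₀ := by
        by_contra hne
        exact hqt (hq3 (lt_of_le_of_ne hpt (Ne.symm hne))).le
      rw [cut, cut, if_neg hqt, if_pos hpt, hG0 p hpe h0]
      simp only [zero_mul, sub_zero, norm_zero]
      positivity

lemma cut_eq_zero_of_notMem {t₀ t₁ : ℝ} {x₀ : 𝔼 d} {ρ ρ' S : ℝ} (hS : 0 < S) (hρ : ρ' ≤ ρ)
    (ht : ρ' ≤ S * (t₁ - t₀)) (G : ℝ × (𝔼 d) → ℝ) {p : ℝ × 𝔼 d}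
    (hp : p ∉ Icc t₀ t₁ ×ˢ closedBall x₀ ρ) : cut t₀ (cone t₀ x₀ ρ' S) G p = 0 := by
  unfold cut
  split_ifs with h
  · rcases (cone_nonneg t₀ x₀ ρ' S p).eq_or_lt with h0 | h0
    · rw [← h0, mul_zero]
    · have := mem_of_cone_pos hS hρ ht h h0
      exact absurd ⟨Ico_subset_Icc_self this.1, ball_subset_closedBall this.2⟩ hp
  · rfl

lemma isCompact_box (t₀ t₁ : ℝ) (x₀ : 𝔼 d) (ρ : ℝ) :
    IsCompact (Icc t₀ t₁ ×ˢ closedBall x₀ ρ) :=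
  isCompact_Icc.prod (isCompact_closedBall _ _)

instance isAddHaarMeasure_volume_spacetime :
    (volume : Measure (ℝ × 𝔼 d)).IsAddHaarMeasure :=
  Measure.prod.instIsAddHaarMeasure volume volume

lemma integral_fderiv_eq_zero {Z : ℝ × (𝔼 d) → ℝ} {K : ℝ≥0} (hZ : LipschitzWith K Z)
    (hc : HasCompactSupport Z) (ξ : ℝ × 𝔼 d) :
    Integrable (fun p => fderiv ℝ Z p ξ) ∧ ∫ p, fderiv ℝ Z p ξ = 0 := by
  have hae : (fun p => lineDeriv ℝ Z p ξ) =ᵐ[volume] fun p => fderiv ℝ Z p ξ := by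
    filter_upwards [hZ.ae_differentiableAt (μ := volume)] with p hp
    exact hp.lineDeriv_eq_fderiv
  constructor
  · refine Integrable.congr ?_ hae
    have hm := (hZ.memLp_lineDeriv (μ := volume) ξ)
    have hsupp : Function.support (fun p => lineDeriv ℝ Z p ξ) ⊆ tsupport Z := by
      intro p hp
      by_contra hnot
      apply hp
      have : Z =ᶠ[𝓝 p] fun _ => 0 := by
        have := (isClosed_tsupport Z).isOpen_compl.mem_nhds hnot
        filter_upwards [this] with q hq
        exact image_eq_zero_of_notMem_tsupport hq
      have h2 := this.lineDeriv_eq (v := ξ) (𝕜 := ℝ)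
      show lineDeriv ℝ Z p ξ = 0
      rw [h2]
      simp [lineDeriv]
    have h1 : MemLp (fun p => lineDeriv ℝ Z p ξ) ⊤ (volume.restrict (tsupport Z)) :=
      hm.restrict _
    have : IsFiniteMeasure ((volume : Measure (ℝ × 𝔼 d)).restrict (tsupport Z)) :=
      ⟨by rw [Measure.restrict_apply_univ]; exact hc.isCompact.measure_lt_top⟩
    have h2 : IntegrableOn (fun p => lineDeriv ℝ Z p ξ) (tsupport Z) :=
      h1.integrable le_top
    exact (integrableOn_iff_integrable_of_support_subset hsupp).1 h2
  · rw [← integral_congr_ae hae]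
    have h := LipschitzWith.integral_lineDeriv_mul_eq (μ := (volume : Measure (ℝ × 𝔼 d)))
      (LipschitzWith.const (1:ℝ)) hZ hc (-ξ)
    simp only [neg_neg, mul_one] at h
    rw [← h]
    simp [lineDeriv]

end Cone

section EnergyAlgebra

set_option maxHeartbeats 2000000 in
/-- The pointwise algebra behind the relative energy inequality: the regularized source and flux
terms are absorbed by the cone slope `S`. -/
lemma energy_algebra {σ κ M N B K D S ρ δ φ f fR PR Pm m R w t₁ t₂ t₃ t₄ dv s y : ℝ}
    (hσ : 0 < σ) (hκσ : κ * σ = 1) (hκ : 0 < κ) (hN : 0 ≤ N) (hB : 0 ≤ B)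
    (hK : 0 ≤ K) (hD : 0 ≤ D) (hδ : 0 ≤ δ)
    (hm : 0 ≤ m) (hmM : m ≤ M) (hRM : |R| ≤ M) (hw : 0 ≤ w) (hwN : w ≤ 2 * N)
    (hf0 : 0 ≤ f) (hf : |f - m ^ σ| ≤ δ) (hfR : |fR - (max R 0) ^ σ| ≤ δ)
    (hPR : |PR - pres σ R| ≤ δ) (hPm : |Pm - pres σ m| ≤ δ)
    (ht₁ : |t₁| ≤ κ * δ * (2 * N ^ 2 + 2 * M) * (D * K))
    (ht₂ : |t₂| ≤ B * √(max (-R) 0) * w) (ht₃ : |t₃| ≤ K * w ^ 2)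
    (ht₄ : |t₄| ≤ B * max (-R) 0) (hdv : |dv| ≤ D * K)
    (hs₁ : S - N ≤ s) (hs₂ : s ≤ S + N) (hy : |y| ≤ w)
    (hφ : 0 ≤ φ) (hφρ : φ ≤ ρ) (hρ1 : ρ ≤ 1) (hρ : (2 * B + 2 * K + D * K * κ) * ρ ≤ 1)
    (hS : 3 * N + 3 + cEnt σ * M / 2 ≤ S) :
    φ * (t₁ - f * t₂ - f * t₃ - f * t₄ + dv * (κ * (f * R - fR * R) + PR - Pm)) +
      (f * (1 / 2 * w ^ 2 + m - R) + (PR - Pm)) * (-s) - (PR - Pm) * y ≤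
      -(1 / 2 * m ^ σ * w ^ 2 + relEnt σ m R) +
        (κ * (2 * N ^ 2 + 2 * M) * (D * K) + B * (4 * N ^ 2 + M) + 4 * N ^ 2 * K + B * M +
          D * K * (2 * κ * M + 2) + (S + N) * (2 * N ^ 2 + 2 * M + 2) + 4 * N) * δ := by
  have hM : 0 ≤ M := hm.trans hmM
  set X := m ^ σ with hX
  set A := relEnt σ m R with hA
  set n := max (-R) 0 with hn
  set E := 1 / 2 * X * w ^ 2 with hE
  have hX0 : 0 ≤ X := by positivity
  have hE0 : 0 ≤ E := by positivity
  have hA0 : 0 ≤ A := relEnt_nonneg hσ hm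
  have hn0 : 0 ≤ n := le_max_right _ _
  have hR1 := abs_le.1 hRM
  have hnM : n ≤ M := max_le (by linarith) hM
  have hXn : X * n ≤ A := mul_negPart_le_relEnt hσ hm
  have hcoer : X * (R - m) ^ 2 ≤ cEnt σ * M * A := relEnt_coercive hσ hm hmM hRM
  have hw2 : w ^ 2 ≤ 4 * N ^ 2 := by
    have h0 := pow_le_pow_left₀ hw hwN 2
    linarith [mul_pow 2 N 2]
  have hf1 := abs_le.1 hf
  have hfX : f ≤ X + δ := by linarith
  have hDK : 0 ≤ D * K := by positivity
  -- second term
  have b2 : |f * t₂| ≤ B * (E + A) + δ * (B * (4 * N ^ 2 + M)) := by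
    rw [abs_mul, abs_of_nonneg hf0]
    have h1 : √n * w ≤ (w ^ 2 + n) / 2 := by
      have h0 := sq_nonneg (√n - w)
      rw [sub_sq, Real.sq_sqrt hn0] at h0
      linarith
    have h2 : |t₂| ≤ B * ((w ^ 2 + n) / 2) := by
      refine ht₂.trans ?_
      rw [mul_assoc]
      gcongr
    calc f * |t₂| ≤ (X + δ) * (B * ((w ^ 2 + n) / 2)) := by gcongr
      _ = B * (E + X * n / 2) + δ * (B * ((w ^ 2 + n) / 2)) := by rw [hE]; ring
      _ ≤ B * (E + A) + δ * (B * (4 * N ^ 2 + M)) := by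
        gcongr
        · linarith
        · linarith [sq_nonneg w]
  have b3 : |f * t₃| ≤ 2 * K * E + δ * (4 * N ^ 2 * K) := by
    rw [abs_mul, abs_of_nonneg hf0]
    calc f * |t₃| ≤ (X + δ) * (K * w ^ 2) := by gcongr
      _ = 2 * K * E + δ * (w ^ 2 * K) := by rw [hE]; ring
      _ ≤ _ := by gcongr
  have b4 : |f * t₄| ≤ B * A + δ * (B * M) := by
    rw [abs_mul, abs_of_nonneg hf0]
    calc f * |t₄| ≤ (X + δ) * (B * n) := by gcongr
      _ = B * (X * n) + δ * (B * n) := by ring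
      _ ≤ _ := by gcongr
  -- pressure bracket
  have hbr : κ * (X * R - (max R 0) ^ σ * R) + pres σ R - pres σ m = -κ * A := by
    have h1 : X * m = (σ + 1) * pres σ m := by
      rw [pres_eq_mul hσ hm, ← hX]; field_simp
    have h2 : (max R 0) ^ σ * R = (σ + 1) * pres σ R := by
      rcases le_total R 0 with h | h
      · rw [pres_of_nonpos hσ h, max_eq_right h, Real.zero_rpow hσ.ne']; simp
      · rw [pres_eq_mul hσ h, max_eq_left h]; field_simp
    rw [hA, relEnt, h2]
    have e1 : κ * ((σ + 1) * pres σ R) = pres σ R + κ * pres σ R := by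
      linear_combination (pres σ R) * hκσ
    have e2 : κ * (X * m) = pres σ m + κ * pres σ m := by
      rw [h1]; linear_combination (pres σ m) * hκσ
    linear_combination -e1 + e2
  have hbr2 : |κ * (f * R - fR * R) + PR - Pm| ≤ κ * A + δ * (2 * κ * M + 2) := by
    have e : κ * (f * R - fR * R) + PR - Pm = -κ * A + (κ * ((f - X) * R) -
        κ * ((fR - (max R 0) ^ σ) * R) + (PR - pres σ R) - (Pm - pres σ m)) := by
      rw [← hbr]; ring
    rw [e]
    have g1 : |κ * ((f - X) * R)| ≤ κ * (δ * M) := by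
      rw [abs_mul, abs_mul, abs_of_pos hκ]; gcongr
    have g2 : |κ * ((fR - (max R 0) ^ σ) * R)| ≤ κ * (δ * M) := by
      rw [abs_mul, abs_mul, abs_of_pos hκ]; gcongr
    have g3 : 0 ≤ κ * A := by positivity
    rw [abs_le] at g1 g2 hPR hPm ⊢
    constructor <;> linarith
  have b5 : |dv * (κ * (f * R - fR * R) + PR - Pm)| ≤
      D * K * κ * A + δ * (D * K * (2 * κ * M + 2)) := by
    rw [abs_mul]
    calc _ ≤ D * K * (κ * A + δ * (2 * κ * M + 2)) := by gcongr
      _ = _ := by ring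
  have hsrc : φ * (t₁ - f * t₂ - f * t₃ - f * t₄ + dv * (κ * (f * R - fR * R) + PR - Pm)) ≤
      (E + A) + δ * (κ * (2 * N ^ 2 + 2 * M) * (D * K) + B * (4 * N ^ 2 + M) + 4 * N ^ 2 * K +
        B * M + D * K * (2 * κ * M + 2)) := by
    have hφ1 : φ ≤ 1 := hφρ.trans hρ1
    set C₂ := κ * (2 * N ^ 2 + 2 * M) * (D * K) + B * (4 * N ^ 2 + M) + 4 * N ^ 2 * K +
        B * M + D * K * (2 * κ * M + 2) with hC₂
    have hC₂0 : 0 ≤ C₂ := by positivity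
    have hb : t₁ - f * t₂ - f * t₃ - f * t₄ + dv * (κ * (f * R - fR * R) + PR - Pm) ≤
        (2 * B + 2 * K + D * K * κ) * (E + A) + δ * C₂ := by
      have h1 := (abs_le.1 ht₁).2
      have h2 := (abs_le.1 b2).1
      have h3 := (abs_le.1 b3).1
      have h4 := (abs_le.1 b4).1
      have h5 := (abs_le.1 b5).2
      have e1 : 0 ≤ B * E := by positivity
      have e2 : 0 ≤ K * A := by positivity
      have e3 : 0 ≤ D * K * κ * E := by positivity
      rw [hC₂]
      linarith
    calc _ ≤ φ * ((2 * B + 2 * K + D * K * κ) * (E + A) + δ * C₂) := by gcongr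
      _ = ((2 * B + 2 * K + D * K * κ) * φ) * (E + A) + φ * (δ * C₂) := by ring
      _ ≤ 1 * (E + A) + 1 * (δ * C₂) := by
        gcongr
        refine le_trans ?_ hρ
        gcongr
      _ = _ := by ring
  -- flux terms
  have hH : |1 / 2 * w ^ 2 + m - R| ≤ 2 * N ^ 2 + 2 * M := by
    rw [abs_le]; constructor <;> linarith [sq_nonneg w, sq_nonneg N]
  have hsum : |f * (1 / 2 * w ^ 2 + m - R) + (PR - Pm) - (E + A)| ≤
      δ * (2 * N ^ 2 + 2 * M + 2) := by
    have e : f * (1 / 2 * w ^ 2 + m - R) + (PR - Pm) - (E + A) =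
        (f - X) * (1 / 2 * w ^ 2 + m - R) + (PR - pres σ R) - (Pm - pres σ m) := by
      rw [hE, hA, relEnt]; ring
    rw [e]
    have g1 : |(f - X) * (1 / 2 * w ^ 2 + m - R)| ≤ δ * (2 * N ^ 2 + 2 * M) := by
      rw [abs_mul]; gcongr
    rw [abs_le] at g1 hPR hPm ⊢
    constructor <;> linarith
  have hcM : 0 ≤ cEnt σ * M := mul_nonneg (cEnt_pos hσ).le hM
  have hs0 : 0 ≤ s := by linarith
  have hfl1 : (f * (1 / 2 * w ^ 2 + m - R) + (PR - Pm)) * (-s) ≤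
      -(S - N) * (E + A) + (S + N) * (2 * N ^ 2 + 2 * M + 2) * δ := by
    have g := (abs_le.1 hsum).1
    have g1 : (E + A - δ * (2 * N ^ 2 + 2 * M + 2)) * s ≤
        (f * (1 / 2 * w ^ 2 + m - R) + (PR - Pm)) * s := by
      gcongr; linarith
    have g2 : (S - N) * (E + A) ≤ s * (E + A) := by gcongr
    have g3 : δ * (2 * N ^ 2 + 2 * M + 2) * s ≤ δ * (2 * N ^ 2 + 2 * M + 2) * (S + N) := by gcongr
    linarith
  have hfl2 : -((PR - Pm) * y) ≤ (2 * N + cEnt σ * M / 2) * A + E + 4 * N * δ := by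
    have e : |PR - Pm| ≤ A + X * |R - m| + 2 * δ := by
      have e' : PR - Pm = A + X * (R - m) + (PR - pres σ R) - (Pm - pres σ m) := by
        rw [hA, relEnt]; ring
      have g1 : |X * (R - m)| = X * |R - m| := by rw [abs_mul, abs_of_nonneg hX0]
      have g2 := abs_le.1 g1.le
      rw [e', abs_le]
      rw [abs_le] at hPR hPm
      constructor <;> linarith
    have h1 : -((PR - Pm) * y) ≤ |PR - Pm| * |y| := by
      rw [← abs_mul]; exact neg_le_abs _
    have h2 : |PR - Pm| * |y| ≤ (A + X * |R - m| + 2 * δ) * w := by gcongr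
    have h3 : X * |R - m| * w ≤ X * (R - m) ^ 2 / 2 + E := by
      have : |R - m| * w ≤ (R - m) ^ 2 / 2 + w ^ 2 / 2 := by
        have h0 := sq_nonneg (|R - m| - w)
        rw [sub_sq, sq_abs] at h0
        linarith
      calc X * |R - m| * w = X * (|R - m| * w) := by ring
        _ ≤ X * ((R - m) ^ 2 / 2 + w ^ 2 / 2) := by gcongr
        _ = _ := by rw [hE]; ring
    have h4 : A * w ≤ A * (2 * N) := by gcongr
    have h5 : δ * w ≤ δ * (2 * N) := by gcongr
    linarith
  have hEA : 0 ≤ E + A := by positivity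
  have hfin : (E + A) + -(S - N) * (E + A) + ((2 * N + cEnt σ * M / 2) * A + E) ≤ -(E + A) := by
    have h1 : (3 * N + 3 + cEnt σ * M / 2) * (E + A) ≤ S * (E + A) := by gcongr
    have h2 : 0 ≤ (2 * N + cEnt σ * M / 2) * E := by positivity
    linarith
  linarith

end EnergyAlgebra

section Flux

variable {d : ℕ}

/-- The spatial divergence of a space-time dependent vector field. -/
noncomputable def sdiv (F : ℝ × (𝔼 d) → 𝔼 d) (p : ℝ × 𝔼 d) : ℝ :=
  ∑ i, @inner ℝ _ _ (fderiv ℝ F p (0, EuclideanSpace.single i 1)) (EuclideanSpace.single i 1)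

/-- The space-time divergence of the cut-off flux `φ α (1, u)`. -/
noncomputable def fluxDiv (t₀ : ℝ) (φ α : ℝ × (𝔼 d) → ℝ) (u : ℝ × (𝔼 d) → 𝔼 d)
    (p : ℝ × 𝔼 d) : ℝ :=
  fderiv ℝ (cut t₀ φ α) p (1, 0) +
    ∑ j, fderiv ℝ (cut t₀ φ (fun q => α q * u q j)) p (0, EuclideanSpace.single j 1)

lemma sum_coord_smul_single (x : 𝔼 d) : ∑ j, x j • EuclideanSpace.single j (1:ℝ) = x := by
  have := (EuclideanSpace.basisFun (Fin d) ℝ).sum_repr x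
  simpa using this

lemma sum_coord_mul_apply (L : ℝ × (𝔼 d) →L[ℝ] ℝ) (x : 𝔼 d) :
    ∑ j, x j * L (0, EuclideanSpace.single j (1:ℝ)) = L (0, x) := by
  conv_rhs => rw [← sum_coord_smul_single x]
  have : ((0:ℝ), ∑ j, x j • EuclideanSpace.single j (1:ℝ)) =
      ∑ j, x j • ((0:ℝ), (EuclideanSpace.single j (1:ℝ) : 𝔼 d)) := by
    ext1
    · simp [Prod.fst_sum]
    · simp [Prod.snd_sum]
  rw [this, map_sum]
  exact Finset.sum_congr rfl fun j _ => by rw [map_smul, smul_eq_mul]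

lemma abs_sdiv_le {F : ℝ × (𝔼 d) → 𝔼 d} {p : ℝ × 𝔼 d} {K : ℝ} (h : ‖fderiv ℝ F p‖ ≤ K) :
    |sdiv F p| ≤ d * K := by
  unfold sdiv
  refine (Finset.abs_sum_le_sum_abs _ _).trans ?_
  have : ∀ i ∈ (Finset.univ : Finset (Fin d)), |@inner ℝ _ _
      (fderiv ℝ F p (0, EuclideanSpace.single i 1)) (EuclideanSpace.single i (1:ℝ))| ≤ K := by
    intro i _
    refine (abs_real_inner_le_norm _ _).trans ?_
    have h1 := (fderiv ℝ F p).le_opNorm (0, EuclideanSpace.single i 1)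
    have h2 : ‖((0:ℝ), (EuclideanSpace.single i 1 : 𝔼 d))‖ = 1 := by
      simp [Prod.norm_def]
    rw [h2, mul_one] at h1
    simp only [PiLp.norm_single, norm_one, mul_one]
    exact h1.trans h
  refine (Finset.sum_le_sum this).trans ?_
  simp

lemma cut_eventuallyEq {t₀ : ℝ} {φ : ℝ × (𝔼 d) → ℝ} (α : ℝ × (𝔼 d) → ℝ) {p : ℝ × 𝔼 d}
    (hp : t₀ < p.1) : cut t₀ φ α =ᶠ[𝓝 p] fun q => α q * φ q := by
  have : ∀ᶠ q : ℝ × 𝔼 d in 𝓝 p, t₀ < q.1 :=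
    continuous_fst.continuousAt.eventually (lt_mem_nhds hp)
  filter_upwards [this] with q hq
  rw [cut, if_pos hq.le]

lemma fluxDiv_eq {t₀ : ℝ} {φ α : ℝ × (𝔼 d) → ℝ} {u : ℝ × (𝔼 d) → 𝔼 d} {p : ℝ × 𝔼 d}
    (hp : t₀ < p.1) (hφ : DifferentiableAt ℝ φ p) (hα : DifferentiableAt ℝ α p)
    (hu : DifferentiableAt ℝ u p) :
    fluxDiv t₀ φ α u p =
      φ p * (fderiv ℝ α p (1, u p) + α p * sdiv u p) + α p * fderiv ℝ φ p (1, u p) := by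
  have huj : ∀ j, HasFDerivAt (fun q => u q j)
      ((EuclideanSpace.proj j : (𝔼 d) →L[ℝ] ℝ).comp (fderiv ℝ u p)) p := fun j =>
    (EuclideanSpace.proj j : (𝔼 d) →L[ℝ] ℝ).hasFDerivAt.comp p hu.hasFDerivAt
  unfold fluxDiv
  rw [(cut_eventuallyEq α hp).fderiv_eq, (hα.hasFDerivAt.fun_mul hφ.hasFDerivAt).fderiv]
  have e : ∀ j, fderiv ℝ (cut t₀ φ (fun q => α q * u q j)) p (0, EuclideanSpace.single j 1) =
      φ p * (u p j * fderiv ℝ α p (0, EuclideanSpace.single j 1)) +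
      φ p * α p * @inner ℝ _ _ (fderiv ℝ u p (0, EuclideanSpace.single j 1))
        (EuclideanSpace.single j 1) +
      α p * (u p j * fderiv ℝ φ p (0, EuclideanSpace.single j 1)) := by
    intro j
    rw [(cut_eventuallyEq _ hp).fderiv_eq,
      ((hα.hasFDerivAt.fun_mul (huj j)).fun_mul hφ.hasFDerivAt).fderiv]
    simp only [_root_.add_apply, _root_.smul_apply, ContinuousLinearMap.comp_apply,
      smul_eq_mul, EuclideanSpace.inner_single_right, one_mul, conj_trivial]
    have e2 : ∀ z : 𝔼 d, (EuclideanSpace.proj j : (𝔼 d) →L[ℝ] ℝ) z = z j := fun _ => rfl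
    rw [e2]
    ring
  simp only [e, Finset.sum_add_distrib, ← Finset.mul_sum, sum_coord_mul_apply]
  have h1 : ((1:ℝ), u p) = (1, 0) + (0, u p) := by simp
  rw [h1, map_add, map_add]
  simp only [_root_.add_apply, _root_.smul_apply, smul_eq_mul, sdiv]
  ring

lemma hasFDerivAt_zero_of_le {W : Type*} [NormedAddCommGroup W] [NormedSpace ℝ W]
    {Z g : W → ℝ} {p : W} {C : ℝ} (hg : DifferentiableAt ℝ g p) (hgp : g p = 0)
    (hgn : ∀ᶠ q in 𝓝 p, 0 ≤ g q) (hZ : ∀ᶠ q in 𝓝 p, |Z q| ≤ C * g q) :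
    HasFDerivAt Z (0 : W →L[ℝ] ℝ) p := by
  have hmin : IsLocalMin g p := by
    filter_upwards [hgn] with q hq
    rw [hgp]; exact hq
  have h0 : fderiv ℝ g p = 0 := hmin.fderiv_eq_zero
  have hd := hg.hasFDerivAt
  rw [h0] at hd
  have hZp : Z p = 0 := by
    have := hZ.self_of_nhds
    rw [hgp, mul_zero] at this
    exact abs_nonpos_iff.1 this
  rw [hasFDerivAt_iff_isLittleO] at hd ⊢
  simp only [hgp, hZp, sub_zero, _root_.zero_apply] at hd ⊢
  refine Asymptotics.IsBigO.trans_isLittleO ?_ hd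
  apply Asymptotics.IsBigO.of_bound |C|
  filter_upwards [hZ, hgn] with q hq hq0
  rw [Real.norm_eq_abs, Real.norm_eq_abs, abs_of_nonneg hq0]
  exact hq.trans (mul_le_mul_of_nonneg_right (le_abs_self _) hq0)

lemma fluxDiv_eq_zero {t₀ : ℝ} {φ α : ℝ × (𝔼 d) → ℝ} {u : ℝ × (𝔼 d) → 𝔼 d} {p : ℝ × 𝔼 d}
    (h0 : HasFDerivAt (cut t₀ φ α) (0 : ℝ × (𝔼 d) →L[ℝ] ℝ) p)
    (hj : ∀ j, HasFDerivAt (cut t₀ φ (fun q => α q * u q j)) (0 : ℝ × (𝔼 d) →L[ℝ] ℝ) p) :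
    fluxDiv t₀ φ α u p = 0 := by
  unfold fluxDiv
  rw [h0.fderiv]
  simp [fun j => (hj j).fderiv]

lemma integral_fluxDiv {t₀ : ℝ} {φ α : ℝ × (𝔼 d) → ℝ} {u : ℝ × (𝔼 d) → 𝔼 d}
    {Q : Set (ℝ × 𝔼 d)} (hQ : IsCompact Q) (hcut : ∀ G, ∀ p ∉ Q, cut t₀ φ G p = 0)
    (h0 : ∃ K : ℝ≥0, LipschitzWith K (cut t₀ φ α))
    (hj : ∀ j, ∃ K : ℝ≥0, LipschitzWith K (cut t₀ φ (fun q => α q * u q j))) :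
    Integrable (fluxDiv t₀ φ α u) ∧ ∫ p, fluxDiv t₀ φ α u p = 0 := by
  have hc : ∀ G, HasCompactSupport (cut t₀ φ G) := fun G => HasCompactSupport.intro hQ (hcut G)
  obtain ⟨K₀, hK₀⟩ := h0
  choose K hK using hj
  have i0 := integral_fderiv_eq_zero hK₀ (hc _) (1, 0)
  have ij := fun j => integral_fderiv_eq_zero (hK j) (hc _) (0, EuclideanSpace.single j 1)
  have isum := integrable_finsetSum Finset.univ (fun j _ => (ij j).1)
  refine ⟨i0.1.add isum, ?_⟩
  unfold fluxDiv
  rw [integral_add i0.1 isum, i0.2, integral_finsetSum _ (fun j _ => (ij j).1)]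
  simp [fun j => (ij j).2]

lemma cone_deriv {t₀ : ℝ} {x₀ : 𝔼 d} {ρ S : ℝ} {p : ℝ × 𝔼 d}
    (hp : 0 < cone t₀ x₀ ρ S p) (hd : DifferentiableAt ℝ (cone t₀ x₀ ρ S) p) :
    fderiv ℝ (cone t₀ x₀ ρ S) p (1, 0) = -S ∧
    ∀ ζ, |fderiv ℝ (cone t₀ x₀ ρ S) p (0, ζ)| ≤ ‖ζ‖ := by
  have hev : ∀ᶠ q in 𝓝 p, 0 < cone t₀ x₀ ρ S q :=
    (continuous_cone t₀ x₀ ρ S).continuousAt.eventually (lt_mem_nhds hp)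
  have hform : ∀ q, 0 < cone t₀ x₀ ρ S q →
      cone t₀ x₀ ρ S q = ρ - ‖q.2 - x₀‖ - S * (q.1 - t₀) := by
    intro q hq
    unfold cone at hq ⊢
    rcases max_cases (ρ - ‖q.2 - x₀‖ - S * (q.1 - t₀)) 0 with h | h
    · exact h.1
    · rw [h.1] at hq; exact absurd hq (lt_irrefl _)
  have hline : ∀ ξ : ℝ × 𝔼 d, HasDerivAt (fun s : ℝ => p + s • ξ) ξ 0 := fun ξ => by
    simpa using ((hasDerivAt_id (0:ℝ)).smul_const ξ).const_add p
  have hcomp : ∀ ξ : ℝ × 𝔼 d, HasDerivAt (fun s : ℝ => cone t₀ x₀ ρ S (p + s • ξ))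
      (fderiv ℝ (cone t₀ x₀ ρ S) p ξ) 0 := fun ξ => by
    have h1 : HasFDerivAt (cone t₀ x₀ ρ S) (fderiv ℝ (cone t₀ x₀ ρ S) p)
        ((fun s : ℝ => p + s • ξ) 0) := by simpa using hd.hasFDerivAt
    exact h1.comp_hasDerivAt 0 (hline ξ)
  have hevl : ∀ ξ : ℝ × 𝔼 d, ∀ᶠ s : ℝ in 𝓝 0, 0 < cone t₀ x₀ ρ S (p + s • ξ) := fun ξ => by
    have h1 : Tendsto (fun s : ℝ => p + s • ξ) (𝓝 0) (𝓝 p) := by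
      have := (hline ξ).continuousAt.tendsto
      simpa using this
    exact h1.eventually hev
  constructor
  · have h1 : HasDerivAt (fun s : ℝ => ρ - ‖p.2 - x₀‖ - S * (p.1 + s - t₀)) (-S) 0 := by
      have := (((((hasDerivAt_id (0:ℝ)).const_add p.1).sub_const t₀)).const_mul S).const_sub
        (ρ - ‖p.2 - x₀‖)
      simpa using this
    refine (hcomp (1, 0)).unique (h1.congr_of_eventuallyEq ?_)
    filter_upwards [hevl (1, 0)] with s hs
    rw [hform _ hs]
    simp
  · intro ζ
    have h2 := (hcomp (0, ζ)).hasFDerivAt.le_of_lip' (C := ‖ζ‖) (norm_nonneg _) ?_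
    · simpa using h2
    · filter_upwards [hevl (0, ζ)] with s hs
      rw [hform _ hs]
      have h3 : cone t₀ x₀ ρ S (p + (0:ℝ) • (0, ζ)) = ρ - ‖p.2 - x₀‖ - S * (p.1 - t₀) := by
        rw [zero_smul, add_zero, hform _ hp]
      rw [h3]
      simp only [Prod.fst_add, Prod.smul_mk, smul_zero, add_zero, Prod.snd_add, sub_zero,
        Real.norm_eq_abs]
      rw [show ρ - ‖p.2 + s • ζ - x₀‖ - S * (p.1 - t₀) - (ρ - ‖p.2 - x₀‖ - S * (p.1 - t₀)) =
        -(‖p.2 + s • ζ - x₀‖ - ‖p.2 - x₀‖) by ring, abs_neg]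
      refine (abs_norm_sub_norm_le _ _).trans ?_
      rw [show p.2 + s • ζ - x₀ - (p.2 - x₀) = s • ζ by abel, norm_smul, mul_comm]
      rfl

end Flux

section Core

variable {d : ℕ}

/-- The half-open space-time cylinder on which two states are compared. -/
def cyl (t₀ t₁ : ℝ) (x₀ : 𝔼 d) (ρ : ℝ) : Set (ℝ × 𝔼 d) := Ico t₀ t₁ ×ˢ ball x₀ ρ

lemma convex_cyl (t₀ t₁ : ℝ) (x₀ : 𝔼 d) (ρ : ℝ) : Convex ℝ (cyl t₀ t₁ x₀ ρ) :=
  (convex_Ico _ _).prod (convex_ball _ _)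

lemma cyl_mem_nhds {t₀ t₁ : ℝ} {x₀ : 𝔼 d} {ρ : ℝ} {p : ℝ × 𝔼 d} (hp : p ∈ cyl t₀ t₁ x₀ ρ)
    (h : t₀ < p.1) : cyl t₀ t₁ x₀ ρ ∈ 𝓝 p :=
  prod_mem_nhds (Ico_mem_nhds h hp.1.2) (isOpen_ball.mem_nhds hp.2)

lemma PtLip.norm_fderiv_le {W F : Type*} [NormedAddCommGroup W] [NormedSpace ℝ W]
    [NormedAddCommGroup F] [NormedSpace ℝ F] {K : ℝ} (hK : 0 ≤ K) {f : W → F} {s : Set W}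
    (h : PtLip K f s) {p : W} (hs : s ∈ 𝓝 p) : ‖fderiv ℝ f p‖ ≤ K := by
  have h1 := h p (mem_of_mem_nhds hs)
  rw [nhdsWithin_eq_nhds.2 hs] at h1
  exact norm_fderiv_le_of_lip' ℝ hK h1

lemma PtLip.comp_lip {W F : Type*} [NormedAddCommGroup W] [NormedSpace ℝ W]
    [NormedAddCommGroup F] [NormedSpace ℝ F] {K : ℝ} {m : W → ℝ} {s : Set W}
    (h : PtLip K m s) {Kf : ℝ≥0} {f : ℝ → F} {I : Set ℝ} (hf : LipschitzOnWith Kf f I)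
    (hI : ∀ p ∈ s, m p ∈ I) : PtLip (Kf * K) (fun p => f (m p)) s := by
  intro p hp
  filter_upwards [h p hp, self_mem_nhdsWithin] with q h1 hq
  have := hf.dist_le_mul _ (hI q hq) _ (hI p hp)
  rw [dist_eq_norm, dist_eq_norm] at this
  rw [mul_assoc]
  exact this.trans (by gcongr)

lemma PtLip.ae_differentiableAt {F : Type*} [NormedAddCommGroup F] [NormedSpace ℝ F]
    [FiniteDimensional ℝ F] {t₀ t₁ : ℝ} {x₀ : 𝔼 d} {ρ K : ℝ} {f : ℝ × (𝔼 d) → F}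
    (h : PtLip K f (cyl t₀ t₁ x₀ ρ)) :
    ∀ᵐ p : ℝ × 𝔼 d, p ∈ cyl t₀ t₁ x₀ ρ → t₀ < p.1 → DifferentiableAt ℝ f p := by
  have h1 := (h.mono_const (Real.le_coe_toNNReal K)).lipschitzOnWith (convex_cyl _ _ _ _)
  filter_upwards [h1.ae_differentiableWithinAt_of_mem (μ := volume)] with p hp hpc ht
  exact (hp hpc).differentiableAt (cyl_mem_nhds hpc ht)

/-- A physical state `(m, u)` and a comparison state `(R, V)` which solves the system up to
errors controlled by the negative part of `R`. -/
structure Core (κ M N B K t₀ t₁ : ℝ) (x₀ : 𝔼 d) (ρ : ℝ) (m R : ℝ × (𝔼 d) → ℝ)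
    (u V : ℝ × (𝔼 d) → 𝔼 d) : Prop where
  N_nonneg : 0 ≤ N
  M_pos : 0 < M
  B_nonneg : 0 ≤ B
  K_nonneg : 0 ≤ K
  m_nonneg : ∀ p ∈ cyl t₀ t₁ x₀ ρ, 0 ≤ m p
  m_le : ∀ p ∈ cyl t₀ t₁ x₀ ρ, m p ≤ M
  R_le : ∀ p ∈ cyl t₀ t₁ x₀ ρ, |R p| ≤ M
  u_le : ∀ p ∈ cyl t₀ t₁ x₀ ρ, 0 < m p → ‖u p‖ ≤ N
  V_le : ∀ p ∈ cyl t₀ t₁ x₀ ρ, ‖V p‖ ≤ N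
  lip_m : PtLip K m (cyl t₀ t₁ x₀ ρ)
  lip_R : PtLip K R (cyl t₀ t₁ x₀ ρ)
  lip_V : PtLip K V (cyl t₀ t₁ x₀ ρ)
  lip_u : PtLip K u (cyl t₀ t₁ x₀ ρ ∩ {p | 0 < m p})
  eq_m : ∀ᵐ p : ℝ × 𝔼 d, p ∈ cyl t₀ t₁ x₀ ρ → t₀ < p.1 → 0 < m p →
    DifferentiableAt ℝ u p ∧
    (∀ ζ, @inner ℝ _ _ (fderiv ℝ u p (1, u p)) ζ + fderiv ℝ m p (0, ζ) = 0) ∧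
    fderiv ℝ m p (1, u p) = -(κ * m p * sdiv u p)
  eq_R : ∀ᵐ p : ℝ × 𝔼 d, p ∈ cyl t₀ t₁ x₀ ρ → t₀ < p.1 →
    (∀ ζ, |@inner ℝ _ _ (fderiv ℝ V p (1, V p)) ζ + fderiv ℝ R p (0, ζ)| ≤
      B * √(max (-(R p)) 0) * ‖ζ‖) ∧
    |fderiv ℝ R p (1, V p) + κ * R p * sdiv V p| ≤ B * max (-(R p)) 0

/-- The weight `½|u-V|² + m - R` of the relative energy flux. -/
noncomputable def hfun (m R : ℝ × (𝔼 d) → ℝ) (u V : ℝ × (𝔼 d) → 𝔼 d) (q : ℝ × 𝔼 d) : ℝ :=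
  1 / 2 * ‖u q - V q‖ ^ 2 + m q - R q

/-- The constant of the error term in the relative energy inequality. -/
noncomputable def errC (κ M N B K S D : ℝ) : ℝ :=
  κ * (2 * N ^ 2 + 2 * M) * (D * K) + B * (4 * N ^ 2 + M) + 4 * N ^ 2 * K + B * M +
          D * K * (2 * κ * M + 2) + (S + N) * (2 * N ^ 2 + 2 * M + 2) + 4 * N

namespace Core

variable {κ M N B K t₀ t₁ ρ : ℝ} {x₀ : 𝔼 d} {m R : ℝ × (𝔼 d) → ℝ} {u V : ℝ × (𝔼 d) → 𝔼 d}

lemma w_le (H : Core κ M N B K t₀ t₁ x₀ ρ m R u V) {p : ℝ × 𝔼 d} (hp : p ∈ cyl t₀ t₁ x₀ ρ)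
    (hm : 0 < m p) : ‖u p - V p‖ ≤ 2 * N := by
  linarith [norm_sub_le (u p) (V p), H.u_le p hp hm, H.V_le p hp]

lemma abs_hfun_le (H : Core κ M N B K t₀ t₁ x₀ ρ m R u V) {p : ℝ × 𝔼 d}
    (hp : p ∈ cyl t₀ t₁ x₀ ρ) (hm : 0 < m p) : |hfun m R u V p| ≤ 2 * N ^ 2 + 2 * M := by
  have h1 := pow_le_pow_left₀ (norm_nonneg _) (H.w_le hp hm) 2
  have h2 := abs_le.1 (H.R_le p hp)
  have h3 := H.m_le p hp
  rw [mul_pow] at h1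
  unfold hfun
  rw [abs_le]
  constructor <;> nlinarith [sq_nonneg N, sq_nonneg ‖u p - V p‖]

lemma lip_hfun (H : Core κ M N B K t₀ t₁ x₀ ρ m R u V) :
    PtLip (2 * N * (K + K) + K + K) (hfun m R u V) (cyl t₀ t₁ x₀ ρ ∩ {p | 0 < m p}) :=
  (((H.lip_u.sub (H.lip_V.mono inter_subset_left)).half_norm_sq
    (fun _ hp => H.w_le hp.1 hp.2)).add (H.lip_m.mono inter_subset_left)).sub
    (H.lip_R.mono inter_subset_left)

lemma lip_weight (H : Core κ M N B K t₀ t₁ x₀ ρ m R u V) {f P : ℝ → ℝ} {σ δ : ℝ}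
    (hf : PowerApprox σ M δ f P) {G : ℝ × (𝔼 d) → ℝ} {K₂ C₂ : ℝ} (hK₂ : 0 ≤ K₂) (hC₂ : 0 ≤ C₂)
    (hG : PtLip K₂ G (cyl t₀ t₁ x₀ ρ ∩ {p | 0 < m p}))
    (hGC : ∀ p ∈ cyl t₀ t₁ x₀ ρ, 0 < m p → |G p| ≤ C₂) :
    ∃ C K', 0 ≤ C ∧ 0 ≤ K' ∧ PtLip K' (fun p => f (m p) * G p) (cyl t₀ t₁ x₀ ρ) ∧
      (∀ p ∈ cyl t₀ t₁ x₀ ρ, |f (m p) * G p| ≤ C * m p) ∧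
      ∀ p ∈ cyl t₀ t₁ x₀ ρ, |f (m p) * G p| ≤ C * M := by
  obtain ⟨Kf, hKf⟩ := hf.lip
  have hmI : ∀ p ∈ cyl t₀ t₁ x₀ ρ, m p ∈ Icc (-M) M := fun p hp =>
    ⟨by linarith [H.m_nonneg p hp, H.M_pos], H.m_le p hp⟩
  have hfm : ∀ p ∈ cyl t₀ t₁ x₀ ρ, |f (m p)| ≤ Kf * m p := by
    intro p hp
    have := hKf.dist_le_mul _ (hmI p hp) 0 ⟨by linarith [H.M_pos], H.M_pos.le⟩
    rw [Real.dist_eq, Real.dist_eq, hf.zero_of_nonpos 0 le_rfl, sub_zero, sub_zero,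
      abs_of_nonneg (H.m_nonneg p hp)] at this
    exact this
  have hfM : ∀ p ∈ cyl t₀ t₁ x₀ ρ, |f (m p)| ≤ Kf * M := fun p hp =>
    (hfm p hp).trans (by gcongr; exact H.m_le p hp)
  have hmain := PtLip.weight_mul H.lip_m.continuousOn (H.lip_m.comp_lip hKf hmI)
    (fun p _ h => hf.zero_of_nonpos _ h) (mul_nonneg Kf.2 H.K_nonneg) hK₂
    (mul_nonneg Kf.2 H.M_pos.le) hC₂ hG hfM hGC
  have hb : ∀ p ∈ cyl t₀ t₁ x₀ ρ, |f (m p) * G p| ≤ Kf * C₂ * m p := by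
    intro p hp
    rcases (H.m_nonneg p hp).eq_or_lt with h | h
    · rw [← h, hf.zero_of_nonpos 0 le_rfl]; simp
    · rw [abs_mul]
      calc |f (m p)| * |G p| ≤ (Kf * m p) * C₂ :=
            mul_le_mul (hfm p hp) (hGC p hp h) (abs_nonneg _)
              (mul_nonneg Kf.2 h.le)
        _ = Kf * C₂ * m p := by ring
  refine ⟨Kf * C₂, _, mul_nonneg Kf.2 hC₂, ?_, hmain, hb, fun p hp => (hb p hp).trans ?_⟩
  · exact add_nonneg (mul_nonneg (mul_nonneg Kf.2 H.K_nonneg) hC₂)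
      (mul_nonneg (mul_nonneg Kf.2 H.M_pos.le) hK₂)
  · have := H.m_le p hp
    gcongr

lemma lip_prim (H : Core κ M N B K t₀ t₁ x₀ ρ m R u V) {f P : ℝ → ℝ} {σ δ : ℝ} (hδ : 0 ≤ δ)
    (hσ : 0 < σ) (hf : PowerApprox σ M δ f P) :
    ∃ C K', 0 ≤ C ∧ 0 ≤ K' ∧ PtLip K' (fun p => P (R p) - P (m p)) (cyl t₀ t₁ x₀ ρ) ∧
      ∀ p ∈ cyl t₀ t₁ x₀ ρ, |P (R p) - P (m p)| ≤ C := by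
  have hM := H.M_pos
  have hC : 0 ≤ M ^ σ + δ := by positivity
  have hP : LipschitzOnWith (Real.toNNReal (M ^ σ + δ)) P (Icc (-M) M) := by
    apply (convex_Icc (-M) M).lipschitzOnWith_of_nnnorm_hasDerivWithin_le
      (fun x _ => (hf.hasDerivAt x).hasDerivWithinAt)
    intro x hx
    rw [← NNReal.coe_le_coe, coe_nnnorm, Real.coe_toNNReal _ hC, Real.norm_eq_abs]
    have h1 := abs_le.1 (hf.close x (abs_le.2 hx))
    have h2 : (max x 0) ^ σ ≤ M ^ σ :=
      Real.rpow_le_rpow (le_max_right _ _) (max_le hx.2 hM.le) hσ.le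
    rw [abs_of_nonneg (hf.nonneg x)]
    linarith
  have hmI : ∀ p ∈ cyl t₀ t₁ x₀ ρ, m p ∈ Icc (-M) M := fun p hp =>
    ⟨by linarith [H.m_nonneg p hp, H.M_pos], H.m_le p hp⟩
  have hRI : ∀ p ∈ cyl t₀ t₁ x₀ ρ, R p ∈ Icc (-M) M := fun p hp => abs_le.1 (H.R_le p hp)
  refine ⟨(M ^ σ + δ) * (2 * M), _, by positivity, ?_, (H.lip_R.comp_lip hP hRI).sub
    (H.lip_m.comp_lip hP hmI), fun p hp => ?_⟩
  · have := H.K_nonneg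
    positivity
  · have := hP.dist_le_mul _ (hRI p hp) _ (hmI p hp)
    rw [Real.dist_eq, Real.coe_toNNReal _ hC, Real.dist_eq] at this
    refine this.trans (mul_le_mul_of_nonneg_left ?_ hC)
    rw [abs_le]
    constructor <;> linarith [(hRI p hp).1, (hRI p hp).2, (hmI p hp).1, (hmI p hp).2,
      H.m_nonneg p hp]

end Core

end Core

section CoreIneq

variable {d : ℕ}

namespace Core

variable {κ M N B K t₀ t₁ ρ : ℝ} {x₀ : 𝔼 d} {m R : ℝ × (𝔼 d) → ℝ} {u V : ℝ × (𝔼 d) → 𝔼 d}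

lemma norm_prod_zero (ζ : 𝔼 d) : ‖((0:ℝ), ζ)‖ = ‖ζ‖ := by simp [Prod.norm_def]

lemma cone_deriv_bounds {S ρ' : ℝ} {p : ℝ × 𝔼 d}
    (hφ : 0 < cone t₀ x₀ ρ' S p) (hφd : DifferentiableAt ℝ (cone t₀ x₀ ρ' S) p)
    {z : 𝔼 d} (hz : ‖z‖ ≤ N) :
    S - N ≤ -(fderiv ℝ (cone t₀ x₀ ρ' S) p (1, z)) ∧
      -(fderiv ℝ (cone t₀ x₀ ρ' S) p (1, z)) ≤ S + N := by
  obtain ⟨h1, h2⟩ := cone_deriv hφ hφd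
  have h3 := abs_le.1 ((h2 z).trans hz)
  have e : fderiv ℝ (cone t₀ x₀ ρ' S) p (1, z) = -S + fderiv ℝ (cone t₀ x₀ ρ' S) p (0, z) := by
    rw [← h1, ← map_add]; simp
  rw [e]
  constructor <;> linarith

set_option maxHeartbeats 1000000 in
lemma fluxDiv_le_of_pos (H : Core κ M N B K t₀ t₁ x₀ ρ m R u V) {σ δ S ρ' : ℝ} (hκ : 0 < κ)
    (hσ : 0 < σ) (hκσ : κ * σ = 1) (hδ : 0 ≤ δ) {f P : ℝ → ℝ} (hf : PowerApprox σ M δ f P)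
    (hρ0 : 0 ≤ ρ') (hρ1 : ρ' ≤ 1) (hρ : (2 * B + 2 * K + d * K * κ) * ρ' ≤ 1)
    (hS0 : 0 ≤ S) (hS : 3 * N + 3 + cEnt σ * M / 2 ≤ S)
    {p : ℝ × 𝔼 d} (hp : p ∈ cyl t₀ t₁ x₀ ρ) (ht : t₀ < p.1) (hm : 0 < m p)
    (hφ : 0 < cone t₀ x₀ ρ' S p) (hφd : DifferentiableAt ℝ (cone t₀ x₀ ρ' S) p)
    (hmd : DifferentiableAt ℝ m p) (hRd : DifferentiableAt ℝ R p) (hVd : DifferentiableAt ℝ V p)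
    (hud : DifferentiableAt ℝ u p)
    (he1 : ∀ ζ, @inner ℝ _ _ (fderiv ℝ u p (1, u p)) ζ + fderiv ℝ m p (0, ζ) = 0)
    (he2 : fderiv ℝ m p (1, u p) = -(κ * m p * sdiv u p))
    (he3 : ∀ ζ, |@inner ℝ _ _ (fderiv ℝ V p (1, V p)) ζ + fderiv ℝ R p (0, ζ)| ≤
      B * √(max (-(R p)) 0) * ‖ζ‖)
    (he4 : |fderiv ℝ R p (1, V p) + κ * R p * sdiv V p| ≤ B * max (-(R p)) 0) :
    fluxDiv t₀ (cone t₀ x₀ ρ' S) (fun q => f (m q) * hfun m R u V q) u p +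
      fluxDiv t₀ (cone t₀ x₀ ρ' S) (fun q => P (R q) - P (m q)) V p ≤
      -(1 / 2 * (m p) ^ σ * ‖u p - V p‖ ^ 2 + relEnt σ (m p) (R p)) +
        errC κ M N B K S d * δ := by
  set φ := cone t₀ x₀ ρ' S with hφdef
  set w := u p - V p with hw
  have hfd := (hf.diff (m p) hm).hasDerivAt
  have hhd : HasFDerivAt (hfun m R u V) ((1 / 2 : ℝ) • ((2:ℕ) • (innerSL ℝ w).comp
      (fderiv ℝ u p - fderiv ℝ V p)) + fderiv ℝ m p - fderiv ℝ R p) p :=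
    (((hud.hasFDerivAt.sub hVd.hasFDerivAt).norm_sq.const_mul (1 / 2)).add
      hmd.hasFDerivAt).sub hRd.hasFDerivAt
  have hfm : HasFDerivAt (fun q => f (m q)) (deriv f (m p) • fderiv ℝ m p) p :=
    hfd.comp_hasFDerivAt p hmd.hasFDerivAt
  have hα := hfm.fun_mul hhd
  have hPR : HasFDerivAt (fun q => P (R q)) (f (R p) • fderiv ℝ R p) p :=
    (hf.hasDerivAt (R p)).comp_hasFDerivAt p hRd.hasFDerivAt
  have hPm : HasFDerivAt (fun q => P (m q)) (f (m p) • fderiv ℝ m p) p :=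
    (hf.hasDerivAt (m p)).comp_hasFDerivAt p hmd.hasFDerivAt
  have hc : HasFDerivAt (fun q => P (R q) - P (m q))
      (f (R p) • fderiv ℝ R p - f (m p) • fderiv ℝ m p) p := hPR.sub hPm
  rw [fluxDiv_eq ht hφd hα.differentiableAt hud, fluxDiv_eq ht hφd hc.differentiableAt hVd,
    hα.fderiv, hc.fderiv]
  have hnhds := cyl_mem_nhds hp ht
  have hnhds' : cyl t₀ t₁ x₀ ρ ∩ {p | 0 < m p} ∈ 𝓝 p :=
    inter_mem hnhds (hmd.continuousAt.eventually (lt_mem_nhds hm))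
  have hDV : ‖fderiv ℝ V p‖ ≤ K := H.lip_V.norm_fderiv_le H.K_nonneg hnhds
  have hDu : ‖fderiv ℝ u p‖ ≤ K := H.lip_u.norm_fderiv_le H.K_nonneg hnhds'
  set t2 := @inner ℝ _ _ (fderiv ℝ V p (1, V p)) w + fderiv ℝ R p (0, w) with ht2
  set t3 := @inner ℝ _ _ w (fderiv ℝ V p (0, w)) with ht3
  set t4 := fderiv ℝ R p (1, V p) + κ * R p * sdiv V p with ht4
  have e1 := he1 w
  have eu : ((1:ℝ), u p) = (1, V p) + (0, w) := by rw [hw]; ext1 <;> simp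
  have eVu : fderiv ℝ V p (1, u p) = fderiv ℝ V p (1, V p) + fderiv ℝ V p (0, w) := by
    rw [eu, map_add]
  have eRu : fderiv ℝ R p (1, u p) = fderiv ℝ R p (1, V p) + fderiv ℝ R p (0, w) := by
    rw [eu, map_add]
  have emu : fderiv ℝ m p (1, u p) = fderiv ℝ m p (1, V p) + fderiv ℝ m p (0, w) := by
    rw [eu, map_add]
  have eφu : fderiv ℝ φ p (1, u p) = fderiv ℝ φ p (1, V p) + fderiv ℝ φ p (0, w) := by
    rw [eu, map_add]
  have hft4 : f (R p) * t4 = 0 := by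
    rcases le_or_gt (R p) 0 with h | h
    · rw [hf.zero_of_nonpos _ h, zero_mul]
    · have := he4
      rw [max_eq_right (by linarith), mul_zero] at this
      rw [abs_nonpos_iff.1 this, mul_zero]
  have halg := energy_algebra (σ := σ) (κ := κ) (m := m p) (M := M) (N := N) (B := B) (K := K)
    (D := d) (S := S) (ρ := ρ') (δ := δ) (φ := φ p) (f := f (m p)) (fR := f (R p))
    (PR := P (R p)) (Pm := P (m p)) (R := R p) (w := ‖w‖)
    (t₁ := (f (m p) - κ * m p * deriv f (m p)) * hfun m R u V p * sdiv u p)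
    (t₂ := t2) (t₃ := t3) (t₄ := t4) (dv := sdiv V p) (s := -(fderiv ℝ φ p (1, u p)))
    (y := fderiv ℝ φ p (0, w)) hσ hκσ hκ H.N_nonneg H.B_nonneg H.K_nonneg (Nat.cast_nonneg d) hδ
    hm.le (H.m_le p hp) (H.R_le p hp) (norm_nonneg _) (H.w_le hp hm) (hf.nonneg _)
    (by
      have := hf.close (m p) (by rw [abs_of_pos hm]; exact H.m_le p hp)
      rwa [max_eq_left hm.le] at this)
    (hf.close _ (H.R_le p hp)) (hf.prim_close _ (H.R_le p hp))
    (hf.prim_close _ (by rw [abs_of_pos hm]; exact H.m_le p hp))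
    (by
      have h1 := hf.euler (m p) hm (H.m_le p hp)
      have h2 : f (m p) - κ * m p * deriv f (m p) = κ * (σ * f (m p) - m p * deriv f (m p)) := by
        linear_combination -(f (m p)) * hκσ
      rw [abs_mul, abs_mul, h2, abs_mul, abs_of_pos hκ]
      have h3 := H.abs_hfun_le hp hm
      have h4 := abs_sdiv_le hDu
      have h5 := H.M_pos
      gcongr)
    (by
      have := he3 w
      exact this)
    (by
      rw [ht3]
      refine (abs_real_inner_le_norm _ _).trans ?_
      have := (fderiv ℝ V p).le_of_opNorm_le hDV (0, w)
      rw [norm_prod_zero] at this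
      calc ‖w‖ * ‖fderiv ℝ V p (0, w)‖ ≤ ‖w‖ * (K * ‖w‖) := by gcongr
        _ = K * ‖w‖ ^ 2 := by ring)
    he4 (abs_sdiv_le hDV) (cone_deriv_bounds hφ hφd (H.u_le p hp hm)).1
    (cone_deriv_bounds hφ hφd (H.u_le p hp hm)).2 ((cone_deriv hφ hφd).2 w) hφ.le
    (cone_le _ _ hρ0 hS0 hp.1.1) hρ1 hρ hS
  refine le_trans (le_of_eq ?_) halg
  have ewu : @inner ℝ _ _ w (fderiv ℝ u p (1, u p)) = -(fderiv ℝ m p (0, w)) := by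
    rw [real_inner_comm]; linarith
  have ewV : @inner ℝ _ _ w (fderiv ℝ V p (1, V p)) = t2 - fderiv ℝ R p (0, w) := by
    rw [ht2, real_inner_comm]; ring
  have eRV : fderiv ℝ R p (1, V p) = t4 - κ * R p * sdiv V p := by rw [ht4]; ring
  have emV : fderiv ℝ m p (1, V p) = -(κ * m p * sdiv u p) - fderiv ℝ m p (0, w) := by linarith
  have eφV : fderiv ℝ φ p (1, V p) = fderiv ℝ φ p (1, u p) - fderiv ℝ φ p (0, w) := by linarith
  have ehf : 1 / 2 * ‖w‖ ^ 2 + m p - R p = hfun m R u V p := rfl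
  rw [ehf]
  simp only [_root_.add_apply, _root_.sub_apply, _root_.smul_apply, ContinuousLinearMap.comp_apply,
    innerSL_apply_apply, smul_eq_mul, nsmul_eq_mul, inner_sub_right, eVu, inner_add_right, ewu,
    ewV, eRu, eRV, emV, eφV, he2, ← ht3]
  push_cast
  linear_combination (φ p) * hft4

lemma exists_flux_bounds (H : Core κ M N B K t₀ t₁ x₀ ρ m R u V) {f P : ℝ → ℝ} {σ δ : ℝ}
    (hf : PowerApprox σ M δ f P) :
    (∃ C K', 0 ≤ C ∧ 0 ≤ K' ∧ PtLip K' (fun p => f (m p) * hfun m R u V p) (cyl t₀ t₁ x₀ ρ) ∧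
      (∀ p ∈ cyl t₀ t₁ x₀ ρ, |f (m p) * hfun m R u V p| ≤ C * m p) ∧
      ∀ p ∈ cyl t₀ t₁ x₀ ρ, |f (m p) * hfun m R u V p| ≤ C * M) ∧
    ∀ j, ∃ C K', 0 ≤ C ∧ 0 ≤ K' ∧
      PtLip K' (fun p => f (m p) * hfun m R u V p * u p j) (cyl t₀ t₁ x₀ ρ) ∧
      (∀ p ∈ cyl t₀ t₁ x₀ ρ, |f (m p) * hfun m R u V p * u p j| ≤ C * m p) ∧
      ∀ p ∈ cyl t₀ t₁ x₀ ρ, |f (m p) * hfun m R u V p * u p j| ≤ C * M := by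
  have hN := H.N_nonneg
  have hM := H.M_pos
  have hK := H.K_nonneg
  refine ⟨H.lip_weight hf (by positivity) (by positivity) H.lip_hfun
    (fun p hp hm => H.abs_hfun_le hp hm), fun j => ?_⟩
  have huj : ∀ p ∈ cyl t₀ t₁ x₀ ρ, 0 < m p → |u p j| ≤ N := fun p hp hm =>
    (PiLp.norm_apply_le (u p) j).trans (H.u_le p hp hm)
  have hlip := H.lip_hfun.mul (H.lip_u.clm_comp (EuclideanSpace.proj j : (𝔼 d) →L[ℝ] ℝ))
    (fun p hp => H.abs_hfun_le hp.1 hp.2) (fun p hp => huj p hp.1 hp.2)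
  have := H.lip_weight hf (C₂ := (2 * N ^ 2 + 2 * M) * N) (by positivity) (by positivity) hlip
    (fun p hp hm => by
      rw [abs_mul]
      exact mul_le_mul (H.abs_hfun_le hp hm) (huj p hp hm) (abs_nonneg _) (by positivity))
  simp only [mul_assoc] at this ⊢
  exact this

lemma fluxDiv_le_of_eq_zero (H : Core κ M N B K t₀ t₁ x₀ ρ m R u V) {σ δ S ρ' : ℝ} (hκ : 0 < κ)
    (hσ : 0 < σ) (hκσ : κ * σ = 1) (hδ : 0 ≤ δ) {f P : ℝ → ℝ} (hf : PowerApprox σ M δ f P)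
    (hρ0 : 0 ≤ ρ') (hρ1 : ρ' ≤ 1) (hρ : (2 * B + 2 * K + d * K * κ) * ρ' ≤ 1)
    (hS0 : 0 ≤ S) (hS : 3 * N + 3 + cEnt σ * M / 2 ≤ S)
    {p : ℝ × 𝔼 d} (hp : p ∈ cyl t₀ t₁ x₀ ρ) (ht : t₀ < p.1) (hm : m p = 0)
    (hφ : 0 < cone t₀ x₀ ρ' S p) (hφd : DifferentiableAt ℝ (cone t₀ x₀ ρ' S) p)
    (hmd : DifferentiableAt ℝ m p) (hRd : DifferentiableAt ℝ R p) (hVd : DifferentiableAt ℝ V p)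
    (he4 : |fderiv ℝ R p (1, V p) + κ * R p * sdiv V p| ≤ B * max (-(R p)) 0) :
    fluxDiv t₀ (cone t₀ x₀ ρ' S) (fun q => f (m q) * hfun m R u V q) u p +
      fluxDiv t₀ (cone t₀ x₀ ρ' S) (fun q => P (R q) - P (m q)) V p ≤
      -relEnt σ (m p) (R p) + errC κ M N B K S d * δ := by
  have hnhds := cyl_mem_nhds hp ht
  have hmn : ∀ᶠ q in 𝓝 p, 0 ≤ m q := by
    filter_upwards [hnhds] with q hq using H.m_nonneg q hq
  have hm0 : fderiv ℝ m p = 0 :=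
    IsLocalMin.fderiv_eq_zero (by filter_upwards [hmn] with q hq; rw [hm]; exact hq)
  have hDV : ‖fderiv ℝ V p‖ ≤ K := H.lip_V.norm_fderiv_le H.K_nonneg hnhds
  have hcut : ∀ (G : ℝ × (𝔼 d) → ℝ) (C : ℝ), 0 ≤ C → (∀ q ∈ cyl t₀ t₁ x₀ ρ, |G q| ≤ C * m q) →
      HasFDerivAt (cut t₀ (cone t₀ x₀ ρ' S) G) (0 : ℝ × (𝔼 d) →L[ℝ] ℝ) p := by
    intro G C hC hG
    refine hasFDerivAt_zero_of_le (C := C * ρ') hmd hm hmn ?_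
    filter_upwards [hnhds] with q hq
    rw [cut, if_pos hq.1.1, abs_mul, abs_of_nonneg (cone_nonneg t₀ x₀ ρ' S q)]
    calc |G q| * cone t₀ x₀ ρ' S q ≤ (C * m q) * ρ' :=
          mul_le_mul (hG q hq) (cone_le _ _ hρ0 hS0 hq.1.1) (cone_nonneg _ _ _ _ _)
            (mul_nonneg hC (H.m_nonneg q hq))
      _ = C * ρ' * m q := by ring
  obtain ⟨⟨C₀, -, hC₀, -, -, hb₀, -⟩, hj⟩ := H.exists_flux_bounds hf
  rw [fluxDiv_eq_zero (hcut _ C₀ hC₀ hb₀) (fun j => by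
    obtain ⟨C, -, hC, -, -, hb, -⟩ := hj j
    exact hcut _ C hC hb), zero_add]
  have hPR : HasFDerivAt (fun q => P (R q)) (f (R p) • fderiv ℝ R p) p :=
    (hf.hasDerivAt (R p)).comp_hasFDerivAt p hRd.hasFDerivAt
  have hPm : HasFDerivAt (fun q => P (m q)) (f (m p) • fderiv ℝ m p) p :=
    (hf.hasDerivAt (m p)).comp_hasFDerivAt p hmd.hasFDerivAt
  have hc : HasFDerivAt (fun q => P (R q) - P (m q))
      (f (R p) • fderiv ℝ R p - f (m p) • fderiv ℝ m p) p := hPR.sub hPm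
  rw [fluxDiv_eq ht hφd hc.differentiableAt hVd, hc.fderiv]
  set φ := cone t₀ x₀ ρ' S with hφdef
  set t4 := fderiv ℝ R p (1, V p) + κ * R p * sdiv V p with ht4
  have hft4 : f (R p) * t4 = 0 := by
    rcases le_or_gt (R p) 0 with h | h
    · rw [hf.zero_of_nonpos _ h, zero_mul]
    · have := he4
      rw [max_eq_right (by linarith), mul_zero] at this
      rw [abs_nonpos_iff.1 this, mul_zero]
  have hfm0 : f (m p) = 0 := hf.zero_of_nonpos _ hm.le
  have hM := H.M_pos
  have hN := H.N_nonneg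
  have hKn := H.K_nonneg
  have halg := energy_algebra (σ := σ) (κ := κ) (m := m p) (M := M) (N := N) (B := B) (K := K)
    (D := d) (S := S) (ρ := ρ') (δ := δ) (φ := φ p) (f := 0) (fR := f (R p))
    (PR := P (R p)) (Pm := P (m p)) (R := R p) (w := 0)
    (t₁ := 0)
    (t₂ := 0) (t₃ := 0) (t₄ := 0) (dv := sdiv V p) (s := -(fderiv ℝ φ p (1, V p)))
    (y := 0) hσ hκσ hκ H.N_nonneg H.B_nonneg H.K_nonneg (Nat.cast_nonneg d) hδ
    hm.ge (H.m_le p hp) (H.R_le p hp) le_rfl (by positivity) le_rfl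
    (by rw [hm, Real.zero_rpow hσ.ne']; simpa using hδ)
    (hf.close _ (H.R_le p hp)) (hf.prim_close _ (H.R_le p hp))
    (hf.prim_close _ (by rw [hm]; simpa using hM.le))
    (by rw [abs_zero]; positivity) (by simp) (by simp)
    (by rw [abs_zero]; exact mul_nonneg H.B_nonneg (le_max_right _ _))
    (abs_sdiv_le hDV) (cone_deriv_bounds hφ hφd (H.V_le p hp)).1
    (cone_deriv_bounds hφ hφd (H.V_le p hp)).2 (by simp) hφ.le
    (cone_le _ _ hρ0 hS0 hp.1.1) hρ1 hρ hS
  have eRV : fderiv ℝ R p (1, V p) = t4 - κ * R p * sdiv V p := by rw [ht4]; ring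
  rw [hfm0, hm0]
  simp only [_root_.smul_apply, smul_eq_mul, eRV, smul_zero, sub_zero]
  unfold errC
  linear_combination halg + (φ p) * hft4

end Core

end CoreIneq

section CoreUniqueness

variable {d : ℕ}

lemma hasFDerivAt_cut_of_lt {t₀ : ℝ} (φ G : ℝ × (𝔼 d) → ℝ) {p : ℝ × 𝔼 d} (hp : p.1 < t₀) :
    HasFDerivAt (cut t₀ φ G) (0 : ℝ × (𝔼 d) →L[ℝ] ℝ) p := by
  refine (hasFDerivAt_const (0:ℝ) p).congr_of_eventuallyEq ?_
  have : ∀ᶠ q : ℝ × 𝔼 d in 𝓝 p, q.1 < t₀ :=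
    continuous_fst.continuousAt.eventually (gt_mem_nhds hp)
  filter_upwards [this] with q hq
  rw [cut, if_neg (not_le.2 hq)]

lemma hasFDerivAt_cut_of_cone_eq_zero {t₀ t₁ : ℝ} {x₀ : 𝔼 d} {ρ ρ' S : ℝ} (hS : 0 < S)
    (hρ : ρ' ≤ ρ) (ht : ρ' ≤ S * (t₁ - t₀)) {G : ℝ × (𝔼 d) → ℝ} {C : ℝ}
    (hG : ∀ p ∈ cyl t₀ t₁ x₀ ρ, |G p| ≤ C) {p : ℝ × 𝔼 d} (hp : t₀ < p.1)
    (hd : DifferentiableAt ℝ (cone t₀ x₀ ρ' S) p) (h0 : cone t₀ x₀ ρ' S p = 0) :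
    HasFDerivAt (cut t₀ (cone t₀ x₀ ρ' S) G) (0 : ℝ × (𝔼 d) →L[ℝ] ℝ) p := by
  refine hasFDerivAt_zero_of_le (C := C) hd h0
    (Eventually.of_forall fun q => cone_nonneg _ _ _ _ q) ?_
  have : ∀ᶠ q : ℝ × 𝔼 d in 𝓝 p, t₀ < q.1 :=
    continuous_fst.continuousAt.eventually (lt_mem_nhds hp)
  filter_upwards [this] with q hq
  rw [cut, if_pos hq.le, abs_mul, abs_of_nonneg (cone_nonneg t₀ x₀ ρ' S q)]
  rcases (cone_nonneg t₀ x₀ ρ' S q).eq_or_lt with h | h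
  · rw [← h, mul_zero, mul_zero]
  · exact mul_le_mul_of_nonneg_right (hG q (mem_of_cone_pos hS hρ ht hq.le h)) h.le

lemma ae_fst_ne (t₀ : ℝ) : ∀ᵐ p : ℝ × 𝔼 d, p.1 ≠ t₀ := by
  have h : ∀ᵐ t : ℝ, t ≠ t₀ := by
    rw [ae_iff]; simp
  exact (Measure.quasiMeasurePreserving_fst (μ := (volume : Measure ℝ))
    (ν := (volume : Measure (𝔼 d)))).ae h

lemma ae_differentiableAt_cone (t₀ : ℝ) (x₀ : 𝔼 d) (ρ : ℝ) {S : ℝ} (hS : 0 ≤ S) :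
    ∀ᵐ p : ℝ × 𝔼 d, DifferentiableAt ℝ (cone t₀ x₀ ρ S) p := by
  have : LipschitzWith (Real.toNNReal (1 + S)) (cone t₀ x₀ ρ S) := by
    apply LipschitzWith.of_dist_le_mul
    intro p q
    rw [Real.dist_eq, Real.coe_toNNReal _ (by linarith), dist_eq_norm]
    exact cone_lipschitz t₀ x₀ ρ hS q p
  exact this.ae_differentiableAt

namespace Core

variable {κ M N B K t₀ t₁ ρ : ℝ} {x₀ : 𝔼 d} {m R : ℝ × (𝔼 d) → ℝ} {u V : ℝ × (𝔼 d) → 𝔼 d}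

/-- The relative energy density in the forward cone. -/
noncomputable def density (t₀ : ℝ) (x₀ : 𝔼 d) (ρ' S σ : ℝ) (m R : ℝ × (𝔼 d) → ℝ)
    (u V : ℝ × (𝔼 d) → 𝔼 d) (p : ℝ × 𝔼 d) : ℝ :=
  indicator {q | t₀ < q.1 ∧ 0 < cone t₀ x₀ ρ' S q} (fun q => relEnt σ (m q) (R q)) p +
  indicator ({q | t₀ < q.1 ∧ 0 < cone t₀ x₀ ρ' S q} ∩ {q | 0 < m q})
    (fun q => 1 / 2 * (m q) ^ σ * ‖u q - V q‖ ^ 2) p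

lemma isOpen_cone_set (t₀ : ℝ) (x₀ : 𝔼 d) (ρ' S : ℝ) :
    IsOpen {q : ℝ × 𝔼 d | t₀ < q.1 ∧ 0 < cone t₀ x₀ ρ' S q} :=
  (isOpen_lt continuous_const continuous_fst).inter
    (isOpen_lt continuous_const (continuous_cone t₀ x₀ ρ' S))

lemma exists_integrable_bound (H : Core κ M N B K t₀ t₁ x₀ ρ m R u V) {σ δ S ρ' : ℝ} (hκ : 0 < κ)
    (hσ : 0 < σ) (hκσ : κ * σ = 1) (hδ : 0 < δ)
    (hρ0 : 0 ≤ ρ') (hρρ : ρ' ≤ ρ) (hρ1 : ρ' ≤ 1) (hρ : (2 * B + 2 * K + d * K * κ) * ρ' ≤ 1)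
    (hS0 : 0 < S) (hS : 3 * N + 3 + cEnt σ * M / 2 ≤ S) (hSt : ρ' ≤ S * (t₁ - t₀))
    (hbase : ∀ p : ℝ × 𝔼 d, p.1 = t₀ → 0 < cone t₀ x₀ ρ' S p →
      m p = max (R p) 0 ∧ (0 < m p → u p = V p)) :
    ∃ D : ℝ × (𝔼 d) → ℝ, Integrable D ∧ ∫ p, D p = 0 ∧
      ∀ᵐ p, density t₀ x₀ ρ' S σ m R u V p ≤ -D p +
        indicator (Icc t₀ t₁ ×ˢ closedBall x₀ ρ) (fun _ => errC κ M N B K S d * δ) p := by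
  obtain ⟨f, P, hf⟩ := exists_powerApprox hσ H.M_pos hδ
  obtain ⟨⟨C₀, K₀, hC₀, hK₀, hl₀, -, hb₀⟩, hj⟩ := H.exists_flux_bounds hf
  obtain ⟨C₁, K₁, hC₁, hK₁, hl₁, hb₁⟩ := H.lip_prim hδ.le hσ hf
  have hM := H.M_pos
  have hN := H.N_nonneg
  have hKn := H.K_nonneg
  have hBn := H.B_nonneg
  have hPV : ∀ j, PtLip (K₁ * N + C₁ * (‖(EuclideanSpace.proj j : (𝔼 d) →L[ℝ] ℝ)‖ * K))
      (fun p => (P (R p) - P (m p)) * V p j) (cyl t₀ t₁ x₀ ρ) := fun j =>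
    hl₁.mul (H.lip_V.clm_comp (EuclideanSpace.proj j : (𝔼 d) →L[ℝ] ℝ)) hb₁
      (fun p hp => (PiLp.norm_apply_le (V p) j).trans (H.V_le p hp))
  have hPVb : ∀ j, ∀ p ∈ cyl t₀ t₁ x₀ ρ, |(P (R p) - P (m p)) * V p j| ≤ C₁ * N := by
    intro j p hp
    rw [abs_mul]
    exact mul_le_mul (hb₁ p hp) ((PiLp.norm_apply_le (V p) j).trans (H.V_le p hp))
      (abs_nonneg _) hC₁
  have hbc : ∀ p : ℝ × 𝔼 d, p.1 = t₀ → 0 < cone t₀ x₀ ρ' S p → P (R p) - P (m p) = 0 := by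
    intro p hp hφ
    rw [(hbase p hp hφ).1]
    rcases le_total (R p) 0 with h | h
    · rw [max_eq_right h, hf.prim_zero _ h, hf.prim_zero _ le_rfl, sub_zero]
    · rw [max_eq_left h, sub_self]
  have hba : ∀ p : ℝ × 𝔼 d, p.1 = t₀ → 0 < cone t₀ x₀ ρ' S p →
      f (m p) * hfun m R u V p = 0 := by
    intro p hp hφ
    obtain ⟨h1, h2⟩ := hbase p hp hφ
    rcases le_or_gt (m p) 0 with h | h
    · rw [hf.zero_of_nonpos _ h, zero_mul]
    · have h3 : R p = m p := by
        rcases max_choice (R p) 0 with h4 | h4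
        · rw [h1, h4]
        · rw [h1, h4] at h; exact absurd h (lt_irrefl _)
      simp [hfun, h2 h, h3]
  have hQ := isCompact_box t₀ t₁ x₀ ρ
  have hoff : ∀ G : ℝ × (𝔼 d) → ℝ, ∀ p ∉ Icc t₀ t₁ ×ˢ closedBall x₀ ρ,
      cut t₀ (cone t₀ x₀ ρ' S) G p = 0 := fun G p hp => cut_eq_zero_of_notMem hS0 hρρ hSt G hp
  have i1 := integral_fluxDiv (α := fun p => f (m p) * hfun m R u V p) (u := u) hQ hoff
    (cut_lipschitz hS0 hρρ hρ0 hSt (mul_nonneg hC₀ hM.le) hK₀ hl₀ hb₀ hba)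
    (fun j => by
      obtain ⟨C, K', hC, hK', hl, -, hb⟩ := hj j
      exact cut_lipschitz hS0 hρρ hρ0 hSt (mul_nonneg hC hM.le) hK' hl hb
        (fun p hp hφ => by rw [hba p hp hφ, zero_mul]))
  have i2 := integral_fluxDiv (α := fun p => P (R p) - P (m p)) (u := V) hQ hoff
    (cut_lipschitz hS0 hρρ hρ0 hSt hC₁ hK₁ hl₁ hb₁ hbc)
    (fun j => cut_lipschitz hS0 hρρ hρ0 hSt (mul_nonneg hC₁ hN) (by positivity) (hPV j) (hPVb j)
        (fun p hp hφ => by rw [hbc p hp hφ, zero_mul]))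
  refine ⟨_, i1.1.add i2.1, ?_, ?_⟩
  · simp only [Pi.add_apply]
    rw [integral_add i1.1 i2.1, i1.2, i2.2, add_zero]
  have herr : 0 ≤ errC κ M N B K S d * δ := by
    unfold errC; positivity
  filter_upwards [ae_fst_ne t₀, ae_differentiableAt_cone t₀ x₀ ρ' hS0.le, H.eq_m, H.eq_R,
    H.lip_m.ae_differentiableAt, H.lip_R.ae_differentiableAt, H.lip_V.ae_differentiableAt]
    with p hpt hcd hem heR hmd hRd hVd
  have hind : 0 ≤ indicator (Icc t₀ t₁ ×ˢ closedBall x₀ ρ)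
      (fun _ => errC κ M N B K S d * δ) p := indicator_nonneg (fun _ _ => herr) _
  have hzero : (∀ G : ℝ × (𝔼 d) → ℝ, ∀ C, (∀ q ∈ cyl t₀ t₁ x₀ ρ, |G q| ≤ C) →
      HasFDerivAt (cut t₀ (cone t₀ x₀ ρ' S) G) (0 : ℝ × (𝔼 d) →L[ℝ] ℝ) p) →
      fluxDiv t₀ (cone t₀ x₀ ρ' S) (fun p => f (m p) * hfun m R u V p) u p +
      fluxDiv t₀ (cone t₀ x₀ ρ' S) (fun p => P (R p) - P (m p)) V p = 0 := by
    intro h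
    rw [fluxDiv_eq_zero (h _ _ hb₀) (fun j => by
      obtain ⟨C, K', hC, hK', hl, -, hb⟩ := hj j
      exact h _ _ hb), fluxDiv_eq_zero (h _ _ hb₁) (fun j => h _ _ (hPVb j)), add_zero]
  simp only [Pi.add_apply]
  rcases lt_or_gt_of_ne hpt with ht | ht
  · rw [hzero fun G C _ => hasFDerivAt_cut_of_lt _ G ht]
    have : density t₀ x₀ ρ' S σ m R u V p = 0 := by
      unfold density
      rw [indicator_of_notMem (fun h => lt_asymm ht h.1),
        indicator_of_notMem (fun h => lt_asymm ht h.1.1), add_zero]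
    rw [this]; linarith
  · rcases (cone_nonneg t₀ x₀ ρ' S p).eq_or_lt with hφ | hφ
    · rw [hzero fun G C hG => hasFDerivAt_cut_of_cone_eq_zero hS0 hρρ hSt hG ht hcd hφ.symm]
      have : density t₀ x₀ ρ' S σ m R u V p = 0 := by
        unfold density
        rw [indicator_of_notMem (fun h => hφ.not_lt h.2),
          indicator_of_notMem (fun h => hφ.not_lt h.1.2), add_zero]
      rw [this]; linarith
    · have hp : p ∈ cyl t₀ t₁ x₀ ρ := mem_of_cone_pos hS0 hρρ hSt ht.le hφ
      have hpO : p ∈ {q | t₀ < q.1 ∧ 0 < cone t₀ x₀ ρ' S q} := ⟨ht, hφ⟩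
      have hpQ : p ∈ Icc t₀ t₁ ×ˢ closedBall x₀ ρ :=
        ⟨Ico_subset_Icc_self hp.1, ball_subset_closedBall hp.2⟩
      rw [indicator_of_mem hpQ]
      unfold density
      rw [indicator_of_mem hpO]
      rcases (H.m_nonneg p hp).eq_or_lt with hm | hm
      · have := H.fluxDiv_le_of_eq_zero hκ hσ hκσ hδ.le hf hρ0 hρ1 hρ hS0.le hS hp ht hm.symm hφ
          hcd (hmd hp ht) (hRd hp ht) (hVd hp ht) (heR hp ht).2
        rw [indicator_of_notMem (fun h => hm.not_lt h.2)]
        linarith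
      · obtain ⟨h1, h2, h3⟩ := hem hp ht hm
        have := H.fluxDiv_le_of_pos hκ hσ hκσ hδ.le hf hρ0 hρ1 hρ hS0.le hS hp ht hm hφ
          hcd (hmd hp ht) (hRd hp ht) (hVd hp ht) h1 h2 h3 (heR hp ht).1 (heR hp ht).2
        have hmem : p ∈ {q | t₀ < q.1 ∧ 0 < cone t₀ x₀ ρ' S q} ∩ {q | 0 < m q} := ⟨hpO, hm⟩
        rw [indicator_of_mem hmem]
        linarith

set_option maxHeartbeats 1000000 in
/-- **Uniqueness in the cone**: the two states agree in the forward cone of the base on which they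
agree initially. -/
theorem agree (H : Core κ M N B K t₀ t₁ x₀ ρ m R u V) {S ρ' : ℝ} (hκ : 0 < κ)
    (hρ0 : 0 ≤ ρ') (hρρ : ρ' ≤ ρ) (hρ1 : ρ' ≤ 1) (hρ : (2 * B + 2 * K + d * K * κ) * ρ' ≤ 1)
    (hS : 3 * N + 3 + cEnt (1 / κ) * M / 2 ≤ S) (hSt : ρ' ≤ S * (t₁ - t₀))
    (hbase : ∀ p : ℝ × 𝔼 d, p.1 = t₀ → 0 < cone t₀ x₀ ρ' S p →
      m p = max (R p) 0 ∧ (0 < m p → u p = V p))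
    {p : ℝ × 𝔼 d} (hpt : t₀ ≤ p.1) (hpc : 0 < cone t₀ x₀ ρ' S p) :
    m p = max (R p) 0 ∧ (0 < m p → u p = V p) := by
  rcases hpt.eq_or_lt with h | hpt
  · exact hbase p h.symm hpc
  set σ := 1 / κ with hσdef
  have hσ : 0 < σ := by positivity
  have hκσ : κ * σ = 1 := by rw [hσdef]; field_simp
  have hM := H.M_pos
  have hN := H.N_nonneg
  have hce := cEnt_pos hσ
  have hS0 : 0 < S := by
    have : 0 ≤ cEnt σ * M / 2 := by positivity
    linarith
  set O := {q : ℝ × 𝔼 d | t₀ < q.1 ∧ 0 < cone t₀ x₀ ρ' S q} with hO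
  have hOopen : IsOpen O := isOpen_cone_set t₀ x₀ ρ' S
  have hOcyl : O ⊆ cyl t₀ t₁ x₀ ρ := fun q hq => mem_of_cone_pos hS0 hρρ hSt hq.1.le hq.2
  have hmO : ContinuousOn m O := H.lip_m.continuousOn.mono hOcyl
  have hRO : ContinuousOn R O := H.lip_R.continuousOn.mono hOcyl
  have hO' : IsOpen (O ∩ {q | 0 < m q}) := hmO.isOpen_inter_preimage hOopen isOpen_Ioi
  have hc1 : ContinuousOn (fun q => relEnt σ (m q) (R q)) O :=
    (continuous_relEnt hσ).comp_continuousOn (hmO.prodMk hRO)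
  have hc2 : ContinuousOn (fun q => 1 / 2 * (m q) ^ σ * ‖u q - V q‖ ^ 2)
      (O ∩ {q | 0 < m q}) := by
    have a1 : ContinuousOn (fun q => (m q) ^ σ) (O ∩ {q | 0 < m q}) :=
      (Real.continuous_rpow_const hσ.le).comp_continuousOn (hmO.mono inter_subset_left)
    have a2 : ContinuousOn (fun q => u q - V q) (O ∩ {q | 0 < m q}) :=
      (H.lip_u.continuousOn.mono (inter_subset_inter_left _ hOcyl)).sub
        (H.lip_V.continuousOn.mono (inter_subset_left.trans hOcyl))
    exact (continuousOn_const.mul a1).mul (a2.norm.pow 2)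
  set ψ := density t₀ x₀ ρ' S σ m R u V with hψ
  have hψ1 : ∀ q, 0 ≤ indicator O (fun q => relEnt σ (m q) (R q)) q := fun q =>
    indicator_nonneg (fun q hq => relEnt_nonneg hσ (H.m_nonneg q (hOcyl hq))) q
  have hψ2 : ∀ q, 0 ≤ indicator (O ∩ {q | 0 < m q})
      (fun q => 1 / 2 * (m q) ^ σ * ‖u q - V q‖ ^ 2) q := fun q =>
    indicator_nonneg (fun q hq => by
      have : 0 < m q := hq.2
      positivity) q
  have hψ0 : ∀ q, 0 ≤ ψ q := fun q => add_nonneg (hψ1 q) (hψ2 q)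
  have hmeas : AEStronglyMeasurable ψ volume :=
    ((aestronglyMeasurable_indicator_iff hOopen.measurableSet).2
      (hc1.aestronglyMeasurable hOopen.measurableSet)).add
    ((aestronglyMeasurable_indicator_iff hO'.measurableSet).2
      (hc2.aestronglyMeasurable hO'.measurableSet))
  have hQ := isCompact_box t₀ t₁ x₀ ρ
  have hQint : ∀ c : ℝ, Integrable
      (indicator (Icc t₀ t₁ ×ˢ closedBall x₀ ρ) (fun _ : ℝ × 𝔼 d => c)) := fun c =>
    (integrable_indicator_iff hQ.measurableSet).2 (integrableOn_const hQ.measure_lt_top.ne)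
  have key : ∀ δ : ℝ, 0 < δ → Integrable ψ ∧ ∫ q, ψ q ≤
      errC κ M N B K S d * δ * (volume : Measure (ℝ × 𝔼 d)).real
        (Icc t₀ t₁ ×ˢ closedBall x₀ ρ) := by
    intro δ hδ
    obtain ⟨D, hD, hD0, hle⟩ := H.exists_integrable_bound hκ hσ hκσ hδ hρ0 hρρ hρ1 hρ hS0 hS hSt
      hbase
    have hi : Integrable (fun p => -D p + indicator (Icc t₀ t₁ ×ˢ closedBall x₀ ρ)
      (fun _ => errC κ M N B K S d * δ) p) := hD.neg.add (hQint _)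
    have hψi : Integrable ψ := hi.mono' hmeas (by
      filter_upwards [hle] with q hq
      rw [Real.norm_eq_abs, abs_of_nonneg (hψ0 q)]
      exact hq)
    refine ⟨hψi, (integral_mono_ae hψi hi hle).trans (le_of_eq ?_)⟩
    have hDn : Integrable (fun q => -D q) := hD.neg
    rw [integral_add hDn (hQint _), integral_neg, hD0, integral_indicator hQ.measurableSet,
      setIntegral_const, smul_eq_mul]
    ring
  have hle_int : ∫ q, ψ q ≤ 0 := by
    have hlim : Tendsto (fun δ : ℝ => errC κ M N B K S d * δ * (volume : Measure (ℝ × 𝔼 d)).real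
        (Icc t₀ t₁ ×ˢ closedBall x₀ ρ)) (𝓝[>] 0) (𝓝 (errC κ M N B K S d * 0 *
        (volume : Measure (ℝ × 𝔼 d)).real (Icc t₀ t₁ ×ˢ closedBall x₀ ρ))) :=
      (Continuous.tendsto (by fun_prop) 0).mono_left nhdsWithin_le_nhds
    rw [mul_zero, zero_mul] at hlim
    exact ge_of_tendsto hlim (by filter_upwards [self_mem_nhdsWithin] with δ hδ using (key δ hδ).2)
  have hae : ψ =ᵐ[volume] 0 := (integral_eq_zero_iff_of_nonneg hψ0 (key 1 one_pos).1).1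
    (le_antisymm hle_int (integral_nonneg hψ0))
  have z1 : EqOn (fun q => relEnt σ (m q) (R q)) 0 O := by
    apply Measure.eqOn_open_of_ae_eq (μ := volume) ?_ hOopen hc1 continuousOn_const
    rw [Filter.EventuallyEq, ae_restrict_iff' hOopen.measurableSet]
    filter_upwards [hae] with q hq hqO
    have h1 := hψ1 q
    have h2 := hψ2 q
    have h3 : indicator O (fun q => relEnt σ (m q) (R q)) q + indicator (O ∩ {q | 0 < m q})
      (fun q => 1 / 2 * (m q) ^ σ * ‖u q - V q‖ ^ 2) q = 0 := hq
    have h4 : indicator O (fun q => relEnt σ (m q) (R q)) q = 0 := by linarith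
    rw [indicator_of_mem hqO] at h4
    exact h4
  have z2 : EqOn (fun q => 1 / 2 * (m q) ^ σ * ‖u q - V q‖ ^ 2) 0 (O ∩ {q | 0 < m q}) := by
    apply Measure.eqOn_open_of_ae_eq (μ := volume) ?_ hO' hc2 continuousOn_const
    rw [Filter.EventuallyEq, ae_restrict_iff' hO'.measurableSet]
    filter_upwards [hae] with q hq hqO
    have h1 := hψ1 q
    have h2 := hψ2 q
    have h3 : indicator O (fun q => relEnt σ (m q) (R q)) q + indicator (O ∩ {q | 0 < m q})
      (fun q => 1 / 2 * (m q) ^ σ * ‖u q - V q‖ ^ 2) q = 0 := hq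
    have h4 : indicator (O ∩ {q | 0 < m q})
      (fun q => 1 / 2 * (m q) ^ σ * ‖u q - V q‖ ^ 2) q = 0 := by linarith
    rw [indicator_of_mem hqO] at h4
    exact h4
  have hpO : p ∈ O := ⟨hpt, hpc⟩
  refine ⟨eq_max_of_relEnt_eq_zero hσ (H.m_nonneg p (hOcyl hpO)) (z1 hpO), fun hm => ?_⟩
  have h5 : 1 / 2 * (m p) ^ σ * ‖u p - V p‖ ^ 2 = 0 := z2 ⟨hpO, hm⟩
  have h6 : 0 < (m p) ^ σ := Real.rpow_pos_of_pos hm σ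
  have h7 : ‖u p - V p‖ ^ 2 = 0 := by
    rcases mul_eq_zero.1 h5 with h | h
    · linarith
    · exact h
  exact sub_eq_zero.1 (norm_eq_zero.1 (pow_eq_zero_iff (two_ne_zero)|>.1 h7))

end Core

end CoreUniqueness

section OneDimensional

lemma posPart_sub_le_of_deriv {g g' : ℝ → ℝ} {a b K : ℝ} (hab : a ≤ b) (hK : 0 ≤ K)
    (hg : ContinuousOn g (Icc a b))
    (hd : ∀ s ∈ Icc a b, 0 < g s → HasDerivWithinAt g (g' s) (Icc a b) s ∧ g' s ≤ K) :
    max (g b) 0 - max (g a) 0 ≤ K * (b - a) := by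
  rcases le_or_gt (g b) 0 with hb | hb
  · rw [max_eq_right hb]
    have := mul_nonneg hK (sub_nonneg.2 hab)
    linarith [le_max_right (g a) 0]
  rw [max_eq_left hb.le]
  have main : ∀ s ∈ Icc a b, (∀ z ∈ Ioc s b, 0 < g z) → g b - g s ≤ K * (b - s) := by
    intro s hs hpos
    have hsub : Icc s b ⊆ Icc a b := Icc_subset_Icc_left hs.1
    rcases hs.2.eq_or_lt with h | h
    · rw [h]; simp
    have hderiv : ∀ z ∈ Ioo s b, HasDerivAt g (g' z) z := fun z hz =>
      (hd z (hsub ⟨hz.1.le, hz.2.le⟩) (hpos z ⟨hz.1, hz.2.le⟩)).1.hasDerivAt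
        (Icc_mem_nhds (hs.1.trans_lt hz.1) hz.2)
    obtain ⟨z, hz, he⟩ := exists_hasDerivAt_eq_slope g g' h (hg.mono hsub) hderiv
    have h1 := (hd z (hsub ⟨hz.1.le, hz.2.le⟩) (hpos z ⟨hz.1, hz.2.le⟩)).2
    rw [he, div_le_iff₀ (by linarith)] at h1
    exact h1
  by_cases hz : ∃ s ∈ Icc a b, g s ≤ 0
  · have hcomp : IsCompact (Icc a b ∩ g ⁻¹' Iic 0) :=
      isCompact_Icc.of_isClosed_subset (hg.preimage_isClosed_of_isClosed isClosed_Icc isClosed_Iic)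
        inter_subset_left
    obtain ⟨s, hs, hmax⟩ := hcomp.exists_isGreatest (by
      obtain ⟨s, hs, h⟩ := hz
      exact ⟨s, hs, h⟩)
    have h1 := main s hs.1 (fun z hz => by
      by_contra h
      have := hmax ⟨⟨hs.1.1.trans hz.1.le, hz.2⟩, not_lt.1 h⟩
      linarith [hz.1])
    have h2 : g s ≤ 0 := hs.2
    have h3 : K * (b - s) ≤ K * (b - a) := by gcongr; exact hs.1.1
    have h4 : 0 ≤ g s := by
      by_contra h
      have hs' : s < b := by
        rcases hs.1.2.eq_or_lt with h' | h'
        · rw [h'] at h2; linarith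
        · exact h'
      have hivt := intermediate_value_Icc hs'.le (hg.mono (Icc_subset_Icc_left hs.1.1))
      obtain ⟨z, hz, hz0⟩ := hivt (⟨h2, hb.le⟩ : (0:ℝ) ∈ Icc (g s) (g b))
      have h5 := hmax ⟨⟨hs.1.1.trans hz.1, hz.2⟩, hz0.le⟩
      have h6 : z = s := le_antisymm h5 hz.1
      rw [← h6] at h
      linarith
    linarith [le_max_right (g a) 0]
  · push Not at hz
    have := main a ⟨le_rfl, hab⟩ (fun z hz' => hz z ⟨hz'.1.le, hz'.2⟩)
    linarith [le_max_left (g a) 0]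

lemma abs_posPart_sub_le_of_deriv {g g' : ℝ → ℝ} {a b K : ℝ} (hab : a ≤ b) (hK : 0 ≤ K)
    (hg : ContinuousOn g (Icc a b))
    (hd : ∀ s ∈ Icc a b, 0 < g s → HasDerivWithinAt g (g' s) (Icc a b) s ∧ |g' s| ≤ K) :
    |max (g b) 0 - max (g a) 0| ≤ K * (b - a) := by
  have h1 := posPart_sub_le_of_deriv hab hK hg
    (fun s hs h => ⟨(hd s hs h).1, (abs_le.1 (hd s hs h).2).2⟩)
  have hmaps : MapsTo (fun s : ℝ => -s) (Icc (-b) (-a)) (Icc a b) := fun s hs =>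
    ⟨by linarith [hs.2], by linarith [hs.1]⟩
  have h2 := posPart_sub_le_of_deriv (g := fun s => g (-s)) (g' := fun s => -(g' (-s)))
    (a := -b) (b := -a) (by linarith) hK (hg.comp continuous_neg.continuousOn hmaps)
    (fun s hs h => by
      obtain ⟨a1, a2⟩ := hd (-s) (hmaps hs) h
      refine ⟨?_, by linarith [(abs_le.1 a2).1]⟩
      have := HasDerivWithinAt.scomp s a1 (hasDerivAt_neg s).hasDerivWithinAt hmaps
      simpa [Function.comp_def] using this)
  simp only [neg_neg] at h2
  rw [abs_le]
  constructor <;> linarith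

end OneDimensional

section Solution

variable {d : ℕ}

/-- A solution of the free boundary Euler system in the uniqueness class on `[0, T]`. -/
structure Sol (κ T L c Mv Mr : ℝ) (r : ℝ → (𝔼 d) → ℝ) (v : ℝ → (𝔼 d) → 𝔼 d) : Prop where
  κ_pos : 0 < κ
  L_nonneg : 0 ≤ L
  c_pos : 0 < c
  Mv_nonneg : 0 ≤ Mv
  Mr_nonneg : 0 ≤ Mr
  rcont : Continuous fun p : ℝ × 𝔼 d => r p.1 p.2
  vcont : Continuous fun p : ℝ × 𝔼 d => v p.1 p.2
  lip : ∀ t ∈ Icc (0:ℝ) T, ∀ x y, |r t x - r t y| ≤ L * ‖x - y‖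
  nondeg : ∀ t ∈ Icc (0:ℝ) T, ∀ x, 0 < r t x → c * infDist x {y | ¬ 0 < r t y} ≤ r t x
  vdiff : ∀ t ∈ Icc (0:ℝ) T, ∀ x, 0 < r t x → DifferentiableAt ℝ (v t) x
  gradv : ∀ t ∈ Icc (0:ℝ) T, ∀ x, 0 < r t x → ‖fderiv ℝ (v t) x‖ ≤ Mv
  gradr : ∀ t ∈ Icc (0:ℝ) T, ∀ x, 0 < r t x → ∀ y, 0 < r t y →
    ‖gradient (r t) x - gradient (r t) y‖ ≤ Mr * (√(r t x) + √(r t y) + √‖x - y‖)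
  eqr : ∀ t ∈ Icc (0:ℝ) T, ∀ x, 0 < r t x → HasDerivWithinAt (fun τ => r τ x)
    (-(@inner ℝ _ _ (v t x) (gradient (r t) x) + κ * r t x * vdiv (v t) x)) (Icc 0 T) t
  eqv : ∀ t ∈ Icc (0:ℝ) T, ∀ x, 0 < r t x → HasDerivWithinAt (fun τ => v τ x)
    (-(fderiv ℝ (v t) x (v t x) + gradient (r t) x)) (Icc 0 T) t

/-- The speed at which `r` changes in time where `|v| ≤ N` and `r ≤ M`. -/
def rateR (d : ℕ) (κ L Mv N M : ℝ) : ℝ := N * L + κ * M * (d * Mv)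

namespace Sol

variable {κ T L c Mv Mr : ℝ} {r : ℝ → (𝔼 d) → ℝ} {v : ℝ → (𝔼 d) → 𝔼 d}

lemma norm_gradient_le (H : Sol κ T L c Mv Mr r v) {t : ℝ} (ht : t ∈ Icc (0:ℝ) T) (x : 𝔼 d) :
    ‖gradient (r t) x‖ ≤ L := by
  rw [gradient, LinearIsometryEquiv.norm_map]
  exact norm_fderiv_le_of_lip' ℝ H.L_nonneg (Eventually.of_forall fun y => H.lip t ht y x)

lemma abs_vdiv_le (H : Sol κ T L c Mv Mr r v) {t : ℝ} (ht : t ∈ Icc (0:ℝ) T) {x : 𝔼 d}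
    (hx : 0 < r t x) : |vdiv (v t) x| ≤ d * Mv := by
  unfold vdiv
  refine (Finset.abs_sum_le_sum_abs _ _).trans ?_
  have : ∀ i ∈ (Finset.univ : Finset (Fin d)), |@inner ℝ _ _
      (fderiv ℝ (v t) x (EuclideanSpace.single i 1)) (EuclideanSpace.single i (1:ℝ))| ≤ Mv := by
    intro i _
    refine (abs_real_inner_le_norm _ _).trans ?_
    have h1 := (fderiv ℝ (v t) x).le_of_opNorm_le (H.gradv t ht x hx) (EuclideanSpace.single i 1)
    simpa using h1
  refine (Finset.sum_le_sum this).trans ?_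
  simp

lemma isOpen_pos (H : Sol κ T L c Mv Mr r v) : IsOpen {p : ℝ × 𝔼 d | 0 < r p.1 p.2} :=
  isOpen_lt continuous_const H.rcont

lemma continuous_slice (H : Sol κ T L c Mv Mr r v) (t : ℝ) : Continuous (r t) :=
  H.rcont.comp (Continuous.prodMk_right t)

lemma isOpen_slice (H : Sol κ T L c Mv Mr r v) (t : ℝ) : IsOpen {x | 0 < r t x} :=
  isOpen_lt continuous_const (H.continuous_slice t)

lemma rateR_nonneg (H : Sol κ T L c Mv Mr r v) {N M : ℝ} (hN : 0 ≤ N) (hM : 0 ≤ M) :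
    0 ≤ rateR d κ L Mv N M := by
  have := H.κ_pos
  have := H.L_nonneg
  have := H.Mv_nonneg
  unfold rateR
  positivity

lemma abs_rate_le (H : Sol κ T L c Mv Mr r v) {t : ℝ} (ht : t ∈ Icc (0:ℝ) T) {x : 𝔼 d}
    (hx : 0 < r t x) {N M : ℝ} (hv : ‖v t x‖ ≤ N) (hr : r t x ≤ M) :
    |-(@inner ℝ _ _ (v t x) (gradient (r t) x) + κ * r t x * vdiv (v t) x)| ≤
      rateR d κ L Mv N M := by
  rw [abs_neg]
  refine (abs_add_le _ _).trans ?_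
  have hκ := H.κ_pos
  have hM : 0 ≤ M := hx.le.trans hr
  have hN : 0 ≤ N := (norm_nonneg _).trans hv
  have h1 : |@inner ℝ _ _ (v t x) (gradient (r t) x)| ≤ N * L :=
    (abs_real_inner_le_norm _ _).trans
      (mul_le_mul hv (H.norm_gradient_le ht x) (norm_nonneg _) hN)
  have h2 : |κ * r t x * vdiv (v t) x| ≤ κ * M * (d * Mv) := by
    rw [abs_mul, abs_mul, abs_of_pos hκ, abs_of_pos hx]
    have := H.abs_vdiv_le ht hx
    gcongr
  unfold rateR
  linarith

lemma abs_posPart_time_le (H : Sol κ T L c Mv Mr r v) {a b N M : ℝ} (hab : a ≤ b) (ha : 0 ≤ a)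
    (hb : b ≤ T) {x : 𝔼 d} (hN : 0 ≤ N) (hM : 0 ≤ M)
    (hbd : ∀ s ∈ Icc a b, 0 < r s x → ‖v s x‖ ≤ N ∧ r s x ≤ M) :
    |max (r b x) 0 - max (r a x) 0| ≤ rateR d κ L Mv N M * (b - a) := by
  have hsub : Icc a b ⊆ Icc 0 T := Icc_subset_Icc ha hb
  refine abs_posPart_sub_le_of_deriv (g := fun s => r s x) hab (H.rateR_nonneg hN hM)
    (H.rcont.comp (Continuous.prodMk_left x)).continuousOn
    (fun s hs h => ⟨(H.eqr s (hsub hs) x h).mono hsub, ?_⟩)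
  exact H.abs_rate_le (hsub hs) h (hbd s hs h).1 (hbd s hs h).2

lemma norm_v_time_le (H : Sol κ T L c Mv Mr r v) {a b N : ℝ} (hab : a ≤ b) (ha : 0 ≤ a)
    (hb : b ≤ T) {x : 𝔼 d} (hbd : ∀ s ∈ Icc a b, 0 < r s x ∧ ‖v s x‖ ≤ N) :
    ‖v b x - v a x‖ ≤ (Mv * N + L) * (b - a) := by
  have hsub : Icc a b ⊆ Icc 0 T := Icc_subset_Icc ha hb
  have h := (convex_Icc a b).norm_image_sub_le_of_norm_hasDerivWithin_le (f := fun s => v s x)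
    (C := Mv * N + L) (fun s hs => (H.eqv s (hsub hs) x (hbd s hs).1).mono hsub) (fun s hs => by
      rw [norm_neg]
      refine (norm_add_le _ _).trans (add_le_add ?_ (H.norm_gradient_le (hsub hs) x))
      refine ((fderiv ℝ (v s) x).le_of_opNorm_le (H.gradv s (hsub hs) x (hbd s hs).1) _).trans ?_
      exact mul_le_mul_of_nonneg_left (hbd s hs).2 H.Mv_nonneg)
    (left_mem_Icc.2 hab) (right_mem_Icc.2 hab)
  rwa [Real.norm_of_nonneg (sub_nonneg.2 hab)] at h

lemma abs_posPart_space_le (H : Sol κ T L c Mv Mr r v) {t : ℝ} (ht : t ∈ Icc (0:ℝ) T) (x y : 𝔼 d) :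
    |max (r t x) 0 - max (r t y) 0| ≤ L * ‖x - y‖ :=
  (abs_max_sub_max_le_abs _ _ _).trans (H.lip t ht x y)

lemma norm_v_space_le (H : Sol κ T L c Mv Mr r v) {t : ℝ} (ht : t ∈ Icc (0:ℝ) T) {x y : 𝔼 d}
    (hpos : ∀ z ∈ segment ℝ x y, 0 < r t z) : ‖v t y - v t x‖ ≤ Mv * ‖y - x‖ :=
  (convex_segment x y).norm_image_sub_le_of_norm_hasFDerivWithin_le (f := v t)
    (fun z hz => (H.vdiff t ht z (hpos z hz)).hasFDerivAt.hasFDerivWithinAt)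
    (fun z hz => H.gradv t ht z (hpos z hz)) (left_mem_segment ℝ x y) (right_mem_segment ℝ x y)

end Sol

end Solution

section JointDerivatives

variable {d : ℕ} {F : Type*} [NormedAddCommGroup F] [NormedSpace ℝ F]

lemma fderiv_slice {f : ℝ × (𝔼 d) → F} {p : ℝ × 𝔼 d} (h : DifferentiableAt ℝ f p) (ζ : 𝔼 d) :
    fderiv ℝ (fun y => f (p.1, y)) p.2 ζ = fderiv ℝ f p (0, ζ) := by
  have h1 : HasFDerivAt (fun y : 𝔼 d => (p.1, y)) (ContinuousLinearMap.inr ℝ ℝ (𝔼 d)) p.2 :=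
    hasFDerivAt_prodMk_right p.1 p.2
  have h2 := HasFDerivAt.comp (g := f) p.2 h.hasFDerivAt h1
  have h3 := h2.fderiv
  rw [show (fun y => f (p.1, y)) = f ∘ fun y : 𝔼 d => (p.1, y) from rfl, h3]
  simp

lemma hasDerivAt_time {f : ℝ × (𝔼 d) → F} {p : ℝ × 𝔼 d} (h : DifferentiableAt ℝ f p) :
    HasDerivAt (fun s => f (s, p.2)) (fderiv ℝ f p (1, 0)) p.1 := by
  have h1 : HasFDerivAt (fun s : ℝ => (s, p.2)) (ContinuousLinearMap.inl ℝ ℝ (𝔼 d)) p.1 :=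
    hasFDerivAt_prodMk_left p.1 p.2
  have h2 := HasFDerivAt.comp (g := f) p.1 h.hasFDerivAt h1
  simpa [Function.comp_def] using h2.hasDerivAt

end JointDerivatives

section LocallyLipschitz

lemma mk_mem_ball {X Y : Type*} [PseudoMetricSpace X] [PseudoMetricSpace Y] {p : X × Y} {δ : ℝ}
    {a : X} {b : Y} (ha : a ∈ ball p.1 δ) (hb : b ∈ ball p.2 δ) : (a, b) ∈ ball p δ := by
  rw [← Prod.mk.eta (p := p), ← ball_prod_same]
  exact ⟨ha, hb⟩

lemma PtLip.ae_differentiableAt_of_isOpen {W F : Type*} [NormedAddCommGroup W] [NormedSpace ℝ W]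
    [FiniteDimensional ℝ W] [MeasurableSpace W] [BorelSpace W] {μ : Measure W} [μ.IsAddHaarMeasure]
    [NormedAddCommGroup F] [NormedSpace ℝ F] [FiniteDimensional ℝ F] {K : ℝ} {f : W → F}
    {O : Set W} (hO : IsOpen O) (h : PtLip K f O) : ∀ᵐ p ∂μ, p ∈ O → DifferentiableAt ℝ f p := by
  have key : μ {p | p ∈ O ∧ ¬ DifferentiableAt ℝ f p} = 0 := by
    refine measure_null_of_locally_null _ fun p hp => ?_
    obtain ⟨δ, hδ, hsub⟩ := Metric.isOpen_iff.1 hO p hp.1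
    have h1 := ((h.mono hsub).mono_const (Real.le_coe_toNNReal K)).lipschitzOnWith
      (convex_ball p δ)
    refine ⟨{q | q ∈ O ∧ ¬ DifferentiableAt ℝ f q} ∩ ball p δ,
      inter_mem self_mem_nhdsWithin (mem_nhdsWithin_of_mem_nhds (ball_mem_nhds p hδ)), ?_⟩
    have h2 := h1.ae_differentiableWithinAt_of_mem (μ := μ)
    refine measure_mono_null (fun q hq => ?_) h2
    simp only [mem_compl_iff, mem_ofPred_eq, not_forall]
    exact ⟨hq.2, fun h' => hq.1.2 (h'.differentiableAt (isOpen_ball.mem_nhds hq.2))⟩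
  have : ∀ᵐ p ∂μ, ¬ (p ∈ O ∧ ¬ DifferentiableAt ℝ f p) := by
    rw [ae_iff]; simpa only [not_not] using key
  filter_upwards [this] with p hp hpO
  by_contra h'
  exact hp ⟨hpO, h'⟩

end LocallyLipschitz

section Solution

variable {d : ℕ}

/-- The nonnegative part of `r`, as a function on space-time. -/
noncomputable def rp (r : ℝ → (𝔼 d) → ℝ) (p : ℝ × 𝔼 d) : ℝ := max (r p.1 p.2) 0

lemma rp_nonneg (r : ℝ → (𝔼 d) → ℝ) (p : ℝ × 𝔼 d) : 0 ≤ rp r p := le_max_right _ _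

lemma rp_pos_iff {r : ℝ → (𝔼 d) → ℝ} {p : ℝ × 𝔼 d} : 0 < rp r p ↔ 0 < r p.1 p.2 := by
  simp [rp]

lemma rp_of_pos {r : ℝ → (𝔼 d) → ℝ} {p : ℝ × 𝔼 d} (h : 0 < r p.1 p.2) : rp r p = r p.1 p.2 :=
  max_eq_left h.le

namespace Sol

variable {κ T L c Mv Mr : ℝ} {r : ℝ → (𝔼 d) → ℝ} {v : ℝ → (𝔼 d) → 𝔼 d}

lemma continuous_rp (H : Sol κ T L c Mv Mr r v) : Continuous (rp r) :=
  H.rcont.max continuous_const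

lemma inner_gradient (f : (𝔼 d) → ℝ) (x ζ : 𝔼 d) :
    @inner ℝ _ _ (gradient f x) ζ = fderiv ℝ f x ζ := by
  simp [gradient]

lemma rp_eventuallyEq (H : Sol κ T L c Mv Mr r v) {p : ℝ × 𝔼 d} (hp : 0 < r p.1 p.2) :
    rp r =ᶠ[𝓝 p] fun q => r q.1 q.2 := by
  filter_upwards [H.isOpen_pos.mem_nhds hp] with q hq
  exact rp_of_pos hq

lemma fderiv_v_apply (H : Sol κ T L c Mv Mr r v) {p : ℝ × 𝔼 d} (h0 : 0 < p.1) (hT : p.1 < T)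
    (hp : 0 < r p.1 p.2) (hd : DifferentiableAt ℝ (fun q : ℝ × 𝔼 d => v q.1 q.2) p) (w : 𝔼 d) :
    fderiv ℝ (fun q : ℝ × 𝔼 d => v q.1 q.2) p (1, w) =
      fderiv ℝ (v p.1) p.2 (w - v p.1 p.2) - gradient (r p.1) p.2 := by
  have h1 := hasDerivAt_time hd
  have h2 := (H.eqv p.1 ⟨h0.le, hT.le⟩ p.2 hp).hasDerivAt (Icc_mem_nhds h0 hT)
  have h3 := h1.unique h2
  have h4 := fderiv_slice hd w
  rw [show ((1:ℝ), w) = (1, 0) + (0, w) by simp, map_add, h3, ← h4, map_sub]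
  abel

lemma fderiv_rp_apply (H : Sol κ T L c Mv Mr r v) {p : ℝ × 𝔼 d} (h0 : 0 < p.1) (hT : p.1 < T)
    (hp : 0 < r p.1 p.2) (hd : DifferentiableAt ℝ (rp r) p) (w : 𝔼 d) :
    fderiv ℝ (rp r) p (1, w) = @inner ℝ _ _ (gradient (r p.1) p.2) (w - v p.1 p.2) -
      κ * r p.1 p.2 * vdiv (v p.1) p.2 ∧
    fderiv ℝ (rp r) p (0, w) = @inner ℝ _ _ (gradient (r p.1) p.2) w := by
  have he := H.rp_eventuallyEq hp
  have hd' : DifferentiableAt ℝ (fun q : ℝ × 𝔼 d => r q.1 q.2) p := he.differentiableAt_iff.1 hd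
  rw [he.fderiv_eq]
  have h1 := hasDerivAt_time hd'
  have h2 := (H.eqr p.1 ⟨h0.le, hT.le⟩ p.2 hp).hasDerivAt (Icc_mem_nhds h0 hT)
  have h3 := h1.unique h2
  have h4 := fderiv_slice hd' w
  have h5 := inner_gradient (r p.1) p.2 w
  constructor
  · rw [show ((1:ℝ), w) = (1, 0) + (0, w) by simp, map_add, h3, ← h4, inner_sub_right,
      real_inner_comm (gradient (r p.1) p.2) (v p.1 p.2), ← h5]
    rw [real_inner_comm (v p.1 p.2)]
    ring
  · rw [← h4, h5]

lemma sdiv_eq_vdiv {p : ℝ × 𝔼 d}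
    (hd : DifferentiableAt ℝ (fun q : ℝ × 𝔼 d => v q.1 q.2) p) :
    sdiv (fun q : ℝ × 𝔼 d => v q.1 q.2) p = vdiv (v p.1) p.2 := by
  unfold sdiv vdiv
  refine Finset.sum_congr rfl fun i _ => ?_
  rw [← fderiv_slice hd]

/-- At a minimum the derivative of `rp` vanishes. -/
lemma fderiv_rp_eq_zero {p : ℝ × 𝔼 d} (hp : ¬ 0 < r p.1 p.2) : fderiv ℝ (rp r) p = 0 := by
  have : IsLocalMin (rp r) p := Eventually.of_forall fun q => by
    have : rp r p = 0 := max_eq_right (not_lt.1 hp)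
    rw [this]
    exact rp_nonneg r q
  exact this.fderiv_eq_zero

lemma norm_v_sub_le (H : Sol κ T L c Mv Mr r v) {t t' N : ℝ} (ht : t ∈ Icc (0:ℝ) T)
    (ht' : t' ∈ Icc (0:ℝ) T) {x x' : 𝔼 d} (hpos : ∀ z ∈ segment ℝ x x', 0 < r t z)
    (hbd : ∀ s ∈ uIcc t t', 0 < r s x' ∧ ‖v s x'‖ ≤ N) :
    ‖v t' x' - v t x‖ ≤ Mv * ‖x' - x‖ + (Mv * N + L) * |t' - t| := by
  have h1 := H.norm_v_space_le ht hpos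
  have h2 : ‖v t' x' - v t x'‖ ≤ (Mv * N + L) * |t' - t| := by
    rcases le_total t t' with h | h
    · rw [uIcc_of_le h] at hbd
      rw [abs_of_nonneg (sub_nonneg.2 h)]
      exact H.norm_v_time_le h ht.1 ht'.2 hbd
    · rw [uIcc_of_ge h] at hbd
      rw [abs_sub_comm, abs_of_nonneg (sub_nonneg.2 h), norm_sub_rev]
      exact H.norm_v_time_le h ht'.1 ht.2 hbd
  have := norm_sub_le_norm_sub_add_norm_sub (v t' x') (v t x') (v t x)
  linarith

lemma abs_rp_sub_le (H : Sol κ T L c Mv Mr r v) {N M : ℝ} (hN : 0 ≤ N) (hM : 0 ≤ M) {p q : ℝ × 𝔼 d}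
    (hp : p.1 ∈ Icc (0:ℝ) T) (hq : q.1 ∈ Icc (0:ℝ) T)
    (hbd : ∀ s ∈ uIcc p.1 q.1, ‖v s q.2‖ ≤ N ∧ |r s q.2| ≤ M) :
    |rp r q - rp r p| ≤ L * ‖q.2 - p.2‖ + rateR d κ L Mv N M * |q.1 - p.1| := by
  have h1 := H.abs_posPart_space_le hp q.2 p.2
  have h2 : |max (r q.1 q.2) 0 - max (r p.1 q.2) 0| ≤ rateR d κ L Mv N M * |q.1 - p.1| := by
    have hbd' : ∀ s ∈ uIcc p.1 q.1, 0 < r s q.2 → ‖v s q.2‖ ≤ N ∧ r s q.2 ≤ M :=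
      fun s hs _ => ⟨(hbd s hs).1, (le_abs_self _).trans (hbd s hs).2⟩
    rcases le_total p.1 q.1 with h | h
    · rw [uIcc_of_le h] at hbd'
      rw [abs_of_nonneg (sub_nonneg.2 h)]
      exact H.abs_posPart_time_le h hp.1 hq.2 hN hM hbd'
    · rw [uIcc_of_ge h] at hbd'
      rw [abs_sub_comm q.1, abs_of_nonneg (sub_nonneg.2 h), abs_sub_comm]
      exact H.abs_posPart_time_le h hq.1 hp.2 hN hM hbd'
  have := abs_sub_le (max (r q.1 q.2) 0) (max (r p.1 q.2) 0) (max (r p.1 p.2) 0)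
  unfold rp
  linarith

end Sol

/-- Bounds for a solution on a space-time cylinder. -/
structure Box (T N M : ℝ) (r : ℝ → (𝔼 d) → ℝ) (v : ℝ → (𝔼 d) → 𝔼 d) (t₀ t₁ : ℝ) (x₀ : 𝔼 d)
    (ρ : ℝ) : Prop where
  t₀_nonneg : 0 ≤ t₀
  t₁_le : t₁ ≤ T
  N_pos : 0 < N
  M_pos : 0 < M
  v_le : ∀ p ∈ cyl t₀ t₁ x₀ ρ, ‖v p.1 p.2‖ ≤ N
  r_le : ∀ p ∈ cyl t₀ t₁ x₀ ρ, |r p.1 p.2| ≤ M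

namespace Box

variable {κ T L c Mv Mr N M t₀ t₁ ρ : ℝ} {r : ℝ → (𝔼 d) → ℝ} {v : ℝ → (𝔼 d) → 𝔼 d} {x₀ : 𝔼 d}

lemma mem_time (Bx : Box T N M r v t₀ t₁ x₀ ρ) {p : ℝ × 𝔼 d} (hp : p ∈ cyl t₀ t₁ x₀ ρ) :
    p.1 ∈ Icc (0:ℝ) T := ⟨Bx.t₀_nonneg.trans hp.1.1, hp.1.2.le.trans Bx.t₁_le⟩

lemma mono (Bx : Box T N M r v t₀ t₁ x₀ ρ) {t₁' ρ' : ℝ} {x' : 𝔼 d} (h1 : t₁' ≤ t₁)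
    (h2 : ball x' ρ' ⊆ ball x₀ ρ) : Box T N M r v t₀ t₁' x' ρ' :=
  ⟨Bx.t₀_nonneg, h1.trans Bx.t₁_le, Bx.N_pos, Bx.M_pos,
    fun p hp => Bx.v_le p ⟨⟨hp.1.1, hp.1.2.trans_le h1⟩, h2 hp.2⟩,
    fun p hp => Bx.r_le p ⟨⟨hp.1.1, hp.1.2.trans_le h1⟩, h2 hp.2⟩⟩

lemma mem_of_uIcc {p q : ℝ × 𝔼 d} (hp : p ∈ cyl t₀ t₁ x₀ ρ) (hq : q ∈ cyl t₀ t₁ x₀ ρ) {s : ℝ}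
    (hs : s ∈ uIcc p.1 q.1) : (s, q.2) ∈ cyl t₀ t₁ x₀ ρ :=
  ⟨(ordConnected_Ico.uIcc_subset hp.1 hq.1) hs, hq.2⟩

lemma abs_rp_sub_le (Bx : Box T N M r v t₀ t₁ x₀ ρ) (H : Sol κ T L c Mv Mr r v) {p q : ℝ × 𝔼 d}
    (hp : p ∈ cyl t₀ t₁ x₀ ρ) (hq : q ∈ cyl t₀ t₁ x₀ ρ) :
    |rp r q - rp r p| ≤ L * ‖q.2 - p.2‖ + rateR d κ L Mv N M * |q.1 - p.1| :=
  H.abs_rp_sub_le Bx.N_pos.le Bx.M_pos.le (Bx.mem_time hp) (Bx.mem_time hq) fun s hs =>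
    ⟨Bx.v_le (s, q.2) (mem_of_uIcc hp hq hs), Bx.r_le (s, q.2) (mem_of_uIcc hp hq hs)⟩

lemma norm_v_sub_le (Bx : Box T N M r v t₀ t₁ x₀ ρ) (H : Sol κ T L c Mv Mr r v) {p q : ℝ × 𝔼 d}
    (hp : p ∈ cyl t₀ t₁ x₀ ρ) (hq : q ∈ cyl t₀ t₁ x₀ ρ)
    (hpos : ∀ z ∈ segment ℝ p.2 q.2, 0 < r p.1 z) (hpos' : ∀ s ∈ uIcc p.1 q.1, 0 < r s q.2) :
    ‖v q.1 q.2 - v p.1 p.2‖ ≤ Mv * ‖q.2 - p.2‖ + (Mv * N + L) * |q.1 - p.1| :=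
  H.norm_v_sub_le (Bx.mem_time hp) (Bx.mem_time hq) hpos fun s hs =>
    ⟨hpos' s hs, Bx.v_le (s, q.2) (mem_of_uIcc hp hq hs)⟩

lemma ptLip_rp (Bx : Box T N M r v t₀ t₁ x₀ ρ) (H : Sol κ T L c Mv Mr r v) :
    PtLip (L + rateR d κ L Mv N M) (rp r) (cyl t₀ t₁ x₀ ρ) := by
  intro p hp
  filter_upwards [self_mem_nhdsWithin] with q hq
  refine (Bx.abs_rp_sub_le H hp hq).trans ?_
  have h1 : ‖q.2 - p.2‖ ≤ ‖q - p‖ := norm_snd_le (q - p)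
  have h2 : |q.1 - p.1| ≤ ‖q - p‖ := norm_fst_le (q - p)
  have := H.L_nonneg
  have := H.rateR_nonneg Bx.N_pos.le Bx.M_pos.le
  rw [add_mul]
  gcongr

lemma ptLip_v (Bx : Box T N M r v t₀ t₁ x₀ ρ) (H : Sol κ T L c Mv Mr r v) :
    PtLip (Mv + (Mv * N + L)) (fun p : ℝ × 𝔼 d => v p.1 p.2)
      (cyl t₀ t₁ x₀ ρ ∩ {p | 0 < r p.1 p.2}) := by
  intro p hp
  obtain ⟨δ, hδ, hsub⟩ := Metric.isOpen_iff.1 H.isOpen_pos p hp.2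
  filter_upwards [self_mem_nhdsWithin, mem_nhdsWithin_of_mem_nhds (ball_mem_nhds p hδ)]
    with q hq hqδ
  have hq1 : dist q.1 p.1 < δ := (le_max_left _ _).trans_lt hqδ
  have hq2 : dist q.2 p.2 < δ := (le_max_right _ _).trans_lt hqδ
  refine (Bx.norm_v_sub_le H hp.1 hq.1 (fun z hz => ?_) (fun s hs => ?_)).trans ?_
  · have hz' : z ∈ ball p.2 δ := (convex_ball p.2 δ).segment_subset (mem_ball_self hδ) hq2 hz
    exact hsub (mk_mem_ball (mem_ball_self hδ) hz')
  · have hs' : s ∈ ball p.1 δ := by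
      rw [Real.ball_eq_Ioo] at *
      exact ordConnected_Ioo.uIcc_subset (by simp [hδ]) (by
        rw [← Real.ball_eq_Ioo]; exact hq1) hs
    exact hsub (mk_mem_ball hs' hq2)
  · have h1 : ‖q.2 - p.2‖ ≤ ‖q - p‖ := norm_snd_le (q - p)
    have h2 : |q.1 - p.1| ≤ ‖q - p‖ := norm_fst_le (q - p)
    have := H.L_nonneg
    have := H.Mv_nonneg
    have := Bx.N_pos
    rw [add_mul Mv]
    gcongr

lemma ae_differentiableAt_v (Bx : Box T N M r v t₀ t₁ x₀ ρ) (H : Sol κ T L c Mv Mr r v) :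
    ∀ᵐ p : ℝ × 𝔼 d, p ∈ cyl t₀ t₁ x₀ ρ → t₀ < p.1 → 0 < r p.1 p.2 →
      DifferentiableAt ℝ (fun q : ℝ × 𝔼 d => v q.1 q.2) p := by
  have hO : IsOpen ((Ioo t₀ t₁ ×ˢ ball x₀ ρ) ∩ {p : ℝ × 𝔼 d | 0 < r p.1 p.2}) :=
    (isOpen_Ioo.prod isOpen_ball).inter H.isOpen_pos
  have h1 := (Bx.ptLip_v H).mono (t := (Ioo t₀ t₁ ×ˢ ball x₀ ρ) ∩ {p : ℝ × 𝔼 d | 0 < r p.1 p.2})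
    (fun p hp => ⟨⟨⟨hp.1.1.1.le, hp.1.1.2⟩, hp.1.2⟩, hp.2⟩)
  filter_upwards [h1.ae_differentiableAt_of_isOpen (μ := volume) hO] with p hp hpc ht hr
  have hmem : p ∈ (Ioo t₀ t₁ ×ˢ ball x₀ ρ) ∩ {p : ℝ × 𝔼 d | 0 < r p.1 p.2} :=
    ⟨⟨⟨ht, hpc.1.2⟩, hpc.2⟩, hr⟩
  exact hp hmem

/-- The physical state `(rp r, v)` solves the system almost everywhere in the gas. -/
lemma eq_m (Bx : Box T N M r v t₀ t₁ x₀ ρ) (H : Sol κ T L c Mv Mr r v) :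
    ∀ᵐ p : ℝ × 𝔼 d, p ∈ cyl t₀ t₁ x₀ ρ → t₀ < p.1 → 0 < rp r p →
      DifferentiableAt ℝ (fun q : ℝ × 𝔼 d => v q.1 q.2) p ∧
      (∀ ζ, @inner ℝ _ _ (fderiv ℝ (fun q : ℝ × 𝔼 d => v q.1 q.2) p (1, v p.1 p.2)) ζ +
        fderiv ℝ (rp r) p (0, ζ) = 0) ∧
      fderiv ℝ (rp r) p (1, v p.1 p.2) =
        -(κ * rp r p * sdiv (fun q : ℝ × 𝔼 d => v q.1 q.2) p) := by
  filter_upwards [Bx.ae_differentiableAt_v H, (Bx.ptLip_rp H).ae_differentiableAt] with p h1 h2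
    hp ht hr
  rw [rp_pos_iff] at hr
  have h0 : 0 < p.1 := Bx.t₀_nonneg.trans_lt ht
  have hT : p.1 < T := hp.1.2.trans_le Bx.t₁_le
  have hv := h1 hp ht hr
  refine ⟨hv, fun ζ => ?_, ?_⟩
  · rw [H.fderiv_v_apply h0 hT hr hv, (H.fderiv_rp_apply h0 hT hr (h2 hp ht) ζ).2]
    simp
  · rw [(H.fderiv_rp_apply h0 hT hr (h2 hp ht) _).1, Sol.sdiv_eq_vdiv hv, rp_of_pos hr]
    simp

end Box

end Solution

section GradientEstimates

variable {d : ℕ} {κ T L c Mv Mr : ℝ} {r : ℝ → (𝔼 d) → ℝ} {v : ℝ → (𝔼 d) → 𝔼 d}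

namespace Sol

lemma lipschitzWith (H : Sol κ T L c Mv Mr r v) {t : ℝ} (ht : t ∈ Icc (0:ℝ) T) :
    LipschitzWith (Real.toNNReal L) (r t) := by
  apply LipschitzWith.of_dist_le_mul
  intro x y
  rw [Real.dist_eq, dist_eq_norm, Real.coe_toNNReal _ H.L_nonneg]
  exact H.lip t ht x y

/-- Along a segment inside the gas, `r` is affine up to the oscillation of its gradient. -/
lemma abs_sub_sub_inner_le (H : Sol κ T L c Mv Mr r v) {t : ℝ} (ht : t ∈ Icc (0:ℝ) T)
    {A : Set (𝔼 d)} (hA : IsOpen A) {G : 𝔼 d} {ε : ℝ}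
    (hG : ∀ z ∈ A, 0 < r t z → ‖gradient (r t) z - G‖ ≤ ε) {y ξ : 𝔼 d}
    (hseg : ∀ z ∈ segment ℝ y (y + ξ), z ∈ A ∧ 0 < r t z) :
    |r t (y + ξ) - r t y - @inner ℝ _ _ G ξ| ≤ ε * ‖ξ‖ := by
  have hcomp : IsCompact (segment ℝ y (y + ξ)) := by
    rw [← convexHull_pair]
    exact (Set.toFinite {y, y + ξ}).isCompact_convexHull ℝ
  obtain ⟨δ, hδ, hsub⟩ := hcomp.exists_thickening_subset_open (hA.inter (H.isOpen_slice t)) hseg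
  refine segment_estimate_real (μ := volume) isOpen_thickening
    ((convex_segment y (y + ξ)).thickening δ) (H.lipschitzWith ht).lipschitzOnWith ξ
    (@inner ℝ _ _ G ξ) (ε * ‖ξ‖) (Eventually.of_forall fun q hq => ?_)
    (self_subset_thickening hδ _ (left_mem_segment ℝ _ _))
    (self_subset_thickening hδ _ (right_mem_segment ℝ _ _))
  rw [← inner_gradient, ← inner_sub_left]
  refine (abs_real_inner_le_norm _ _).trans ?_
  exact mul_le_mul_of_nonneg_right (hG q (hsub hq).1 (hsub hq).2) (norm_nonneg _)

/-- Closeness of gradients at two times from closeness of the functions. -/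
lemma norm_gradient_compare (H : Sol κ T L c Mv Mr r v) {t t' : ℝ} (ht : t ∈ Icc (0:ℝ) T)
    (ht' : t' ∈ Icc (0:ℝ) T) {y G G' : 𝔼 d} {δ ε η : ℝ} (hδ : 0 < δ)
    (hpos : ∀ z ∈ ball y δ, 0 < r t z) (hpos' : ∀ z ∈ ball y δ, 0 < r t' z)
    (hG : ∀ z ∈ ball y δ, ‖gradient (r t) z - G‖ ≤ ε)
    (hG' : ∀ z ∈ ball y δ, ‖gradient (r t') z - G'‖ ≤ ε)
    (hη : ∀ z ∈ ball y δ, |r t' z - r t z| ≤ η) :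
    ‖G' - G‖ ≤ 2 * ε + 4 * η / δ := by
  have hε : 0 ≤ ε := (norm_nonneg _).trans (hG y (mem_ball_self hδ))
  have hη0 : 0 ≤ η := (abs_nonneg _).trans (hη y (mem_ball_self hδ))
  rcases eq_or_ne (G' - G) 0 with h0 | h0
  · rw [h0, norm_zero]; positivity
  have hn : 0 < ‖G' - G‖ := norm_pos_iff.2 h0
  set ξ : 𝔼 d := (δ / 2 * ‖G' - G‖⁻¹) • (G' - G) with hξ
  have hξn : ‖ξ‖ = δ / 2 := by
    rw [hξ, norm_smul, Real.norm_of_nonneg (by positivity)]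
    field_simp
  have hmem : y + ξ ∈ ball y δ := by
    rw [mem_ball, dist_eq_norm, add_sub_cancel_left, hξn]; linarith
  have hsegb : segment ℝ y (y + ξ) ⊆ ball y δ :=
    (convex_ball y δ).segment_subset (mem_ball_self hδ) hmem
  have h1 := H.abs_sub_sub_inner_le ht isOpen_ball (fun z hz _ => hG z hz)
    (fun z hz => ⟨hsegb hz, hpos z (hsegb hz)⟩)
  have h2 := H.abs_sub_sub_inner_le ht' isOpen_ball (fun z hz _ => hG' z hz)
    (fun z hz => ⟨hsegb hz, hpos' z (hsegb hz)⟩)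
  have h3 := hη y (mem_ball_self hδ)
  have h4 := hη _ hmem
  have h5 : @inner ℝ _ _ G' ξ - @inner ℝ _ _ G ξ = δ / 2 * ‖G' - G‖ := by
    rw [← inner_sub_left, hξ, real_inner_smul_right, real_inner_self_eq_norm_sq]
    field_simp
  rw [hξn] at h1 h2
  rw [abs_le] at h1 h2 h3 h4
  have h6 : δ / 2 * ‖G' - G‖ ≤ 2 * (ε * (δ / 2)) + 2 * η := by linarith
  have h7 : 4 * η / δ * δ = 4 * η := by field_simp
  nlinarith

/-- Growth of `r` along the direction of a nearly constant gradient. -/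
lemma growth (H : Sol κ T L c Mv Mr r v) {t : ℝ} (ht : t ∈ Icc (0:ℝ) T) {A : Set (𝔼 d)}
    (hA : IsOpen A) {e : 𝔼 d} {a ε : ℝ} (he : ‖e‖ = 1) (hε : ε ≤ a)
    (hG : ∀ z ∈ A, 0 < r t z → ‖gradient (r t) z - a • e‖ ≤ ε) {x : 𝔼 d} {S : ℝ}
    (hseg : ∀ s ∈ Icc 0 S, x + s • e ∈ A) (hx : 0 < r t x) {s : ℝ} (hs : s ∈ Icc 0 S) :
    0 < r t (x + s • e) ∧ |r t (x + s • e) - r t x - a * s| ≤ ε * s := by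
  have seg : ∀ s ∈ Icc 0 S, (∀ s' ∈ Icc 0 s, 0 < r t (x + s' • e)) →
      |r t (x + s • e) - r t x - a * s| ≤ ε * s := by
    intro s hs hpos
    have h := H.abs_sub_sub_inner_le ht hA hG (y := x) (ξ := s • e) (fun z hz => by
      rw [segment_eq_image'] at hz
      obtain ⟨θ, hθ, rfl⟩ := hz
      have e1 : x + θ • (x + s • e - x) = x + (θ * s) • e := by
        rw [add_sub_cancel_left, smul_smul]
      have h1 : θ * s ≤ s := mul_le_of_le_one_left hs.1 hθ.2
      have h0 : 0 ≤ θ * s := mul_nonneg hθ.1 hs.1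
      simp only [e1]
      exact ⟨hseg _ ⟨h0, h1.trans hs.2⟩, hpos _ ⟨h0, h1⟩⟩)
    rw [real_inner_smul_left, real_inner_smul_right, real_inner_self_eq_norm_sq, he, norm_smul,
      he, Real.norm_of_nonneg hs.1] at h
    simpa using h
  have pos : ∀ s ∈ Icc 0 S, 0 < r t (x + s • e) := by
    by_contra hcon
    push Not at hcon
    have hcont : Continuous fun s : ℝ => r t (x + s • e) :=
      (H.continuous_slice t).comp (by fun_prop)
    have hcompact : IsCompact (Icc 0 S ∩ (fun s : ℝ => r t (x + s • e)) ⁻¹' Iic 0) :=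
      isCompact_Icc.inter_right (isClosed_Iic.preimage hcont)
    obtain ⟨s1, hs1, hmin⟩ := hcompact.exists_isLeast (by
      obtain ⟨s, hs, h⟩ := hcon
      exact ⟨s, hs, h⟩)
    have hlow : ∀ s ∈ Ico 0 s1, r t x ≤ r t (x + s • e) := by
      intro s hs
      have h1 := seg s ⟨hs.1, hs.2.le.trans hs1.1.2⟩ (fun s' hs' => by
        by_contra h
        have := hmin ⟨⟨hs'.1, hs'.2.trans (hs.2.le.trans hs1.1.2)⟩, not_lt.1 h⟩
        linarith [hs'.2, hs.2])
      have h2 := (abs_le.1 h1).1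
      have h3 : ε * s ≤ a * s := mul_le_mul_of_nonneg_right hε hs.1
      linarith
    have hs1pos : 0 < s1 := by
      rcases hs1.1.1.eq_or_lt with h | h
      · have h' : r t (x + s1 • e) ≤ 0 := hs1.2
        rw [← h] at h'
        simp only [zero_smul, add_zero] at h'
        linarith
      · exact h
    have hlim : r t x ≤ r t (x + s1 • e) := by
      have ht1 : Tendsto (fun s : ℝ => r t (x + s • e)) (𝓝[<] s1) (𝓝 (r t (x + s1 • e))) :=
        (hcont.tendsto s1).mono_left nhdsWithin_le_nhds
      refine ge_of_tendsto ht1 ?_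
      filter_upwards [Ioo_mem_nhdsLT hs1pos] with s hs
      exact hlow s ⟨hs.1.le, hs.2⟩
    have h' : r t (x + s1 • e) ≤ 0 := hs1.2
    linarith
  exact ⟨pos s hs, seg s hs fun s' hs' => pos s' ⟨hs'.1, hs'.2.trans hs.2⟩⟩

end Sol

namespace Box

variable {N M t₀ t₁ ρ : ℝ} {x₀ : 𝔼 d}

/-- `rp r` changes slowly along directions close to the material derivative. -/
lemma transport (Bx : Box T N M r v t₀ t₁ x₀ ρ) (H : Sol κ T L c Mv Mr r v) {w₀ : ℝ × 𝔼 d}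
    (hw : w₀ ∈ cyl t₀ t₁ x₀ ρ) (hw0 : t₀ < w₀.1) (V : 𝔼 d) {ε : ℝ} (hε : 0 < ε) :
    ∃ δ > 0, ∀ w ∈ ball w₀ δ, ∀ h : ℝ, w + h • ((1:ℝ), V) ∈ ball w₀ δ →
      |rp r (w + h • ((1:ℝ), V)) - rp r w| ≤
        (κ * (d * Mv) * rp r w₀ + L * ‖v w₀.1 w₀.2 - V‖ + ε) * |h| := by
  have hcont : Continuous fun q : ℝ × 𝔼 d => κ * (d * Mv) * rp r q + L * ‖v q.1 q.2 - V‖ := by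
    have := H.continuous_rp
    have := H.vcont
    fun_prop
  have hev : ∀ᶠ q in 𝓝 w₀, q ∈ cyl t₀ t₁ x₀ ρ ∧ t₀ < q.1 ∧
      κ * (d * Mv) * rp r q + L * ‖v q.1 q.2 - V‖ <
        κ * (d * Mv) * rp r w₀ + L * ‖v w₀.1 w₀.2 - V‖ + ε := by
    filter_upwards [cyl_mem_nhds hw hw0, (continuous_fst.tendsto w₀).eventually (lt_mem_nhds hw0),
      (hcont.tendsto w₀).eventually (gt_mem_nhds (lt_add_of_pos_right _ hε))] with q h1 h2 h3
    exact ⟨h1, h2, h3⟩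
  obtain ⟨δ, hδ, hball⟩ := Metric.eventually_nhds_iff_ball.1 hev
  refine ⟨δ, hδ, fun w hwδ h hwh => ?_⟩
  have hlip := (((Bx.ptLip_rp H).mono fun q hq => (hball q hq).1).mono_const
    (Real.le_coe_toNNReal _)).lipschitzOnWith (convex_ball w₀ δ)
  have := segment_estimate_real (μ := volume) isOpen_ball (convex_ball w₀ δ) hlip
    (h • ((1:ℝ), V)) 0 ((κ * (d * Mv) * rp r w₀ + L * ‖v w₀.1 w₀.2 - V‖ + ε) * |h|) ?_ hwδ hwh
  · simpa using this
  filter_upwards [(Bx.ptLip_rp H).ae_differentiableAt] with q hd hq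
  obtain ⟨hqc, hqt, hqb⟩ := hball q hq
  rw [sub_zero, map_smul, smul_eq_mul, abs_mul, mul_comm]
  refine mul_le_mul_of_nonneg_right (le_trans ?_ hqb.le) (abs_nonneg _)
  have hκ := H.κ_pos
  have hL := H.L_nonneg
  have hMv := H.Mv_nonneg
  by_cases hr : 0 < r q.1 q.2
  · have hT := Bx.mem_time hqc
    rw [(H.fderiv_rp_apply (Bx.t₀_nonneg.trans_lt hqt) (hqc.1.2.trans_le Bx.t₁_le) hr
      (hd hqc hqt) V).1, rp_of_pos hr]
    have h1 : |@inner ℝ _ _ (gradient (r q.1) q.2) (V - v q.1 q.2)| ≤ L * ‖v q.1 q.2 - V‖ := by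
      refine (abs_real_inner_le_norm _ _).trans ?_
      rw [norm_sub_rev V]
      exact mul_le_mul_of_nonneg_right (H.norm_gradient_le hT _) (norm_nonneg _)
    have h2 : |κ * r q.1 q.2 * vdiv (v q.1) q.2| ≤ κ * (d * Mv) * r q.1 q.2 := by
      rw [abs_mul, abs_mul, abs_of_pos hκ, abs_of_pos hr]
      have := mul_le_mul_of_nonneg_left (H.abs_vdiv_le hT hr) (mul_nonneg hκ.le hr.le)
      linarith
    have := abs_sub (@inner ℝ _ _ (gradient (r q.1) q.2) (V - v q.1 q.2))
      (κ * r q.1 q.2 * vdiv (v q.1) q.2)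
    linarith
  · rw [Sol.fderiv_rp_eq_zero hr]
    have := rp_nonneg r q
    simp only [_root_.zero_apply, abs_zero]
    positivity

/-- The velocity has material derivative close to `-∇r`. -/
lemma velocity_transport (Bx : Box T N M r v t₀ t₁ x₀ ρ) (H : Sol κ T L c Mv Mr r v)
    {w₀ : ℝ × 𝔼 d} (hw : w₀ ∈ cyl t₀ t₁ x₀ ρ) (hw0 : t₀ < w₀.1) (hr : 0 < r w₀.1 w₀.2)
    {G : 𝔼 d} {ω : ℝ} (hω : ∀ᶠ q in 𝓝 w₀, ‖gradient (r q.1) q.2 - G‖ ≤ ω) {ε : ℝ} (hε : 0 < ε) :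
    ∃ δ > 0, ∀ w ∈ ball w₀ δ, ∀ h : ℝ, w + h • ((1:ℝ), v w₀.1 w₀.2) ∈ ball w₀ δ →
      ‖v (w + h • ((1:ℝ), v w₀.1 w₀.2)).1 (w + h • ((1:ℝ), v w₀.1 w₀.2)).2 - v w.1 w.2 + h • G‖ ≤
        (ω + ε) * |h| := by
  have hcont : Continuous fun q : ℝ × 𝔼 d => Mv * ‖v w₀.1 w₀.2 - v q.1 q.2‖ := by
    have := H.vcont
    fun_prop
  have hev : ∀ᶠ q in 𝓝 w₀, q ∈ cyl t₀ t₁ x₀ ρ ∧ t₀ < q.1 ∧ 0 < r q.1 q.2 ∧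
      ‖gradient (r q.1) q.2 - G‖ ≤ ω ∧ Mv * ‖v w₀.1 w₀.2 - v q.1 q.2‖ < ε := by
    filter_upwards [cyl_mem_nhds hw hw0, (continuous_fst.tendsto w₀).eventually (lt_mem_nhds hw0),
      H.isOpen_pos.mem_nhds hr, hω, (hcont.tendsto w₀).eventually (gt_mem_nhds (by simpa))]
      with q h1 h2 h3 h4 h5
    exact ⟨h1, h2, h3, h4, h5⟩
  obtain ⟨δ, hδ, hball⟩ := Metric.eventually_nhds_iff_ball.1 hev
  refine ⟨δ, hδ, fun w hwδ h hwh => ?_⟩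
  have hlip := (((Bx.ptLip_v H).mono (t := ball w₀ δ)
    fun q hq => ⟨(hball q hq).1, (hball q hq).2.2.1⟩).mono_const
    (Real.le_coe_toNNReal _)).lipschitzOnWith (convex_ball w₀ δ)
  have := segment_estimate (μ := volume) isOpen_ball (convex_ball w₀ δ) hlip
    (h • ((1:ℝ), v w₀.1 w₀.2)) (-(h • G)) ((ω + ε) * |h|) ?_ hwδ hwh
  · simpa only [sub_neg_eq_add] using this
  filter_upwards [Bx.ae_differentiableAt_v H] with q hd hq
  obtain ⟨hqc, hqt, hqr, hqω, hqv⟩ := hball q hq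
  rw [map_smul, ← smul_neg, ← smul_sub, norm_smul, Real.norm_eq_abs, mul_comm]
  refine mul_le_mul_of_nonneg_right ?_ (abs_nonneg _)
  rw [H.fderiv_v_apply (Bx.t₀_nonneg.trans_lt hqt) (hqc.1.2.trans_le Bx.t₁_le) hqr
    (hd hqc hqt hqr)]
  have h1 := (fderiv ℝ (v q.1) q.2).le_of_opNorm_le (H.gradv q.1 (Bx.mem_time hqc) q.2 hqr)
    (v w₀.1 w₀.2 - v q.1 q.2)
  have e1 : fderiv ℝ (v q.1) q.2 (v w₀.1 w₀.2 - v q.1 q.2) - gradient (r q.1) q.2 - -G =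
      fderiv ℝ (v q.1) q.2 (v w₀.1 w₀.2 - v q.1 q.2) - (gradient (r q.1) q.2 - G) := by abel
  rw [e1]
  refine (norm_sub_le _ _).trans ?_
  linarith

end Box

end GradientEstimates

section BoundaryChart

variable {d : ℕ}

/-- Near a free boundary point: the gradient of `r` is within `ε` of the fixed vector `a • e`
at all times, and every point of the small cylinder is carried into the gas by `s₀ • e`. -/
structure Chart (T N M ε a : ℝ) (e : 𝔼 d) (r : ℝ → (𝔼 d) → ℝ) (v : ℝ → (𝔼 d) → 𝔼 d)
    (t₀ t₁ : ℝ) (x₀ : 𝔼 d) (P ρ s₀ : ℝ) : Prop where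
  bx : Box T N M r v t₀ t₁ x₀ P
  t₀_lt : t₀ < t₁
  ρ_pos : 0 < ρ
  s₀_pos : 0 < s₀
  P_ge : ρ + 4 * s₀ ≤ P
  ε_pos : 0 < ε
  a_ge : 15 * ε ≤ a
  norm_e : ‖e‖ = 1
  osc : ∀ t ∈ Ico t₀ t₁, ∀ z ∈ ball x₀ P, 0 < r t z → ‖gradient (r t) z - a • e‖ ≤ ε
  reach : ∀ t ∈ Ico t₀ t₁, ∀ x ∈ ball x₀ ρ, 0 < r t (x + s₀ • e)

variable {κ T L c Mv Mr : ℝ} {r : ℝ → (𝔼 d) → ℝ} {v : ℝ → (𝔼 d) → 𝔼 d}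

/-- The nondegeneracy of `r` bounds its gradient from below near the free boundary. -/
lemma Sol.le_norm_gradient (H : Sol κ T L c Mv Mr r v) {t : ℝ} (ht : t ∈ Icc (0:ℝ) T) {x₀ y : 𝔼 d}
    {P ε : ℝ} (hx₀ : ¬ 0 < r t x₀) (hy : 0 < r t y) (hyP : dist y x₀ < P / 2)
    (hosc : ∀ z ∈ ball x₀ P, 0 < r t z → ‖gradient (r t) z - gradient (r t) y‖ ≤ ε) :
    c ≤ ‖gradient (r t) y‖ + ε := by
  have hP : 0 < P := by linarith [dist_nonneg (x := y) (y := x₀)]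
  set Z : Set (𝔼 d) := {z | ¬ 0 < r t z} with hZ
  have hZc : IsClosed Z := (H.isOpen_slice t).isClosed_compl
  have hZn : Z.Nonempty := ⟨x₀, hx₀⟩
  obtain ⟨b, hbZ, hbd⟩ := hZc.exists_infDist_eq_dist hZn y
  have hb : r t b ≤ 0 := not_lt.1 hbZ
  set D := dist y b with hD
  have hDpos : 0 < D := dist_pos.2 fun h => hbZ (h ▸ hy)
  have hDle : D ≤ dist y x₀ := hbd ▸ infDist_le_dist_of_mem hx₀
  have hposD : ∀ z ∈ ball y D, 0 < r t z := by
    intro z hz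
    by_contra h
    have h1 := infDist_le_dist_of_mem (x := y) (show z ∈ Z from h)
    rw [hbd, dist_comm] at h1
    exact absurd hz (not_lt.2 h1)
  have hPD : ball y D ⊆ ball x₀ P := by
    apply ball_subset_ball'
    linarith
  have hDb : ‖b - y‖ = D := by rw [hD, dist_comm, dist_eq_norm]
  have hineq : ∀ θ ∈ Ico (0:ℝ) 1, 0 ≤ r t (y + θ • (b - y)) - r t y
      - θ * @inner ℝ _ _ (gradient (r t) y) (b - y) + ε * (θ * D) := by
    intro θ hθ
    have h := H.abs_sub_sub_inner_le ht (isOpen_ball (x := x₀) (ε := P)) hosc (y := y)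
      (ξ := θ • (b - y)) (fun z hz => by
        have hz' : z ∈ ball y D := (convex_ball y D).segment_subset (mem_ball_self hDpos) (by
          rw [mem_ball, dist_eq_norm, add_sub_cancel_left, norm_smul, hDb,
            Real.norm_of_nonneg hθ.1]
          nlinarith [hθ.2]) hz
        exact ⟨hPD hz', hposD z hz'⟩)
    rw [norm_smul, hDb, Real.norm_of_nonneg hθ.1, real_inner_smul_right] at h
    linarith [(abs_le.1 h).1]
  have hcont : Continuous fun θ : ℝ => r t (y + θ • (b - y)) - r t y
      - θ * @inner ℝ _ _ (gradient (r t) y) (b - y) + ε * (θ * D) := by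
    have h1 : Continuous fun θ : ℝ => r t (y + θ • (b - y)) :=
      (H.continuous_slice t).comp (by fun_prop)
    exact ((h1.sub continuous_const).sub (continuous_id.mul continuous_const)).add
      (continuous_const.mul (continuous_id.mul continuous_const))
  have hlim : 0 ≤ r t (y + (1:ℝ) • (b - y)) - r t y
      - 1 * @inner ℝ _ _ (gradient (r t) y) (b - y) + ε * (1 * D) := by
    refine ge_of_tendsto ((hcont.tendsto 1).mono_left (nhdsWithin_le_nhds (s := Iio 1))) ?_
    filter_upwards [Ioo_mem_nhdsLT (zero_lt_one' ℝ)] with θ hθ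
    exact hineq θ ⟨hθ.1.le, hθ.2⟩
  rw [one_smul, add_sub_cancel] at hlim
  have h1 := H.nondeg t ht y hy
  rw [hbd] at h1
  have h2 := (abs_le.1 (abs_real_inner_le_norm (gradient (r t) y) (b - y))).1
  rw [hDb] at h2
  have h3 : c * D ≤ (‖gradient (r t) y‖ + ε) * D := by linarith
  exact le_of_mul_le_mul_right h3 hDpos

lemma Sol.exists_chart (H : Sol κ T L c Mv Mr r v) {N M t₀ t₁ P₀ : ℝ} {x₀ : 𝔼 d}
    (Bx : Box T N M r v t₀ t₁ x₀ P₀) (h01 : t₀ < t₁) (hP₀ : 0 < P₀) (hx : r t₀ x₀ = 0)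
    (hcl : x₀ ∈ closure {x | 0 < r t₀ x}) :
    ∃ a e t₂ P ρ s₀, t₂ ≤ t₁ ∧ Chart T N M (c / 16) a e r v t₀ t₂ x₀ P ρ s₀ := by
  have hc := H.c_pos
  have hL := H.L_nonneg
  have hMr := H.Mr_nonneg
  set ε := c / 16 with hε
  have hε0 : 0 < ε := by positivity
  set k := ε / (16 * (Mr + 1)) with hk
  have hk0 : 0 < k := by positivity
  have hMk : Mr * (3 * k) ≤ ε / 4 := by
    rw [hk]
    have : Mr * (3 * (ε / (16 * (Mr + 1)))) = 3 * ε / 16 * (Mr / (Mr + 1)) := by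
      field_simp
    rw [this]
    have h1 : Mr / (Mr + 1) ≤ 1 := by rw [div_le_one (by positivity)]; linarith
    nlinarith
  -- a cylinder on which `r` is small
  have hsmall : ∀ᶠ q in 𝓝 (t₀, x₀), r q.1 q.2 < k ^ 2 := by
    refine (H.rcont.tendsto (t₀, x₀)).eventually (gt_mem_nhds ?_)
    simp only [hx]
    positivity
  obtain ⟨δ, hδ, hδr⟩ := Metric.eventually_nhds_iff_ball.1 hsmall
  set P := min P₀ (min δ (k ^ 2 / 2)) with hP
  have hP0 : 0 < P := by positivity
  have hPP₀ : P ≤ P₀ := min_le_left _ _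
  have hPδ : P ≤ δ := (min_le_right _ _).trans (min_le_left _ _)
  have hPk : P ≤ k ^ 2 / 2 := (min_le_right _ _).trans (min_le_right _ _)
  have hT : ∀ t ∈ Ico t₀ t₁, t ∈ Icc (0:ℝ) T := fun t ht =>
    ⟨Bx.t₀_nonneg.trans ht.1, ht.2.le.trans Bx.t₁_le⟩
  have hosc : ∀ t ∈ Ico t₀ t₁, t < t₀ + δ → ∀ z ∈ ball x₀ P, 0 < r t z → ∀ z' ∈ ball x₀ P,
      0 < r t z' → ‖gradient (r t) z - gradient (r t) z'‖ ≤ ε / 4 := by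
    intro t ht htδ z hz hrz z' hz' hrz'
    have htb : t ∈ ball t₀ δ := by rw [Real.ball_eq_Ioo]; exact ⟨by linarith [ht.1], htδ⟩
    have s1 : ∀ w ∈ ball x₀ P, √(r t w) ≤ k := fun w hw => by
      rw [← Real.sqrt_sq hk0.le]
      exact Real.sqrt_le_sqrt (hδr (t, w) (mk_mem_ball htb (ball_subset_ball hPδ hw))).le
    have s2 : √‖z - z'‖ ≤ k := by
      rw [← Real.sqrt_sq hk0.le]
      apply Real.sqrt_le_sqrt
      rw [← dist_eq_norm]
      have := dist_triangle_right z z' x₀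
      rw [mem_ball] at hz hz'
      linarith
    refine (H.gradr t (hT t ht) z hrz z' hrz').trans (le_trans ?_ hMk)
    have := s1 z hz
    have := s1 z' hz'
    gcongr
    linarith
  -- a reference point in the gas
  obtain ⟨y, hy, hyx⟩ := Metric.mem_closure_iff.1 hcl (P / 2) (by positivity)
  rw [dist_comm] at hyx
  have hyr : 0 < r t₀ y := hy
  have hyP : y ∈ ball x₀ P := by rw [mem_ball]; linarith
  have h00 : t₀ ∈ Ico t₀ t₁ := ⟨le_rfl, h01⟩
  set G := gradient (r t₀) y with hG
  have hGc : c ≤ ‖G‖ + ε / 4 := H.le_norm_gradient (hT t₀ h00) (by rw [hx]; exact lt_irrefl 0)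
    hyr hyx fun z hz hr => hosc t₀ h00 (by linarith) z hz hr y hyP hyr
  have ha : 15 * ε ≤ ‖G‖ := by linarith
  have ha0 : 0 < ‖G‖ := by linarith
  set e : 𝔼 d := ‖G‖⁻¹ • G with he
  have hen : ‖e‖ = 1 := by rw [he, norm_smul, norm_inv, norm_norm, inv_mul_cancel₀ ha0.ne']
  have hae : ‖G‖ • e = G := by rw [he, smul_smul, mul_inv_cancel₀ ha0.ne', one_smul]
  have hev : ∀ᶠ z in 𝓝 y, r t₀ y / 2 < r t₀ z ∧ z ∈ ball x₀ P :=
    (((H.continuous_slice t₀).tendsto y).eventually (lt_mem_nhds (half_lt_self hyr))).and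
      (isOpen_ball.mem_nhds hyP)
  obtain ⟨δ₁, hδ₁, hball₁⟩ := Metric.eventually_nhds_iff_ball.1 hev
  set rt := rateR d κ L Mv N M with hrt
  have hrt0 : 0 ≤ rt := H.rateR_nonneg Bx.N_pos.le Bx.M_pos.le
  set θ := min (r t₀ y / (4 * (rt + 1))) (δ₁ * ε / (16 * (rt + 1))) with hθ
  have hθ0 : 0 < θ := by positivity
  have hθ1 : rt * θ ≤ r t₀ y / 4 := by
    have h1 : θ ≤ r t₀ y / (4 * (rt + 1)) := min_le_left _ _
    rw [le_div_iff₀ (by positivity)] at h1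
    nlinarith
  have hθ2 : 4 * (rt * θ) / δ₁ ≤ ε / 4 := by
    have h1 : θ ≤ δ₁ * ε / (16 * (rt + 1)) := min_le_right _ _
    rw [le_div_iff₀ (by positivity)] at h1
    rw [div_le_iff₀ hδ₁]
    nlinarith
  have hclose : ∀ t ∈ Ico t₀ t₁, t < t₀ + θ → ∀ z ∈ ball y δ₁,
      0 < r t z ∧ |r t z - r t₀ z| ≤ rt * θ := by
    intro t ht htθ z hz
    obtain ⟨hz1, hz2⟩ := hball₁ z hz
    have hrz : 0 < r t₀ z := by linarith
    have h1 := Bx.abs_rp_sub_le H (p := (t₀, z)) (q := (t, z)) ⟨h00, ball_subset_ball hPP₀ hz2⟩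
      ⟨ht, ball_subset_ball hPP₀ hz2⟩
    simp only [sub_self, norm_zero, mul_zero, zero_add] at h1
    rw [rp_of_pos (p := (t₀, z)) hrz, abs_of_nonneg (by linarith [ht.1] : 0 ≤ t - t₀)] at h1
    have h2 : rt * (t - t₀) ≤ rt * θ := mul_le_mul_of_nonneg_left (by linarith) hrt0
    have h3 : 0 < rp r (t, z) := by
      have := (abs_le.1 h1).1
      simp only at this
      linarith
    have h4 := rp_pos_iff.1 h3
    rw [rp_of_pos h4] at h1
    exact ⟨h4, h1.trans h2⟩
  have hoscG : ∀ t ∈ Ico t₀ t₁, t < t₀ + δ → t < t₀ + θ → ∀ z ∈ ball x₀ P, 0 < r t z →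
      ‖gradient (r t) z - G‖ ≤ ε := by
    intro t ht htδ htθ z hz hrz
    have hyt := (hclose t ht htθ y (mem_ball_self hδ₁)).1
    have h1 := hosc t ht htδ z hz hrz y hyP hyt
    have h2 := H.norm_gradient_compare (hT t₀ h00) (hT t ht) (y := y) (G := G)
      (G' := gradient (r t) y) (ε := ε / 4) (η := rt * θ) hδ₁
      (fun z hz => by linarith [(hball₁ z hz).1]) (fun z hz => (hclose t ht htθ z hz).1)
      (fun z hz => hosc t₀ h00 (by linarith) z (hball₁ z hz).2 (by linarith [(hball₁ z hz).1])
        y hyP hyr)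
      (fun z hz => hosc t ht htδ z (hball₁ z hz).2 (hclose t ht htθ z hz).1 y hyP hyt)
      (fun z hz => (hclose t ht htθ z hz).2)
    have := norm_sub_le_norm_sub_add_norm_sub (gradient (r t) z) (gradient (r t) y) G
    linarith
  -- pushing the boundary point into the gas
  set s₀ := P / 8 with hs₀
  have hs₀0 : 0 < s₀ := by positivity
  have hreach0 : 0 < r t₀ (x₀ + s₀ • e) := by
    set μ := min (P / 2) ((‖G‖ - ε) * s₀ / (2 * (L + 1))) with hμ
    have hGε : 0 < ‖G‖ - ε := by linarith
    have hμ0 : 0 < μ := by positivity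
    obtain ⟨x, hxr, hxd⟩ := Metric.mem_closure_iff.1 hcl μ hμ0
    rw [dist_comm] at hxd
    have h1 := H.growth (hT t₀ h00) (isOpen_ball (x := x₀) (ε := P)) hen (by linarith : ε ≤ ‖G‖)
      (fun z hz hr => by
        rw [hae]; exact hoscG t₀ h00 (by linarith) (by linarith) z hz hr)
      (x := x) (S := s₀) (fun s hs => by
        rw [mem_ball, dist_eq_norm, show x + s • e - x₀ = (x - x₀) + s • e by abel]
        refine (norm_add_le _ _).trans_lt ?_
        rw [norm_smul, hen, Real.norm_of_nonneg hs.1, ← dist_eq_norm]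
        have := min_le_left (P / 2) ((‖G‖ - ε) * s₀ / (2 * (L + 1)))
        linarith [hs.2]) hxr (s := s₀) ⟨hs₀0.le, le_rfl⟩
    have h2 := (abs_le.1 h1.2).1
    have h3 := (abs_le.1 (H.lip t₀ (hT t₀ h00) (x + s₀ • e) (x₀ + s₀ • e))).2
    rw [add_sub_add_right_eq_sub, ← dist_eq_norm] at h3
    have h4 : μ ≤ (‖G‖ - ε) * s₀ / (2 * (L + 1)) := min_le_right _ _
    rw [le_div_iff₀ (by positivity)] at h4
    have h5 : L * dist x x₀ ≤ L * μ := mul_le_mul_of_nonneg_left hxd.le hL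
    have h6 : 0 < r t₀ x := hxr
    have h7 : 0 < (‖G‖ - ε) * s₀ := by positivity
    nlinarith
  have hreach : ∀ᶠ q in 𝓝 (t₀, x₀), 0 < r q.1 (q.2 + s₀ • e) := by
    have hcont : Continuous fun q : ℝ × 𝔼 d => r q.1 (q.2 + s₀ • e) :=
      H.rcont.comp (f := fun q : ℝ × 𝔼 d => (q.1, q.2 + s₀ • e)) (by fun_prop)
    exact (hcont.tendsto (t₀, x₀)).eventually (lt_mem_nhds hreach0)
  obtain ⟨δ₂, hδ₂, hball₂⟩ := Metric.eventually_nhds_iff_ball.1 hreach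
  set t₂ := min t₁ (t₀ + min δ (min θ δ₂)) with ht₂
  have ht₂1 : t₂ ≤ t₁ := min_le_left _ _
  have ht₂2 : t₂ ≤ t₀ + min δ (min θ δ₂) := min_le_right _ _
  have hm1 : min δ (min θ δ₂) ≤ δ := min_le_left _ _
  have hm2 : min δ (min θ δ₂) ≤ θ := (min_le_right _ _).trans (min_le_left _ _)
  have hm3 : min δ (min θ δ₂) ≤ δ₂ := (min_le_right _ _).trans (min_le_right _ _)
  have hm0 : 0 < min δ (min θ δ₂) := by positivity
  have hsub : ∀ t ∈ Ico t₀ t₂, t ∈ Ico t₀ t₁ := fun t ht => ⟨ht.1, ht.2.trans_le ht₂1⟩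
  refine ⟨‖G‖, e, t₂, P, min δ₂ (P / 2), s₀, ht₂1,
    Bx.mono ht₂1 (ball_subset_ball hPP₀), lt_min h01 (by linarith), by positivity, hs₀0, ?_, hε0, ha,
    hen, fun t ht z hz hr => ?_, fun t ht x hx => ?_⟩
  · have := min_le_right δ₂ (P / 2)
    rw [hs₀]
    linarith
  · rw [hae]
    exact hoscG t (hsub t ht) (by linarith [ht.2]) (by linarith [ht.2]) z hz hr
  · refine hball₂ (t, x) (mk_mem_ball ?_ (ball_subset_ball (min_le_left _ _) hx))
    rw [Real.ball_eq_Ioo]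
    exact ⟨by linarith [ht.1], by linarith [ht.2]⟩

end BoundaryChart

section Extension

variable {d : ℕ}

/-- The distance one has to travel along `e` to reach the gas. -/
noncomputable def hit (r : ℝ → (𝔼 d) → ℝ) (e : 𝔼 d) (s₀ : ℝ) (p : ℝ × 𝔼 d) : ℝ :=
  sInf {s | s ∈ Icc 0 s₀ ∧ 0 < r p.1 (p.2 + s • e)}

/-- The space-time point `p` translated by `s • e`. -/
def push (e : 𝔼 d) (s : ℝ) (p : ℝ × 𝔼 d) : ℝ × 𝔼 d := (p.1, p.2 + s • e)

/-- The extension of `r` to the vacuum. -/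
noncomputable def extR (r : ℝ → (𝔼 d) → ℝ) (e : 𝔼 d) (s₀ : ℝ) (p : ℝ × 𝔼 d) : ℝ :=
  2 * rp r (push e (2 * hit r e s₀ p) p) - rp r (push e (4 * hit r e s₀ p) p)

/-- The extension of `v` to the vacuum. -/
noncomputable def extV (r : ℝ → (𝔼 d) → ℝ) (v : ℝ → (𝔼 d) → 𝔼 d) (e : 𝔼 d) (s₀ : ℝ)
    (p : ℝ × 𝔼 d) : 𝔼 d := v p.1 (p.2 + (2 * hit r e s₀ p) • e)

namespace Chart

variable {κ T L c Mv Mr N M ε a t₀ t₁ P ρ s₀ : ℝ} {r : ℝ → (𝔼 d) → ℝ}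
  {v : ℝ → (𝔼 d) → 𝔼 d} {e x₀ : 𝔼 d} {p q : ℝ × 𝔼 d}

lemma push_mem (Ch : Chart T N M ε a e r v t₀ t₁ x₀ P ρ s₀) (hp : p ∈ cyl t₀ t₁ x₀ ρ) {s : ℝ}
    (hs : s ∈ Icc 0 (4 * s₀)) : push e s p ∈ cyl t₀ t₁ x₀ P := by
  refine ⟨hp.1, ?_⟩
  have h1 : dist p.2 x₀ < ρ := hp.2
  rw [mem_ball, dist_eq_norm, show (push e s p).2 - x₀ = (p.2 - x₀) + s • e by
    simp only [push]; abel]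
  refine (norm_add_le _ _).trans_lt ?_
  rw [norm_smul, Ch.norm_e, Real.norm_of_nonneg hs.1, ← dist_eq_norm]
  linarith [hs.2, Ch.P_ge]

lemma slope_pos (Ch : Chart T N M ε a e r v t₀ t₁ x₀ P ρ s₀) : 14 * ε ≤ a - ε ∧ 0 < a - ε := by
  have := Ch.a_ge
  have := Ch.ε_pos
  constructor <;> linarith

lemma hit_nonneg (r : ℝ → (𝔼 d) → ℝ) (e : 𝔼 d) (s₀ : ℝ) (p : ℝ × 𝔼 d) : 0 ≤ hit r e s₀ p :=
  Real.sInf_nonneg fun _ hs => hs.1.1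

lemma hit_le {s : ℝ} (hs : s ∈ Icc 0 s₀) (h : 0 < r p.1 (p.2 + s • e)) : hit r e s₀ p ≤ s :=
  csInf_le ⟨0, fun _ hs => hs.1.1⟩ ⟨hs, h⟩

lemma hit_le_max (Ch : Chart T N M ε a e r v t₀ t₁ x₀ P ρ s₀) (hp : p ∈ cyl t₀ t₁ x₀ ρ) :
    hit r e s₀ p ≤ s₀ := hit_le ⟨Ch.s₀_pos.le, le_rfl⟩ (Ch.reach p.1 hp.1 p.2 hp.2)

lemma hit_eq_zero (Ch : Chart T N M ε a e r v t₀ t₁ x₀ P ρ s₀) (h : 0 < r p.1 p.2) :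
    hit r e s₀ p = 0 :=
  le_antisymm (hit_le ⟨le_rfl, Ch.s₀_pos.le⟩ (by simpa using h)) (hit_nonneg _ _ _ _)

lemma growth (Ch : Chart T N M ε a e r v t₀ t₁ x₀ P ρ s₀) (H : Sol κ T L c Mv Mr r v)
    (hp : p ∈ cyl t₀ t₁ x₀ ρ) {s s' : ℝ} (hs : 0 ≤ s) (hss : s ≤ s') (hs' : s' ≤ 4 * s₀)
    (hpos : 0 < r p.1 (p.2 + s • e)) :
    0 < r p.1 (p.2 + s' • e) ∧
      |r p.1 (p.2 + s' • e) - r p.1 (p.2 + s • e) - a * (s' - s)| ≤ ε * (s' - s) := by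
  have := Ch.slope_pos
  have h := H.growth (Ch.bx.mem_time (Ch.push_mem hp ⟨hs, hss.trans hs'⟩)) isOpen_ball Ch.norm_e
    (by linarith : ε ≤ a) (fun z hz hr => Ch.osc p.1 hp.1 z hz hr) (x := p.2 + s • e)
    (S := s' - s) (fun θ hθ => by
      have := (Ch.push_mem hp (s := s + θ) ⟨by linarith [hθ.1], by linarith [hθ.2]⟩).2
      rwa [push, add_smul, ← add_assoc] at this) hpos (s := s' - s) ⟨by linarith, le_rfl⟩
  rwa [add_assoc, ← add_smul, add_sub_cancel] at h

lemma pos_of_hit_lt (Ch : Chart T N M ε a e r v t₀ t₁ x₀ P ρ s₀) (H : Sol κ T L c Mv Mr r v)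
    (hp : p ∈ cyl t₀ t₁ x₀ ρ) {s : ℝ} (hs : hit r e s₀ p < s) (hs' : s ≤ 4 * s₀) :
    0 < r p.1 (p.2 + s • e) := by
  have hne : {s | s ∈ Icc 0 s₀ ∧ 0 < r p.1 (p.2 + s • e)}.Nonempty :=
    ⟨s₀, ⟨Ch.s₀_pos.le, le_rfl⟩, Ch.reach p.1 hp.1 p.2 hp.2⟩
  obtain ⟨s1, ⟨hs1, hr⟩, hlt⟩ := exists_lt_of_csInf_lt hne hs
  exact (Ch.growth H hp hs1.1 hlt.le hs' hr).1

lemma continuous_rp_push (H : Sol κ T L c Mv Mr r v) (e : 𝔼 d) (p : ℝ × 𝔼 d) :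
    Continuous fun s => rp r (push e s p) := by
  refine H.continuous_rp.comp ?_
  unfold push
  fun_prop

/-- Beyond the hitting point, `rp r` grows along `e` at rate between `a - ε` and `a + ε`. -/
lemma slope (Ch : Chart T N M ε a e r v t₀ t₁ x₀ P ρ s₀) (H : Sol κ T L c Mv Mr r v)
    (hp : p ∈ cyl t₀ t₁ x₀ ρ) {s s' : ℝ} (hs : hit r e s₀ p ≤ s) (hss : s ≤ s')
    (hs' : s' ≤ 4 * s₀) :
    |rp r (push e s' p) - rp r (push e s p) - a * (s' - s)| ≤ ε * (s' - s) := by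
  have main : ∀ s ∈ Ioc (hit r e s₀ p) s',
      |rp r (push e s' p) - rp r (push e s p) - a * (s' - s)| ≤ ε * (s' - s) := by
    intro s hs
    have h0 := (hit_nonneg r e s₀ p).trans hs.1.le
    have h1 := Ch.pos_of_hit_lt H hp hs.1 (hs.2.trans hs')
    have h2 := Ch.growth H hp h0 hs.2 hs' h1
    rw [rp_of_pos (p := push e s p) h1, rp_of_pos (p := push e s' p) h2.1]
    exact h2.2
  rcases hs.lt_or_eq with h | h
  · exact main s ⟨h, hss⟩
  rcases hss.eq_or_lt with h' | h'
  · rw [h']; simp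
  have hc1 : Continuous fun s => |rp r (push e s' p) - rp r (push e s p) - a * (s' - s)| := by
    have := continuous_rp_push H e p
    fun_prop
  have hc2 : Continuous fun s => ε * (s' - s) := by fun_prop
  refine le_of_tendsto_of_tendsto ((hc1.tendsto s).mono_left (nhdsWithin_le_nhds (s := Ioi s)))
    ((hc2.tendsto s).mono_left nhdsWithin_le_nhds) ?_
  filter_upwards [Ioo_mem_nhdsGT h'] with s1 hs1
  exact main s1 ⟨by rw [h]; exact hs1.1, hs1.2.le⟩

lemma slope_ge (Ch : Chart T N M ε a e r v t₀ t₁ x₀ P ρ s₀) (H : Sol κ T L c Mv Mr r v)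
    (hp : p ∈ cyl t₀ t₁ x₀ ρ) {s : ℝ} (hs : hit r e s₀ p ≤ s) (hs' : s ≤ 4 * s₀) :
    (a - ε) * (s - hit r e s₀ p) ≤ rp r (push e s p) := by
  have h := (abs_le.1 (Ch.slope H hp le_rfl hs hs')).1
  have := rp_nonneg r (push e (hit r e s₀ p) p)
  linarith

lemma rp_push_hit (H : Sol κ T L c Mv Mr r v) (Ch : Chart T N M ε a e r v t₀ t₁ x₀ P ρ s₀)
    (hp : p ∈ cyl t₀ t₁ x₀ ρ) (hr : ¬ 0 < r p.1 p.2) : rp r (push e (hit r e s₀ p) p) = 0 := by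
  refine le_antisymm (not_lt.1 fun h => ?_) (rp_nonneg _ _)
  rcases (hit_nonneg r e s₀ p).eq_or_lt with h0 | h0
  · rw [rp_pos_iff, ← h0] at h
    simp only [push, zero_smul, add_zero] at h
    exact hr h
  · have hev := ((continuous_rp_push H e p).tendsto (hit r e s₀ p)).eventually (lt_mem_nhds h)
    have h1 : ∀ᶠ s in 𝓝[<] (hit r e s₀ p), 0 < rp r (push e s p) :=
      hev.filter_mono nhdsWithin_le_nhds
    obtain ⟨s, hs, hs'⟩ := (h1.and (Ioo_mem_nhdsLT h0)).exists
    have := hit_le (r := r) (e := e) (s₀ := s₀) (p := p)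
      ⟨hs'.1.le, hs'.2.le.trans (Ch.hit_le_max hp)⟩ (rp_pos_iff.1 hs)
    linarith [hs'.2]

lemma abs_rp_push_sub_le (Ch : Chart T N M ε a e r v t₀ t₁ x₀ P ρ s₀) (H : Sol κ T L c Mv Mr r v)
    (hp : p ∈ cyl t₀ t₁ x₀ ρ) (hq : q ∈ cyl t₀ t₁ x₀ ρ) {s s' : ℝ} (hs : s ∈ Icc 0 (4 * s₀))
    (hs' : s' ∈ Icc 0 (4 * s₀)) :
    |rp r (push e s' q) - rp r (push e s p)| ≤
      L * ‖q.2 - p.2‖ + L * |s' - s| + rateR d κ L Mv N M * |q.1 - p.1| := by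
  refine (Ch.bx.abs_rp_sub_le H (Ch.push_mem hp hs) (Ch.push_mem hq hs')).trans ?_
  have e1 : (push e s' q).2 - (push e s p).2 = (q.2 - p.2) + (s' - s) • e := by
    simp only [push, sub_smul]; abel
  have h1 := norm_add_le (q.2 - p.2) ((s' - s) • e)
  rw [norm_smul, Ch.norm_e, mul_one, Real.norm_eq_abs] at h1
  rw [e1]
  have h2 := mul_le_mul_of_nonneg_left h1 H.L_nonneg
  simp only [push]
  linarith

lemma hit_le_add (Ch : Chart T N M ε a e r v t₀ t₁ x₀ P ρ s₀) (H : Sol κ T L c Mv Mr r v)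
    (hp : p ∈ cyl t₀ t₁ x₀ ρ) (hq : q ∈ cyl t₀ t₁ x₀ ρ) :
    hit r e s₀ q ≤ hit r e s₀ p +
      (L * ‖q.2 - p.2‖ + rateR d κ L Mv N M * |q.1 - p.1|) / (a - ε) := by
  have hg := Ch.slope_pos.2
  set ν := L * ‖q.2 - p.2‖ + rateR d κ L Mv N M * |q.1 - p.1| with hν
  by_contra hcon
  push Not at hcon
  obtain ⟨s, hs1, hs2⟩ := exists_between hcon
  have hν0 : 0 ≤ ν := add_nonneg (mul_nonneg H.L_nonneg (norm_nonneg _))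
    (mul_nonneg (H.rateR_nonneg Ch.bx.N_pos.le Ch.bx.M_pos.le) (abs_nonneg _))
  have h0 := hit_nonneg r e s₀ p
  have h1 : hit r e s₀ p ≤ s := by
    have : 0 ≤ ν / (a - ε) := by positivity
    linarith
  have hs0 : s ≤ s₀ := hs2.le.trans (Ch.hit_le_max hq)
  have hs4 : s ∈ Icc 0 (4 * s₀) := ⟨h0.trans h1, by linarith [Ch.s₀_pos]⟩
  have h2 := Ch.slope_ge H hp h1 hs4.2
  have h3 := Ch.abs_rp_push_sub_le H hp hq hs4 hs4
  simp only [sub_self, abs_zero, mul_zero, add_zero] at h3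
  have h4 : ν < (a - ε) * (s - hit r e s₀ p) := by
    have : ν / (a - ε) < s - hit r e s₀ p := by linarith
    rw [div_lt_iff₀ hg] at this
    linarith
  have h5 : 0 < rp r (push e s q) := by linarith [(abs_le.1 h3).1]
  have := hit_le (r := r) (e := e) (s₀ := s₀) (p := q) ⟨hs4.1, hs0⟩ (rp_pos_iff.1 h5)
  linarith

lemma abs_hit_sub_le (Ch : Chart T N M ε a e r v t₀ t₁ x₀ P ρ s₀) (H : Sol κ T L c Mv Mr r v)
    (hp : p ∈ cyl t₀ t₁ x₀ ρ) (hq : q ∈ cyl t₀ t₁ x₀ ρ) :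
    |hit r e s₀ q - hit r e s₀ p| ≤
      (L * ‖q.2 - p.2‖ + rateR d κ L Mv N M * |q.1 - p.1|) / (a - ε) := by
  have h1 := Ch.hit_le_add H hp hq
  have h2 := Ch.hit_le_add H hq hp
  rw [norm_sub_rev p.2, abs_sub_comm p.1] at h2
  rw [abs_le]
  constructor <;> linarith

/-- The Lipschitz constant of the hitting distance. -/
noncomputable def hitK (L rt a ε : ℝ) : ℝ := (L + rt) / (a - ε)

lemma div_le_hitK_mul (Ch : Chart T N M ε a e r v t₀ t₁ x₀ P ρ s₀)
    (H : Sol κ T L c Mv Mr r v) :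
    (L * ‖q.2 - p.2‖ + rateR d κ L Mv N M * |q.1 - p.1|) / (a - ε) ≤
      hitK L (rateR d κ L Mv N M) a ε * ‖q - p‖ := by
  have hg := Ch.slope_pos.2
  have h1 : ‖q.2 - p.2‖ ≤ ‖q - p‖ := norm_snd_le (q - p)
  have h2 : |q.1 - p.1| ≤ ‖q - p‖ := norm_fst_le (q - p)
  have h3 := H.L_nonneg
  have h4 := H.rateR_nonneg Ch.bx.N_pos.le Ch.bx.M_pos.le
  rw [hitK, div_mul_eq_mul_div, add_mul]
  gcongr

lemma norm_hit_sub_le (Ch : Chart T N M ε a e r v t₀ t₁ x₀ P ρ s₀) (H : Sol κ T L c Mv Mr r v)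
    (hp : p ∈ cyl t₀ t₁ x₀ ρ) (hq : q ∈ cyl t₀ t₁ x₀ ρ) :
    |hit r e s₀ q - hit r e s₀ p| ≤ hitK L (rateR d κ L Mv N M) a ε * ‖q - p‖ :=
  (Ch.abs_hit_sub_le H hp hq).trans (Ch.div_le_hitK_mul H)

lemma ptLip_hit (Ch : Chart T N M ε a e r v t₀ t₁ x₀ P ρ s₀) (H : Sol κ T L c Mv Mr r v) :
    PtLip (hitK L (rateR d κ L Mv N M) a ε) (hit r e s₀) (cyl t₀ t₁ x₀ ρ) := by
  intro p hp
  filter_upwards [self_mem_nhdsWithin] with q hq using Ch.norm_hit_sub_le H hp hq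

lemma hitK_nonneg (Ch : Chart T N M ε a e r v t₀ t₁ x₀ P ρ s₀) (H : Sol κ T L c Mv Mr r v) :
    0 ≤ hitK L (rateR d κ L Mv N M) a ε := by
  have hg := Ch.slope_pos.2
  have h3 := H.L_nonneg
  have h4 := H.rateR_nonneg Ch.bx.N_pos.le Ch.bx.M_pos.le
  unfold hitK
  positivity

lemma hit_mul_mem (Ch : Chart T N M ε a e r v t₀ t₁ x₀ P ρ s₀) (hp : p ∈ cyl t₀ t₁ x₀ ρ) {k : ℝ}
    (hk : k ∈ Icc (0:ℝ) 4) : k * hit r e s₀ p ∈ Icc 0 (4 * s₀) :=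
  ⟨mul_nonneg hk.1 (hit_nonneg _ _ _ _),
    mul_le_mul hk.2 (Ch.hit_le_max hp) (hit_nonneg _ _ _ _) (by norm_num)⟩

lemma extR_of_pos (Ch : Chart T N M ε a e r v t₀ t₁ x₀ P ρ s₀) (hr : 0 < r p.1 p.2) :
    extR r e s₀ p = r p.1 p.2 := by
  unfold extR
  rw [Ch.hit_eq_zero hr]
  simp only [push, mul_zero, zero_smul, add_zero]
  rw [rp_of_pos hr]
  ring

lemma extV_of_pos (Ch : Chart T N M ε a e r v t₀ t₁ x₀ P ρ s₀) (hr : 0 < r p.1 p.2) :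
    extV r v e s₀ p = v p.1 p.2 := by
  unfold extV
  rw [Ch.hit_eq_zero hr]
  simp

lemma rp_push_mul_bounds (Ch : Chart T N M ε a e r v t₀ t₁ x₀ P ρ s₀)
    (H : Sol κ T L c Mv Mr r v) (hp : p ∈ cyl t₀ t₁ x₀ ρ) (hr : ¬ 0 < r p.1 p.2) {k : ℝ}
    (hk : k ∈ Icc (1:ℝ) 4) :
    (a - ε) * ((k - 1) * hit r e s₀ p) ≤ rp r (push e (k * hit r e s₀ p) p) ∧
      rp r (push e (k * hit r e s₀ p) p) ≤ (a + ε) * ((k - 1) * hit r e s₀ p) := by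
  have h0 := hit_nonneg r e s₀ p
  have h := abs_le.1 (Ch.slope H hp le_rfl (by nlinarith [hk.1])
    (Ch.hit_mul_mem hp (k := k) ⟨by linarith [hk.1], hk.2⟩).2)
  rw [rp_push_hit H Ch hp hr] at h
  constructor <;> nlinarith [h.1, h.2]

lemma extR_le (Ch : Chart T N M ε a e r v t₀ t₁ x₀ P ρ s₀) (H : Sol κ T L c Mv Mr r v)
    (hp : p ∈ cyl t₀ t₁ x₀ ρ) (hr : ¬ 0 < r p.1 p.2) :
    extR r e s₀ p ≤ -((a - 3 * ε) * hit r e s₀ p) ∧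
      |extR r e s₀ p| ≤ 3 * (a + ε) * hit r e s₀ p := by
  have h0 := hit_nonneg r e s₀ p
  have h2 := Ch.rp_push_mul_bounds H hp hr (k := 2) ⟨by norm_num, by norm_num⟩
  have h4 := abs_le.1 (Ch.slope H hp (s := 2 * hit r e s₀ p) (s' := 4 * hit r e s₀ p) (by linarith)
    (by linarith) (Ch.hit_mul_mem hp ⟨by norm_num, le_rfl⟩).2)
  have := Ch.ε_pos
  have := Ch.a_ge
  have h5 : 0 ≤ (a - 3 * ε) * hit r e s₀ p := mul_nonneg (by linarith) h0
  have h6 : 0 ≤ ε * hit r e s₀ p := mul_nonneg (by linarith) h0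
  unfold extR
  have h7 : 2 * rp r (push e (2 * hit r e s₀ p) p) - rp r (push e (4 * hit r e s₀ p) p) ≤
    -((a - 3 * ε) * hit r e s₀ p) := by nlinarith
  refine ⟨h7, abs_le.2 ⟨by nlinarith, by nlinarith⟩⟩

end Chart

end Extension

section ExtensionLipschitz

variable {d : ℕ}

namespace Chart

variable {κ T L c Mv Mr N M ε a t₀ t₁ P ρ s₀ : ℝ} {r : ℝ → (𝔼 d) → ℝ}
  {v : ℝ → (𝔼 d) → 𝔼 d} {e x₀ : 𝔼 d} {p q : ℝ × 𝔼 d}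

lemma abs_extR_sub_le (Ch : Chart T N M ε a e r v t₀ t₁ x₀ P ρ s₀) (H : Sol κ T L c Mv Mr r v)
    (hp : p ∈ cyl t₀ t₁ x₀ ρ) (hq : q ∈ cyl t₀ t₁ x₀ ρ) :
    |extR r e s₀ q - extR r e s₀ p| ≤
      (3 * (L + rateR d κ L Mv N M) + 8 * L * hitK L (rateR d κ L Mv N M) a ε) * ‖q - p‖ := by
  have h2 := Ch.abs_rp_push_sub_le H hp hq
    (Ch.hit_mul_mem hp (k := 2) ⟨by norm_num, by norm_num⟩)
    (Ch.hit_mul_mem hq (k := 2) ⟨by norm_num, by norm_num⟩)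
  have h4 := Ch.abs_rp_push_sub_le H hp hq
    (Ch.hit_mul_mem hp (k := 4) ⟨by norm_num, by norm_num⟩)
    (Ch.hit_mul_mem hq (k := 4) ⟨by norm_num, by norm_num⟩)
  rw [← mul_sub, abs_mul, abs_of_pos (by norm_num : (0:ℝ) < 2)] at h2
  rw [← mul_sub, abs_mul, abs_of_pos (by norm_num : (0:ℝ) < 4)] at h4
  have hh := mul_le_mul_of_nonneg_left (Ch.norm_hit_sub_le H hp hq) H.L_nonneg
  have e1 : ‖q.2 - p.2‖ ≤ ‖q - p‖ := norm_snd_le (q - p)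
  have e2 : |q.1 - p.1| ≤ ‖q - p‖ := norm_fst_le (q - p)
  have e1' := mul_le_mul_of_nonneg_left e1 H.L_nonneg
  have e2' := mul_le_mul_of_nonneg_left e2 (H.rateR_nonneg (d := d) Ch.bx.N_pos.le Ch.bx.M_pos.le)
  have h2' := abs_le.1 h2
  have h4' := abs_le.1 h4
  unfold extR
  rw [abs_le]
  constructor <;> linarith [h2'.1, h2'.2, h4'.1, h4'.2]

lemma abs_extR_le (Ch : Chart T N M ε a e r v t₀ t₁ x₀ P ρ s₀) (hp : p ∈ cyl t₀ t₁ x₀ ρ) :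
    |extR r e s₀ p| ≤ 3 * M := by
  have key : ∀ k ∈ Icc (0:ℝ) 4, rp r (push e (k * hit r e s₀ p) p) ≤ M := fun k hk =>
    max_le ((le_abs_self _).trans (Ch.bx.r_le _ (Ch.push_mem hp (Ch.hit_mul_mem hp hk))))
      Ch.bx.M_pos.le
  have h2 := key 2 ⟨by norm_num, by norm_num⟩
  have h4 := key 4 ⟨by norm_num, by norm_num⟩
  have g2 := rp_nonneg r (push e (2 * hit r e s₀ p) p)
  have g4 := rp_nonneg r (push e (4 * hit r e s₀ p) p)
  unfold extR
  rw [abs_le]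
  constructor <;> linarith [Ch.bx.M_pos]

lemma norm_extV_le (Ch : Chart T N M ε a e r v t₀ t₁ x₀ P ρ s₀) (hp : p ∈ cyl t₀ t₁ x₀ ρ) :
    ‖extV r v e s₀ p‖ ≤ N := by
  have h := Ch.bx.v_le _ (Ch.push_mem hp (Ch.hit_mul_mem hp (k := 2) ⟨by norm_num, by norm_num⟩))
  simpa only [extV, push] using h

/-- Beyond the hitting point, `v` is Lipschitz along `e`. -/
lemma norm_v_push_sub_le (Ch : Chart T N M ε a e r v t₀ t₁ x₀ P ρ s₀)
    (H : Sol κ T L c Mv Mr r v) (hp : p ∈ cyl t₀ t₁ x₀ ρ) {s s' : ℝ} (hs : hit r e s₀ p ≤ s)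
    (hss : s ≤ s') (hs' : s' ≤ 4 * s₀) :
    ‖v p.1 (p.2 + s' • e) - v p.1 (p.2 + s • e)‖ ≤ Mv * (s' - s) := by
  have main : ∀ s ∈ Ioc (hit r e s₀ p) s',
      ‖v p.1 (p.2 + s' • e) - v p.1 (p.2 + s • e)‖ ≤ Mv * (s' - s) := by
    intro s hs
    have h0 := (hit_nonneg r e s₀ p).trans hs.1.le
    have h1 := Ch.push_mem hp (s := s) ⟨h0, hs.2.trans hs'⟩
    have h2 := Ch.push_mem hp (s := s') ⟨h0.trans hs.2, hs'⟩
    have h := Ch.bx.norm_v_sub_le H h1 h2 (fun z hz => ?_) (fun τ hτ => ?_)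
    · simp only [push, add_sub_add_left_eq_sub, sub_self, abs_zero, mul_zero, add_zero,
        ← sub_smul, norm_smul, Ch.norm_e, mul_one, Real.norm_eq_abs] at h
      rwa [abs_of_nonneg (by linarith [hs.2])] at h
    · rw [segment_eq_image'] at hz
      obtain ⟨θ, hθ, rfl⟩ := hz
      have hz : (push e s p).2 + θ • ((push e s' p).2 - (push e s p).2)
          = p.2 + (s + θ * (s' - s)) • e := by
        simp only [push, add_sub_add_left_eq_sub]
        rw [← sub_smul, smul_smul, add_assoc, ← add_smul]
      beta_reduce
      rw [hz]
      exact Ch.pos_of_hit_lt H hp (by nlinarith [hs.1, hs.2, hθ.1])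
        (by nlinarith [hs.1, hs.2, hθ.2])
    · simp only [push, uIcc_self, mem_singleton_iff] at hτ
      rw [hτ]
      exact Ch.pos_of_hit_lt H hp (hs.1.trans_le hs.2) hs'
  rcases hss.eq_or_lt with rfl | hss
  · simp
  rcases hs.lt_or_eq with h | h
  · exact main s ⟨h, hss.le⟩
  · subst h
    have hc : Continuous fun s => v p.1 (p.2 + s • e) :=
      H.vcont.comp (by fun_prop : Continuous fun s : ℝ => (p.1, p.2 + s • e))
    have l1 : Tendsto (fun s => ‖v p.1 (p.2 + s' • e) - v p.1 (p.2 + s • e)‖)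
        (𝓝[>] (hit r e s₀ p)) (𝓝 ‖v p.1 (p.2 + s' • e) - v p.1 (p.2 + hit r e s₀ p • e)‖) :=
      ((continuous_const.sub hc).norm.tendsto _).mono_left nhdsWithin_le_nhds
    have l2 : Tendsto (fun s => Mv * (s' - s)) (𝓝[>] (hit r e s₀ p))
        (𝓝 (Mv * (s' - hit r e s₀ p))) :=
      ((by fun_prop : Continuous fun s : ℝ => Mv * (s' - s)).tendsto _).mono_left
        nhdsWithin_le_nhds
    refine le_of_tendsto_of_tendsto l1 l2 ?_
    filter_upwards [Ioc_mem_nhdsGT hss] with s hs using main s hs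

/-- The velocity is Lipschitz on parallel translates along `e` that stay in the gas. -/
lemma norm_v_push_push_sub_le (Ch : Chart T N M ε a e r v t₀ t₁ x₀ P ρ s₀)
    (H : Sol κ T L c Mv Mr r v) (hp : p ∈ cyl t₀ t₁ x₀ ρ) (hq : q ∈ cyl t₀ t₁ x₀ ρ) {s : ℝ}
    (hsp : hit r e s₀ p +
      (L * ‖q.2 - p.2‖ + rateR d κ L Mv N M * |q.1 - p.1|) / (a - ε) < s)
    (hsq : hit r e s₀ q +
      (L * ‖q.2 - p.2‖ + rateR d κ L Mv N M * |q.1 - p.1|) / (a - ε) < s) (hs : s ≤ 4 * s₀) :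
    ‖v q.1 (q.2 + s • e) - v p.1 (p.2 + s • e)‖ ≤
      Mv * ‖q.2 - p.2‖ + (Mv * N + L) * |q.1 - p.1| := by
  have hg := Ch.slope_pos.2
  have hL := H.L_nonneg
  have hrt := H.rateR_nonneg Ch.bx.N_pos.le Ch.bx.M_pos.le
  have hν : 0 ≤ (L * ‖q.2 - p.2‖ + rateR d κ L Mv N M * |q.1 - p.1|) / (a - ε) := by positivity
  have hs0 : 0 ≤ s := by
    have := hit_nonneg r e s₀ p
    linarith
  have h := Ch.bx.norm_v_sub_le H (Ch.push_mem hp ⟨hs0, hs⟩) (Ch.push_mem hq ⟨hs0, hs⟩)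
    (fun z hz => ?_) (fun τ hτ => ?_)
  · simpa only [push, add_sub_add_right_eq_sub] using h
  · rw [segment_eq_image'] at hz
    obtain ⟨θ, hθ, rfl⟩ := hz
    have hz : (push e s p).2 + θ • ((push e s q).2 - (push e s p).2)
        = (p.2 + θ • (q.2 - p.2)) + s • e := by
      simp only [push, add_sub_add_right_eq_sub]
      abel
    beta_reduce
    rw [hz]
    have hy : (p.1, p.2 + θ • (q.2 - p.2)) ∈ cyl t₀ t₁ x₀ ρ :=
      ⟨hp.1, (convex_ball x₀ ρ).add_smul_sub_mem hp.2 hq.2 hθ⟩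
    refine Ch.pos_of_hit_lt H hy (lt_of_le_of_lt ?_ hsp) hs
    refine (Ch.hit_le_add H hp hy).trans ?_
    simp only [add_sub_cancel_left, sub_self, abs_zero, mul_zero, add_zero, norm_smul,
      Real.norm_of_nonneg hθ.1]
    gcongr
    have := mul_le_of_le_one_left (norm_nonneg (q.2 - p.2)) hθ.2
    nlinarith [mul_nonneg hrt (abs_nonneg (q.1 - p.1)), mul_le_mul_of_nonneg_left this hL]
  · have hy : (τ, q.2) ∈ cyl t₀ t₁ x₀ ρ := Box.mem_of_uIcc hp hq hτ
    refine Ch.pos_of_hit_lt H hy (lt_of_le_of_lt ?_ hsq) hs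
    refine (Ch.hit_le_add H hq hy).trans ?_
    have h1 : |τ - q.1| ≤ |q.1 - p.1| := by
      rw [abs_sub_comm q.1 p.1]
      exact abs_sub_left_of_mem_uIcc (by rwa [uIcc_comm] at hτ)
    simp only [sub_self, norm_zero, mul_zero, zero_add]
    gcongr
    nlinarith [mul_nonneg hL (norm_nonneg (q.2 - p.2)), mul_le_mul_of_nonneg_left h1 hrt]

lemma ptLip_extV (Ch : Chart T N M ε a e r v t₀ t₁ x₀ P ρ s₀) (H : Sol κ T L c Mv Mr r v) :
    PtLip (2 * Mv * (3 * hitK L (rateR d κ L Mv N M) a ε + 1) + (Mv + (Mv * N + L)))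
      (extV r v e s₀) (cyl t₀ t₁ x₀ ρ) := by
  have hK := Ch.hitK_nonneg H
  set k := hitK L (rateR d κ L Mv N M) a ε with hk
  intro p hp
  have hev : ∀ᶠ q in 𝓝[cyl t₀ t₁ x₀ ρ] p, (k + 1) * ‖q - p‖ < 2 * s₀ := by
    have hc : Continuous fun q : ℝ × 𝔼 d => (k + 1) * ‖q - p‖ := by fun_prop
    refine (hc.continuousWithinAt).eventually (gt_mem_nhds ?_)
    simp [Ch.s₀_pos]
  filter_upwards [hev, self_mem_nhdsWithin] with q hsmall hq
  rcases eq_or_ne q p with rfl | hne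
  · simp
  have hn : 0 < ‖q - p‖ := norm_pos_iff.2 (sub_ne_zero.2 hne)
  have hpq := abs_le.1 (Ch.norm_hit_sub_le H hp hq)
  rw [← hk] at hpq
  have hp0 := hit_nonneg r e s₀ p
  have hq0 := hit_nonneg r e s₀ q
  have hpm := Ch.hit_le_max hp
  have hqm := Ch.hit_le_max hq
  set σ := max (hit r e s₀ p) (hit r e s₀ q) with hσ
  have hσp : hit r e s₀ p ≤ σ := le_max_left _ _
  have hσq : hit r e s₀ q ≤ σ := le_max_right _ _
  have hσm : σ ≤ s₀ := max_le hpm hqm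
  have hσp' : σ ≤ hit r e s₀ p + k * ‖q - p‖ := max_le (by nlinarith) (by linarith)
  have hσq' : σ ≤ hit r e s₀ q + k * ‖q - p‖ := max_le (by linarith) (by nlinarith)
  obtain ⟨s, hs⟩ : ∃ s, s = 2 * σ + (k + 1) * ‖q - p‖ := ⟨_, rfl⟩
  have hs4 : s ≤ 4 * s₀ := by linarith
  have hkn : 0 ≤ k * ‖q - p‖ := mul_nonneg hK hn.le
  have hk1 : (k + 1) * ‖q - p‖ = k * ‖q - p‖ + ‖q - p‖ := by ring
  have hA := Ch.norm_v_push_sub_le H hp (s := 2 * hit r e s₀ p) (s' := s) (by linarith)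
    (by linarith) hs4
  have hB := Ch.norm_v_push_sub_le H hq (s := 2 * hit r e s₀ q) (s' := s) (by linarith)
    (by linarith) hs4
  have hν : (L * ‖q.2 - p.2‖ + rateR d κ L Mv N M * |q.1 - p.1|) / (a - ε) ≤ k * ‖q - p‖ :=
    Ch.div_le_hitK_mul H
  have hC := Ch.norm_v_push_push_sub_le H hp hq (s := s) (by linarith) (by linarith) hs4
  have hA' := mul_le_mul_of_nonneg_left
    (by linarith : s - 2 * hit r e s₀ p ≤ (3 * k + 1) * ‖q - p‖) H.Mv_nonneg
  have hB' := mul_le_mul_of_nonneg_left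
    (by linarith : s - 2 * hit r e s₀ q ≤ (3 * k + 1) * ‖q - p‖) H.Mv_nonneg
  have e1 := mul_le_mul_of_nonneg_left (norm_snd_le (q - p)) H.Mv_nonneg
  have e2 := mul_le_mul_of_nonneg_left (norm_fst_le (q - p))
    (add_nonneg (mul_nonneg H.Mv_nonneg Ch.bx.N_pos.le) H.L_nonneg)
  simp only [Prod.fst_sub, Prod.snd_sub, Real.norm_eq_abs] at e1 e2
  have e3 : extV r v e s₀ q - extV r v e s₀ p =
      (v q.1 (q.2 + s • e) - v p.1 (p.2 + s • e))
      - (v q.1 (q.2 + s • e) - v q.1 (q.2 + (2 * hit r e s₀ q) • e))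
      + (v p.1 (p.2 + s • e) - v p.1 (p.2 + (2 * hit r e s₀ p) • e)) := by
    unfold extV; abel
  rw [e3]
  refine (norm_add_le _ _).trans ?_
  refine (add_le_add_left (norm_sub_le _ _) _).trans ?_
  linarith

end Chart

end ExtensionLipschitz

section ExtensionEquation

lemma norm_fderiv_apply_sub_le {W F : Type*} [NormedAddCommGroup W] [NormedSpace ℝ W]
    [NormedAddCommGroup F] [NormedSpace ℝ F] {f : W → F} {p w : W} {G : F} {C : ℝ}
    (hf : DifferentiableAt ℝ f p)
    (h : ∀ η > 0, ∀ᶠ h : ℝ in 𝓝[>] 0, ‖f (p + h • w) - f p - h • G‖ ≤ (C + η) * h) :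
    ‖fderiv ℝ f p w - G‖ ≤ C := by
  refine le_of_forall_pos_le_add fun η hη => ?_
  have h1 : HasDerivAt (fun t : ℝ => f (p + t • w)) (fderiv ℝ f p w) 0 :=
    hf.hasFDerivAt.hasLineDerivAt w
  have hsub : Ioi (0:ℝ) ⊆ {0}ᶜ := fun x hx => (mem_Ioi.1 hx).ne'
  have h2 := (hasDerivAt_iff_tendsto_slope_zero.1 h1).mono_left (nhdsWithin_mono 0 hsub)
  simp only [zero_add, zero_smul, add_zero] at h2
  refine le_of_tendsto (h2.sub_const G).norm ?_
  filter_upwards [h η hη, self_mem_nhdsWithin] with t ht (ht0 : 0 < t)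
  have e1 : t⁻¹ • (f (p + t • w) - f p) - G = t⁻¹ • (f (p + t • w) - f p - t • G) := by
    rw [smul_sub t⁻¹ (f (p + t • w) - f p), inv_smul_smul₀ ht0.ne']
  rw [e1, norm_smul, Real.norm_of_nonneg (inv_nonneg.2 ht0.le), inv_mul_le_iff₀ ht0]
  linarith

variable {d : ℕ}

lemma tendsto_add_smul {W : Type*} [NormedAddCommGroup W] [NormedSpace ℝ W] (p w : W) :
    Tendsto (fun h : ℝ => p + h • w) (𝓝[>] 0) (𝓝 p) := by
  have : Continuous fun h : ℝ => p + h • w := by fun_prop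
  simpa using (this.tendsto 0).mono_left (nhdsWithin_le_nhds (s := Ioi (0:ℝ)))

/-- The gradient of `r` oscillates by at most a multiple of `√r` on a space-time neighbourhood. -/
lemma Box.eventually_gradient_le {κ T L c Mv Mr N M t₀ t₁ ρ : ℝ} {r : ℝ → (𝔼 d) → ℝ}
    {v : ℝ → (𝔼 d) → 𝔼 d} {x₀ : 𝔼 d} (Bx : Box T N M r v t₀ t₁ x₀ ρ)
    (H : Sol κ T L c Mv Mr r v) {w₀ : ℝ × 𝔼 d} (hw : w₀ ∈ cyl t₀ t₁ x₀ ρ) (hw0 : t₀ < w₀.1)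
    (hr : 0 < r w₀.1 w₀.2) : ∀ᶠ q in 𝓝 w₀,
      ‖gradient (r q.1) q.2 - gradient (r w₀.1) w₀.2‖ ≤ (8 * Mr + 1) * √(r w₀.1 w₀.2) := by
  set m := r w₀.1 w₀.2 with hm
  set rt := rateR d κ L Mv N M with hrt
  have hrt0 : 0 ≤ rt := H.rateR_nonneg Bx.N_pos.le Bx.M_pos.le
  have hL := H.L_nonneg
  have hsm : 0 < √m := Real.sqrt_pos.2 hr
  obtain ⟨ρ₁, hρ₁, hball⟩ := Metric.mem_nhds_iff.1 (cyl_mem_nhds hw hw0)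
  set δ := min (m / (2 * (L + 1))) ρ₁ with hδ
  have hδ0 : 0 < δ := lt_min (by positivity) hρ₁
  have hδm : L * δ ≤ m / 2 ∧ 2 * δ ≤ m := by
    have h1 : δ ≤ m / (2 * (L + 1)) := min_le_left _ _
    rw [le_div_iff₀ (by positivity)] at h1
    constructor <;> nlinarith
  have ev1 : ∀ᶠ q : ℝ × 𝔼 d in 𝓝 w₀, rt * |q.1 - w₀.1| < m / 4 :=
    (show Continuous fun q : ℝ × 𝔼 d => rt * |q.1 - w₀.1| by fun_prop).continuousAt.eventually
      (gt_mem_nhds (by simp; exact hr))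
  have ev2 : ∀ᶠ q : ℝ × 𝔼 d in 𝓝 w₀, 4 * (rt * |q.1 - w₀.1|) / δ < √m :=
    (show Continuous fun q : ℝ × 𝔼 d => 4 * (rt * |q.1 - w₀.1|) / δ by
      fun_prop).continuousAt.eventually (gt_mem_nhds (by simp; exact hr))
  filter_upwards [ev1, ev2, ball_mem_nhds w₀ hδ0] with q h1 h2 hq
  have hq1 : q.1 ∈ ball w₀.1 δ := (ball_prod_same w₀.1 w₀.2 δ ▸ hq : q ∈ ball w₀.1 δ ×ˢ _).1
  have hq2 : q.2 ∈ ball w₀.2 δ := (ball_prod_same w₀.1 w₀.2 δ ▸ hq : q ∈ ball w₀.1 δ ×ˢ _).2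
  have hc1 : ∀ z ∈ ball w₀.2 δ, (w₀.1, z) ∈ cyl t₀ t₁ x₀ ρ := fun z hz =>
    hball (ball_subset_ball (min_le_right _ _) (mk_mem_ball (mem_ball_self hδ0) hz))
  have hc2 : ∀ z ∈ ball w₀.2 δ, (q.1, z) ∈ cyl t₀ t₁ x₀ ρ := fun z hz =>
    hball (ball_subset_ball (min_le_right _ _) (mk_mem_ball hq1 hz))
  have ht := Bx.mem_time hw
  have ht' := Bx.mem_time (hc2 q.2 hq2)
  have hb1 : ∀ z ∈ ball w₀.2 δ, m / 2 ≤ r w₀.1 z ∧ r w₀.1 z ≤ 3 / 2 * m := by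
    intro z hz
    have h3 := abs_le.1 (H.lip w₀.1 ht z w₀.2)
    rw [← hm, ← dist_eq_norm] at h3
    have h4 : L * dist z w₀.2 ≤ L * δ := mul_le_mul_of_nonneg_left (mem_ball.1 hz).le hL
    constructor <;> linarith [h3.1, h3.2]
  have hb2 : ∀ z ∈ ball w₀.2 δ, (0 < r q.1 z ∧ r q.1 z ≤ 2 * m) ∧
      |r q.1 z - r w₀.1 z| ≤ rt * |q.1 - w₀.1| := by
    intro z hz
    have h3 := Bx.abs_rp_sub_le H (hc1 z hz) (hc2 z hz)
    rw [sub_self, norm_zero, mul_zero, zero_add, ← hrt] at h3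
    have h4 := hb1 z hz
    have h5 : rp r (w₀.1, z) = r w₀.1 z := rp_of_pos (p := (w₀.1, z)) (by linarith [h4.1])
    have h3' := abs_le.1 h3
    rw [h5] at h3'
    have h6 : 0 < rp r (q.1, z) := by linarith [h3'.1, h4.1]
    have h7 : rp r (q.1, z) = r q.1 z := rp_of_pos (p := (q.1, z)) (rp_pos_iff.1 h6)
    rw [h5, h7] at h3
    rw [h7] at h3' h6
    exact ⟨⟨h6, by linarith [h3'.2, h4.2]⟩, h3⟩
  have hs2 : √(2 * m) ≤ 3 / 2 * √m := by
    rw [Real.sqrt_le_left (by positivity), mul_pow, Real.sq_sqrt hr.le]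
    linarith
  have hbd : ∀ x y z : ℝ, x ≤ 2 * m → y ≤ 2 * m → z ≤ 2 * δ →
      Mr * (√x + √y + √z) ≤ 4 * Mr * √m := by
    intro x y z hx hy hz
    have g1 := (Real.sqrt_le_sqrt hx).trans hs2
    have g2 := (Real.sqrt_le_sqrt hy).trans hs2
    have g3 := Real.sqrt_le_sqrt (hz.trans hδm.2)
    have := mul_le_mul_of_nonneg_left (by linarith : √x + √y + √z ≤ 4 * √m) H.Mr_nonneg
    linarith
  have hdist : ∀ z ∈ ball w₀.2 δ, ∀ z' ∈ ball w₀.2 δ, ‖z - z'‖ ≤ 2 * δ := by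
    intro z hz z' hz'
    rw [← dist_eq_norm]
    have := dist_triangle_right z z' w₀.2
    linarith [mem_ball.1 hz, mem_ball.1 hz']
  have hw2 : w₀.2 ∈ ball w₀.2 δ := mem_ball_self hδ0
  have := H.norm_gradient_compare ht ht' hδ0 (G := gradient (r w₀.1) w₀.2)
    (G' := gradient (r q.1) q.2) (fun z hz => by linarith [(hb1 z hz).1])
    (fun z hz => (hb2 z hz).1.1)
    (fun z hz => (H.gradr w₀.1 ht z (by linarith [(hb1 z hz).1]) w₀.2 hr).trans
      (hbd _ _ _ (by linarith [(hb1 z hz).2]) (by linarith) (hdist z hz _ hw2)))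
    (fun z hz => (H.gradr q.1 ht' z (hb2 z hz).1.1 q.2 (hb2 _ hq2).1.1).trans
      (hbd _ _ _ (hb2 z hz).1.2 (hb2 _ hq2).1.2 (hdist z hz _ hq2)))
    (fun z hz => (hb2 z hz).2)
  linarith

lemma push_add (e : 𝔼 d) (s : ℝ) (p w : ℝ × 𝔼 d) : push e s (p + w) = push e s p + w := by
  ext1
  · rfl
  · simp only [push, Prod.snd_add]; abel

namespace Chart

variable {κ T L c Mv Mr N M ε a t₀ t₁ P ρ s₀ : ℝ} {r : ℝ → (𝔼 d) → ℝ}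
  {v : ℝ → (𝔼 d) → 𝔼 d} {e x₀ : 𝔼 d} {p q : ℝ × 𝔼 d}

lemma continuousAt_hit (Ch : Chart T N M ε a e r v t₀ t₁ x₀ P ρ s₀) (H : Sol κ T L c Mv Mr r v)
    (hp : p ∈ cyl t₀ t₁ x₀ ρ) (hp0 : t₀ < p.1) : ContinuousAt (hit r e s₀) p :=
  (Ch.ptLip_hit H).continuousOn.continuousAt (cyl_mem_nhds hp hp0)

lemma tendsto_push (Ch : Chart T N M ε a e r v t₀ t₁ x₀ P ρ s₀) (H : Sol κ T L c Mv Mr r v)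
    (hp : p ∈ cyl t₀ t₁ x₀ ρ) (hp0 : t₀ < p.1) (k : ℝ) :
    Tendsto (fun q => push e (k * hit r e s₀ q) q) (𝓝 p) (𝓝 (push e (k * hit r e s₀ p) p)) := by
  have h1 := Ch.continuousAt_hit H hp hp0
  unfold push
  exact continuousAt_fst.prodMk (continuousAt_snd.add ((h1.const_mul k).smul continuousAt_const))

lemma norm_v_push_sub_extV_le (Ch : Chart T N M ε a e r v t₀ t₁ x₀ P ρ s₀)
    (H : Sol κ T L c Mv Mr r v) (hp : p ∈ cyl t₀ t₁ x₀ ρ) {k : ℝ} (hk : k ∈ Icc (1:ℝ) 4) :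
    ‖v p.1 (p.2 + (k * hit r e s₀ p) • e) - extV r v e s₀ p‖ ≤ 2 * Mv * hit r e s₀ p := by
  have h0 := hit_nonneg r e s₀ p
  have hm := (Ch.hit_mul_mem hp (k := k) ⟨by linarith [hk.1], hk.2⟩).2
  have hm2 := (Ch.hit_mul_mem hp (k := 2) ⟨by norm_num, by norm_num⟩).2
  have hMv := mul_nonneg H.Mv_nonneg h0
  unfold extV
  rcases le_total k 2 with h | h
  · rw [norm_sub_rev]
    refine (Ch.norm_v_push_sub_le H hp (by nlinarith [hk.1]) (by nlinarith) hm2).trans ?_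
    nlinarith [hk.1]
  · refine (Ch.norm_v_push_sub_le H hp (by nlinarith) (by nlinarith) hm).trans ?_
    nlinarith [hk.2]

/-- The hitting distance changes slowly along the flow of the extended velocity. -/
lemma eventually_abs_hit_sub_le (Ch : Chart T N M ε a e r v t₀ t₁ x₀ P ρ s₀)
    (H : Sol κ T L c Mv Mr r v) (hp : p ∈ cyl t₀ t₁ x₀ ρ) (hp0 : t₀ < p.1)
    (hr : ¬ 0 < r p.1 p.2) (hσ : 0 < hit r e s₀ p) {η : ℝ} (hη : 0 < η) :
    ∀ᶠ h : ℝ in 𝓝[>] 0, |hit r e s₀ (p + h • ((1:ℝ), extV r v e s₀ p)) - hit r e s₀ p| ≤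
      (2 * L * Mv / (a - ε) * hit r e s₀ p + η) * h := by
  have hg := Ch.slope_pos.2
  set V := extV r v e s₀ p with hV
  set σ := hit r e s₀ p with hσ'
  have hpush := Ch.push_mem hp (s := σ) ⟨hσ.le, by linarith [Ch.hit_le_max hp, Ch.s₀_pos]⟩
  obtain ⟨δ, hδ, htr⟩ := Ch.bx.transport H hpush hp0 V (mul_pos hη hg)
  rw [rp_push_hit H Ch hp hr, mul_zero, zero_add] at htr
  have hvV := Ch.norm_v_push_sub_extV_le H hp (k := 1) ⟨le_rfl, by norm_num⟩
  rw [one_mul, ← hσ', ← hV] at hvV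
  have htd := tendsto_add_smul p ((1:ℝ), V)
  have h1 := htd.eventually (cyl_mem_nhds hp hp0)
  have h2 := htd.eventually ((Ch.continuousAt_hit H hp hp0).eventually (lt_mem_nhds hσ))
  have h3 := htd.eventually ((Ch.tendsto_push H hp hp0 1).eventually
    (by rw [one_mul]; exact ball_mem_nhds _ hδ))
  have hc : Continuous (push e σ) := by unfold push; fun_prop
  have h4 := htd.eventually (hc.continuousAt.eventually (ball_mem_nhds (push e σ p) hδ))
  have h5 : ∀ᶠ h : ℝ in 𝓝[>] 0, push e (hit r e s₀ (p + h • ((1:ℝ), V))) p ∈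
      ball (push e σ p) δ := by
    have : Continuous fun s => push e s p := by unfold push; fun_prop
    exact (this.tendsto σ).comp ((Ch.continuousAt_hit H hp hp0).tendsto.comp htd)
      (ball_mem_nhds _ hδ)
  filter_upwards [h1, h2, h3, h4, h5, self_mem_nhdsWithin] with h h1 h2 h3 h4 h5 (hpos : 0 < h)
  set q := p + h • ((1:ℝ), V) with hq
  set τ := hit r e s₀ q with hτ
  rw [one_mul] at h3
  have hbound : L * ‖v (push e σ p).1 (push e σ p).2 - V‖ + η * (a - ε) ≤
      2 * L * Mv * σ + η * (a - ε) := by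
    have := mul_le_mul_of_nonneg_left hvV H.L_nonneg
    simp only [push]
    linarith
  have hgoal : (2 * L * Mv / (a - ε) * σ + η) * h =
      ((2 * L * Mv * σ + η * (a - ε)) * h) / (a - ε) := by
    field_simp
  have hrq : ¬ 0 < r q.1 q.2 := fun hc => h2.ne' (Ch.hit_eq_zero hc)
  have hqm : τ ≤ s₀ := Ch.hit_le_max h1
  have hpm : σ ≤ s₀ := Ch.hit_le_max hp
  have key : ∀ w ∈ ball (push e σ p) δ, w + h • ((1:ℝ), V) ∈ ball (push e σ p) δ →
      |rp r (w + h • ((1:ℝ), V)) - rp r w| ≤ (2 * L * Mv * σ + η * (a - ε)) * h := by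
    intro w hw hw'
    refine (htr w hw h hw').trans ?_
    rw [abs_of_pos hpos]
    exact mul_le_mul_of_nonneg_right hbound hpos.le
  rw [hgoal, le_div_iff₀ hg]
  rcases le_total τ σ with hle | hle
  · rw [abs_of_nonpos (by linarith)]
    have g1 := Ch.slope_ge H h1 hle (by linarith [Ch.s₀_pos])
    have g2 := key (push e σ p) (mem_ball_self hδ) (by rw [← push_add]; exact h4)
    rw [← push_add, ← hq, rp_push_hit H Ch hp hr, sub_zero] at g2
    have := le_abs_self (rp r (push e σ q))
    linarith
  · rw [abs_of_nonneg (by linarith)]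
    have g1 := Ch.slope_ge H hp hle (by linarith [Ch.s₀_pos])
    have g2 := key (push e τ p) h5 (by rw [← push_add]; exact h3)
    rw [← push_add, ← hq, rp_push_hit H Ch h1 hrq, zero_sub, abs_neg] at g2
    have := le_abs_self (rp r (push e τ p))
    linarith

end Chart

end ExtensionEquation

section ExtensionDerivatives

variable {d : ℕ}

namespace Chart

variable {κ T L c Mv Mr N M ε a t₀ t₁ P ρ s₀ : ℝ} {r : ℝ → (𝔼 d) → ℝ}
  {v : ℝ → (𝔼 d) → 𝔼 d} {e x₀ : 𝔼 d} {p q : ℝ × 𝔼 d}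

/-- The rate, relative to the hitting distance, at which `r` changes along the extended flow. -/
noncomputable def driftR (d : ℕ) (κ L Mv a ε : ℝ) : ℝ :=
  4 * L * (2 * L * Mv / (a - ε)) + 3 * (κ * (d * Mv)) * (a + ε) + 2 * L * Mv

lemma eventually_abs_rp_push_sub_le (Ch : Chart T N M ε a e r v t₀ t₁ x₀ P ρ s₀)
    (H : Sol κ T L c Mv Mr r v) (hp : p ∈ cyl t₀ t₁ x₀ ρ) (hp0 : t₀ < p.1)
    (hr : ¬ 0 < r p.1 p.2) (hσ : 0 < hit r e s₀ p) {k : ℝ} (hk : k ∈ Icc (1:ℝ) 4) {η : ℝ}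
    (hη : 0 < η) :
    ∀ᶠ h : ℝ in 𝓝[>] 0, |rp r (push e (k * hit r e s₀ (p + h • ((1:ℝ), extV r v e s₀ p)))
        (p + h • ((1:ℝ), extV r v e s₀ p))) - rp r (push e (k * hit r e s₀ p) p)| ≤
      (driftR d κ L Mv a ε * hit r e s₀ p + η) * h := by
  have hL := H.L_nonneg
  have hk4 : k ∈ Icc (0:ℝ) 4 := ⟨by linarith [hk.1], hk.2⟩
  obtain ⟨η', hη', hηη⟩ : ∃ η' > 0, (4 * L + 1) * η' = η :=
    ⟨η / (4 * L + 1), by positivity, by field_simp⟩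
  have hA := Ch.eventually_abs_hit_sub_le H hp hp0 hr hσ hη'
  have hb := (Ch.rp_push_mul_bounds H hp hr hk).2
  have hvV := Ch.norm_v_push_sub_extV_le H hp hk
  set V := extV r v e s₀ p with hV
  set σ := hit r e s₀ p with hσ'
  have hpush := Ch.push_mem hp (Ch.hit_mul_mem hp hk4)
  obtain ⟨δ, hδ, htr⟩ := Ch.bx.transport H hpush hp0 V hη'
  have htd := tendsto_add_smul p ((1:ℝ), V)
  have h1 := htd.eventually (cyl_mem_nhds hp hp0)
  have hc : Continuous (push e (k * σ)) := by unfold push; fun_prop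
  have h4 := htd.eventually (hc.continuousAt.eventually (ball_mem_nhds (push e (k * σ) p) hδ))
  filter_upwards [hA, h1, h4, self_mem_nhdsWithin] with h hA h1 h4 (hpos : 0 < h)
  set q := p + h • ((1:ℝ), V) with hq
  have g1 := Ch.abs_rp_push_sub_le H h1 h1 (Ch.hit_mul_mem hp hk4) (Ch.hit_mul_mem h1 hk4)
  rw [sub_self, sub_self, norm_zero, abs_zero, mul_zero, mul_zero, zero_add, add_zero, ← mul_sub,
    abs_mul, abs_of_nonneg hk4.1] at g1
  have g2 := htr (push e (k * σ) p) (mem_ball_self hδ) h (by rw [← push_add]; exact h4)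
  rw [← push_add, ← hq, abs_of_pos hpos] at g2
  have b1 : κ * (d * Mv) * rp r (push e (k * σ) p) ≤ 3 * (κ * (d * Mv)) * (a + ε) * σ := by
    have hc : 0 ≤ κ * (d * Mv) :=
      mul_nonneg H.κ_pos.le (mul_nonneg (Nat.cast_nonneg _) H.Mv_nonneg)
    have ha : 0 ≤ (a + ε) * σ := mul_nonneg (by linarith [Ch.slope_pos.2, Ch.ε_pos]) hσ.le
    have := mul_le_mul_of_nonneg_left (hb.trans
      (show (a + ε) * ((k - 1) * σ) ≤ 3 * ((a + ε) * σ) by nlinarith [hk.2])) hc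
    linarith
  have b2 : L * ‖v (push e (k * σ) p).1 (push e (k * σ) p).2 - V‖ ≤ 2 * L * Mv * σ := by
    have := mul_le_mul_of_nonneg_left hvV hL
    simp only [push]
    linarith
  have b3 : L * (k * |hit r e s₀ q - σ|) ≤
      4 * L * ((2 * L * Mv / (a - ε) * σ + η') * h) := by
    have := mul_le_mul hk.2 hA (abs_nonneg _) (by norm_num)
    have := mul_le_mul_of_nonneg_left this hL
    linarith
  have b4 := mul_le_mul_of_nonneg_right (add_le_add (add_le_add b1 b2) le_rfl : _ + η' ≤ _ + η')
    hpos.le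
  refine (abs_sub_le _ (rp r (push e (k * σ) q)) _).trans ((add_le_add g1 g2).trans ?_)
  have : (driftR d κ L Mv a ε * σ + η) * h = 4 * L * ((2 * L * Mv / (a - ε) * σ + η') * h) +
      (3 * (κ * (d * Mv)) * (a + ε) * σ + 2 * L * Mv * σ + η') * h := by
    rw [← hηη, driftR]; ring
  linarith

lemma abs_fderiv_extR_le (Ch : Chart T N M ε a e r v t₀ t₁ x₀ P ρ s₀)
    (H : Sol κ T L c Mv Mr r v) (hp : p ∈ cyl t₀ t₁ x₀ ρ) (hp0 : t₀ < p.1)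
    (hr : ¬ 0 < r p.1 p.2) (hσ : 0 < hit r e s₀ p)
    (hd : DifferentiableAt ℝ (extR r e s₀) p) :
    |fderiv ℝ (extR r e s₀) p (1, extV r v e s₀ p)| ≤
      3 * driftR d κ L Mv a ε * hit r e s₀ p := by
  have := norm_fderiv_apply_sub_le (w := ((1:ℝ), extV r v e s₀ p)) (G := (0:ℝ))
    (C := 3 * driftR d κ L Mv a ε * hit r e s₀ p) hd fun η hη => ?_
  · simpa using this
  filter_upwards [Ch.eventually_abs_rp_push_sub_le H hp hp0 hr hσ (k := 2)
    ⟨by norm_num, by norm_num⟩ (show 0 < η / 3 by positivity),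
    Ch.eventually_abs_rp_push_sub_le H hp hp0 hr hσ (k := 4)
    ⟨by norm_num, by norm_num⟩ (show 0 < η / 3 by positivity)] with h h2 h4
  rw [smul_zero, sub_zero, Real.norm_eq_abs]
  have h2 := abs_le.1 h2
  have h4 := abs_le.1 h4
  rw [abs_le]
  unfold extR at *
  constructor <;> linarith [h2.1, h2.2, h4.1, h4.2]

/-- The oscillation of `∇ r`, relative to the root of the hitting distance, along the chart. -/
noncomputable def oscR (Mr a ε : ℝ) : ℝ := Mr * (2 * √(4 * (a + ε)) + √3)

/-- A first order expansion of `r` near the translates of `p`. -/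
lemma exists_abs_push_sub_le (Ch : Chart T N M ε a e r v t₀ t₁ x₀ P ρ s₀)
    (H : Sol κ T L c Mv Mr r v) (hp : p ∈ cyl t₀ t₁ x₀ ρ)
    (hr : ¬ 0 < r p.1 p.2) (hσ : 0 < hit r e s₀ p) {k : ℝ} (hk : k ∈ Icc (2:ℝ) 4) :
    ∃ δ > 0, ∀ ξ : 𝔼 d, ‖ξ‖ < δ →
      |rp r (push e (k * hit r e s₀ p) p + (0, ξ)) - rp r (push e (k * hit r e s₀ p) p) -
        @inner ℝ _ _ (gradient (r p.1) (push e (2 * hit r e s₀ p) p).2) ξ| ≤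
      oscR Mr a ε * √(hit r e s₀ p) * ‖ξ‖ := by
  have hg := Ch.slope_pos.2
  have hε := Ch.ε_pos
  have hk1 : k ∈ Icc (1:ℝ) 4 := ⟨by linarith [hk.1], hk.2⟩
  set σ := hit r e s₀ p with hσ'
  set y := (push e (k * σ) p).2 with hy
  set y₁ := (push e (2 * σ) p).2 with hy₁
  have ht := Ch.bx.mem_time (Ch.push_mem hp (s := 0) ⟨le_rfl, by linarith [Ch.s₀_pos]⟩)
  change p.1 ∈ Icc (0:ℝ) T at ht
  have hpos : ∀ k ∈ Icc (2:ℝ) 4, 0 < r p.1 (push e (k * σ) p).2 := fun k hk =>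
    Ch.pos_of_hit_lt H hp (by nlinarith [hk.1])
      (Ch.hit_mul_mem hp ⟨by linarith [hk.1], hk.2⟩).2
  have hy0 := hpos k hk
  have hy₁0 := hpos 2 ⟨le_rfl, by norm_num⟩
  have hb := (Ch.rp_push_mul_bounds H hp hr hk1).2
  have hb₁ := (Ch.rp_push_mul_bounds H hp hr (k := 2) ⟨by norm_num, by norm_num⟩).2
  rw [rp_of_pos (p := push e (k * σ) p) hy0] at hb ⊢
  rw [rp_of_pos (p := push e (2 * σ) p) hy₁0] at hb₁
  have hlt : r p.1 y < 4 * (a + ε) * σ := by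
    have h1 : (a + ε) * ((k - 1) * σ) < (a + ε) * (4 * σ) := by
      have : 0 < a + ε := by linarith
      gcongr
      linarith [hk.2]
    refine lt_of_le_of_lt hb (h1.trans_le (by linarith))
  have hlt₁ : r p.1 y₁ ≤ 4 * (a + ε) * σ := by
    refine le_trans hb₁ ?_
    have : 0 < (a + ε) * σ := mul_pos (by linarith) hσ
    linarith
  have hdist : ‖y - y₁‖ < 3 * σ := by
    have : y - y₁ = ((k - 2) * σ) • e := by
      simp only [hy, hy₁, push, add_sub_add_left_eq_sub, ← sub_smul]
      ring_nf
    rw [this, norm_smul, Ch.norm_e, mul_one, Real.norm_of_nonneg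
      (mul_nonneg (by linarith [hk.1]) hσ.le)]
    nlinarith [hk.2]
  have hcr : Continuous (r p.1) := H.continuous_slice p.1
  have hev : ∀ᶠ z in 𝓝 y, 0 < r p.1 z ∧ r p.1 z < 4 * (a + ε) * σ ∧ ‖z - y₁‖ < 3 * σ :=
    (hcr.continuousAt.eventually (lt_mem_nhds hy0)).and
      ((hcr.continuousAt.eventually (gt_mem_nhds hlt)).and
      ((show Continuous fun z : 𝔼 d => ‖z - y₁‖ by fun_prop).continuousAt.eventually
        (gt_mem_nhds hdist)))
  obtain ⟨δ, hδ, hball⟩ := Metric.eventually_nhds_iff_ball.1 hev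
  refine ⟨δ, hδ, fun ξ hξ => ?_⟩
  have hyξ : y + ξ ∈ ball y δ := by simpa [dist_eq_norm] using hξ
  have h := H.abs_sub_sub_inner_le ht isOpen_ball (A := ball y δ)
    (G := gradient (r p.1) y₁) (ε := oscR Mr a ε * √σ) (fun z hz hrz => ?_) (y := y) (ξ := ξ)
    (fun z hz => ?_)
  · have e1 : push e (k * σ) p + (0, ξ) = (p.1, y + ξ) := by
      ext1
      · simp [push]
      · rfl
    rw [e1, rp_of_pos (p := (p.1, y + ξ)) (hball _ hyξ).1]
    exact h
  · obtain ⟨-, h2, h3⟩ := hball z hz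
    refine (H.gradr p.1 ht z hrz y₁ hy₁0).trans ?_
    unfold oscR
    rw [mul_assoc]
    refine mul_le_mul_of_nonneg_left ?_ H.Mr_nonneg
    have g1 := Real.sqrt_le_sqrt h2.le
    have g2 := Real.sqrt_le_sqrt hlt₁
    have g3 := Real.sqrt_le_sqrt h3.le
    rw [Real.sqrt_mul (by linarith)] at g1 g2
    rw [Real.sqrt_mul (by norm_num)] at g3
    linarith
  · have hz' : z ∈ ball y δ := (convex_ball y δ).segment_subset (mem_ball_self hδ) hyξ hz
    exact ⟨hz', (hball z hz').1⟩

lemma abs_fderiv_extR_space_sub_le (Ch : Chart T N M ε a e r v t₀ t₁ x₀ P ρ s₀)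
    (H : Sol κ T L c Mv Mr r v) (hp : p ∈ cyl t₀ t₁ x₀ ρ) (hp0 : t₀ < p.1)
    (hr : ¬ 0 < r p.1 p.2) (hσ : 0 < hit r e s₀ p)
    (hd : DifferentiableAt ℝ (extR r e s₀) p) (ζ : 𝔼 d) :
    |fderiv ℝ (extR r e s₀) p (0, ζ) -
        @inner ℝ _ _ (gradient (r p.1) (push e (2 * hit r e s₀ p) p).2) ζ| ≤
      3 * (oscR Mr a ε * √(hit r e s₀ p)) *
        ((1 + 4 * hitK L (rateR d κ L Mv N M) a ε) * ‖ζ‖) := by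
  set kk := hitK L (rateR d κ L Mv N M) a ε with hkk
  have hk0 : 0 ≤ kk := Ch.hitK_nonneg H
  set G := gradient (r p.1) (push e (2 * hit r e s₀ p) p).2 with hG
  obtain ⟨δ₂, hδ₂, h₂⟩ := Ch.exists_abs_push_sub_le H hp hr hσ (k := 2) ⟨le_rfl, by norm_num⟩
  obtain ⟨δ₄, hδ₄, h₄⟩ := Ch.exists_abs_push_sub_le H hp hr hσ (k := 4) ⟨by norm_num, le_rfl⟩
  rw [← hG] at h₂ h₄
  set σ := hit r e s₀ p with hσ'
  set C := oscR Mr a ε * √σ with hC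
  have hC0 : 0 ≤ C := by
    rw [hC, oscR]
    have := H.Mr_nonneg
    positivity
  refine norm_fderiv_apply_sub_le (w := ((0:ℝ), ζ)) (G := @inner ℝ _ _ G ζ) hd fun η hη => ?_
  have htd := tendsto_add_smul p ((0:ℝ), ζ)
  have h1 := htd.eventually (cyl_mem_nhds hp hp0)
  have ev : ∀ᶠ h : ℝ in 𝓝[>] 0, h * ((1 + 4 * kk) * ‖ζ‖) < min δ₂ δ₄ := by
    have : Continuous fun h : ℝ => h * ((1 + 4 * kk) * ‖ζ‖) := by fun_prop
    exact (this.tendsto 0).mono_left nhdsWithin_le_nhds |>.eventually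
      (gt_mem_nhds (by simpa using ⟨hδ₂, hδ₄⟩))
  filter_upwards [h1, ev, self_mem_nhdsWithin] with h h1 h2 (hpos : 0 < h)
  set q := p + h • ((0:ℝ), ζ) with hq
  have hqp : ‖q - p‖ = h * ‖ζ‖ := by
    rw [hq, add_sub_cancel_left, norm_smul, Prod.norm_mk, norm_zero,
      max_eq_right (norm_nonneg _), Real.norm_of_nonneg hpos.le]
  have hστ := Ch.norm_hit_sub_le H hp h1
  rw [← hkk, hqp, ← hσ'] at hστ
  set τ := hit r e s₀ q with hτ
  have hξ : ∀ k ∈ Icc (0:ℝ) 4, ‖h • ζ + (k * (τ - σ)) • e‖ ≤ h * ((1 + 4 * kk) * ‖ζ‖) := by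
    intro k hk
    refine (norm_add_le _ _).trans ?_
    rw [norm_smul, norm_smul, Ch.norm_e, Real.norm_of_nonneg hpos.le, Real.norm_eq_abs, abs_mul,
      abs_of_nonneg hk.1]
    have := mul_le_mul hk.2 hστ (abs_nonneg _) (by norm_num)
    linarith
  have hpq : ∀ k : ℝ, push e (k * τ) q = push e (k * σ) p + (0, h • ζ + (k * (τ - σ)) • e) := by
    intro k
    ext1
    · simp [push, hq]
    · simp only [push, hq, Prod.snd_add, Prod.smul_snd, mul_sub, sub_smul]
      abel
  have hξ2 := hξ 2 ⟨by norm_num, by norm_num⟩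
  have hξ4 := hξ 4 ⟨by norm_num, by norm_num⟩
  have g2 := (h₂ _ (hξ2.trans_lt (h2.trans_le (min_le_left _ _)))).trans
    (mul_le_mul_of_nonneg_left hξ2 hC0)
  have g4 := (h₄ _ (hξ4.trans_lt (h2.trans_le (min_le_right _ _)))).trans
    (mul_le_mul_of_nonneg_left hξ4 hC0)
  rw [← hpq, inner_add_right, inner_smul_right, inner_smul_right, abs_le] at g2 g4
  have hηh := mul_pos hη hpos
  rw [Real.norm_eq_abs, abs_le, smul_eq_mul]
  unfold extR
  rw [← hσ', ← hτ]
  constructor <;> linarith [g2.1, g2.2, g4.1, g4.2]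

lemma norm_fderiv_extV_add_le (Ch : Chart T N M ε a e r v t₀ t₁ x₀ P ρ s₀)
    (H : Sol κ T L c Mv Mr r v) (hp : p ∈ cyl t₀ t₁ x₀ ρ) (hp0 : t₀ < p.1)
    (hr : ¬ 0 < r p.1 p.2) (hσ : 0 < hit r e s₀ p)
    (hd : DifferentiableAt ℝ (extV r v e s₀) p) :
    ‖fderiv ℝ (extV r v e s₀) p (1, extV r v e s₀ p) +
        gradient (r p.1) (push e (2 * hit r e s₀ p) p).2‖ ≤
      2 * Mv * (2 * L * Mv / (a - ε) * hit r e s₀ p) +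
        (8 * Mr + 1) * √((a + ε) * hit r e s₀ p) := by
  have hMv := H.Mv_nonneg
  set G := gradient (r p.1) (push e (2 * hit r e s₀ p) p).2 with hG
  have hy0 : 0 < r p.1 (push e (2 * hit r e s₀ p) p).2 :=
    Ch.pos_of_hit_lt H hp (by linarith) (Ch.hit_mul_mem hp ⟨by norm_num, by norm_num⟩).2
  have hpush := Ch.push_mem hp (Ch.hit_mul_mem hp (k := 2) ⟨by norm_num, by norm_num⟩)
  have hω := Ch.bx.eventually_gradient_le H hpush hp0 hy0
  have hb := (Ch.rp_push_mul_bounds H hp hr (k := 2) ⟨by norm_num, by norm_num⟩).2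
  rw [rp_of_pos (p := push e (2 * hit r e s₀ p) p) hy0,
    show (2 - 1 : ℝ) * hit r e s₀ p = hit r e s₀ p by ring] at hb
  have hω' : ∀ᶠ q in 𝓝 (push e (2 * hit r e s₀ p) p), ‖gradient (r q.1) q.2 - G‖ ≤
      (8 * Mr + 1) * √((a + ε) * hit r e s₀ p) := by
    filter_upwards [hω] with q hq
    exact hq.trans (mul_le_mul_of_nonneg_left (Real.sqrt_le_sqrt hb)
      (by linarith [H.Mr_nonneg]))
  rw [← sub_neg_eq_add]
  refine norm_fderiv_apply_sub_le (w := ((1:ℝ), extV r v e s₀ p)) (G := -G) hd fun η hη => ?_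
  obtain ⟨η', hη', hηη⟩ : ∃ η' > 0, (2 * Mv + 1) * η' = η :=
    ⟨η / (2 * Mv + 1), by positivity, by field_simp⟩
  have hA := Ch.eventually_abs_hit_sub_le H hp hp0 hr hσ hη'
  obtain ⟨δ, hδ, hvt⟩ := Ch.bx.velocity_transport H hpush hp0 hy0 hω' hη'
  set σ := hit r e s₀ p with hσ'
  have hV : v (push e (2 * σ) p).1 (push e (2 * σ) p).2 = extV r v e s₀ p := rfl
  rw [hV] at hvt
  set V := extV r v e s₀ p with hVV
  have htd := tendsto_add_smul p ((1:ℝ), V)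
  have h1 := htd.eventually (cyl_mem_nhds hp hp0)
  have hc : Continuous (push e (2 * σ)) := by unfold push; fun_prop
  have h4 := htd.eventually (hc.continuousAt.eventually (ball_mem_nhds (push e (2 * σ) p) hδ))
  have h5 := htd.eventually ((Ch.continuousAt_hit H hp hp0).eventually
    (gt_mem_nhds (show σ < 2 * σ by linarith)))
  have h6 := htd.eventually ((Ch.continuousAt_hit H hp hp0).eventually
    (lt_mem_nhds hσ))
  filter_upwards [hA, h1, h4, h5, h6, self_mem_nhdsWithin] with h hA h1 h4 h5 h6 (hpos : 0 < h)
  set q := p + h • ((1:ℝ), V) with hq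
  set τ := hit r e s₀ q with hτ
  have g2 := hvt (push e (2 * σ) p) (mem_ball_self hδ) h (by rw [← push_add]; exact h4)
  rw [← push_add, ← hq, hV, abs_of_pos hpos] at g2
  have hs2 := (Ch.hit_mul_mem h1 (k := 2) ⟨by norm_num, by norm_num⟩).2
  have hs2' := (Ch.hit_mul_mem hp (k := 2) ⟨by norm_num, by norm_num⟩).2
  rw [← hτ] at hs2
  rw [← hσ'] at hs2'
  have g1 : ‖extV r v e s₀ q - v (push e (2 * σ) q).1 (push e (2 * σ) q).2‖ ≤
      2 * Mv * |τ - σ| := by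
    rw [extV, ← hτ]
    simp only [push]
    rcases le_total τ σ with hle | hle
    · rw [norm_sub_rev, abs_of_nonpos (by linarith)]
      refine (Ch.norm_v_push_sub_le H h1 (s := 2 * τ) (s' := 2 * σ) (by linarith) (by linarith)
        hs2').trans (le_of_eq (by ring))
    · rw [abs_of_nonneg (by linarith)]
      refine (Ch.norm_v_push_sub_le H h1 (s := 2 * σ) (s' := 2 * τ) h5.le (by linarith)
        hs2).trans (le_of_eq (by ring))
  have g3 := mul_le_mul_of_nonneg_left hA (show 0 ≤ 2 * Mv by positivity)
  have e1 : extV r v e s₀ q - V - h • -G =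
      (extV r v e s₀ q - v (push e (2 * σ) q).1 (push e (2 * σ) q).2) +
      (v (push e (2 * σ) q).1 (push e (2 * σ) q).2 - V + h • G) := by
    rw [smul_neg]; abel
  rw [e1]
  refine (norm_add_le _ _).trans ((add_le_add (g1.trans g3) g2).trans (le_of_eq ?_))
  rw [← hηη]
  ring

end Chart

end ExtensionDerivatives

section ComparisonStates

variable {d : ℕ}

lemma sdiv_congr {F G : ℝ × (𝔼 d) → 𝔼 d} {p : ℝ × 𝔼 d} (h : F =ᶠ[𝓝 p] G) :
    sdiv F p = sdiv G p := by
  unfold sdiv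
  rw [h.fderiv_eq]

/-- A Lipschitz state solving the system up to errors that vanish in the gas. -/
structure Comparison (κ M N B K t₀ t₁ : ℝ) (x₀ : 𝔼 d) (ρ : ℝ) (R : ℝ × (𝔼 d) → ℝ)
    (V : ℝ × (𝔼 d) → 𝔼 d) : Prop where
  B_nonneg : 0 ≤ B
  K_nonneg : 0 ≤ K
  R_le : ∀ p ∈ cyl t₀ t₁ x₀ ρ, |R p| ≤ M
  V_le : ∀ p ∈ cyl t₀ t₁ x₀ ρ, ‖V p‖ ≤ N
  lip_R : PtLip K R (cyl t₀ t₁ x₀ ρ)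
  lip_V : PtLip K V (cyl t₀ t₁ x₀ ρ)
  eq_R : ∀ᵐ p : ℝ × 𝔼 d, p ∈ cyl t₀ t₁ x₀ ρ → t₀ < p.1 →
    (∀ ζ, |@inner ℝ _ _ (fderiv ℝ V p (1, V p)) ζ + fderiv ℝ R p (0, ζ)| ≤
      B * √(max (-(R p)) 0) * ‖ζ‖) ∧
    |fderiv ℝ R p (1, V p) + κ * R p * sdiv V p| ≤ B * max (-(R p)) 0

variable {κ T L c Mv Mr N M ε a t₀ t₁ P ρ s₀ : ℝ} {r : ℝ → (𝔼 d) → ℝ}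
  {v : ℝ → (𝔼 d) → 𝔼 d} {e x₀ : 𝔼 d} {p q : ℝ × 𝔼 d}

lemma Box.mono_M (Bx : Box T N M r v t₀ t₁ x₀ ρ) {M' : ℝ} (h : M ≤ M') :
    Box T N M' r v t₀ t₁ x₀ ρ :=
  ⟨Bx.t₀_nonneg, Bx.t₁_le, Bx.N_pos, Bx.M_pos.trans_le h, Bx.v_le,
    fun p hp => (Bx.r_le p hp).trans h⟩

/-- A solution and a comparison state can be compared. -/
lemma Comparison.core {B K : ℝ} {R : ℝ × (𝔼 d) → ℝ} {V : ℝ × (𝔼 d) → 𝔼 d}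
    (C : Comparison κ M N B K t₀ t₁ x₀ ρ R V) (Bx : Box T N M r v t₀ t₁ x₀ ρ)
    (H : Sol κ T L c Mv Mr r v) : Core κ M N B
      (max K (max (L + rateR d κ L Mv N M) (Mv + (Mv * N + L)))) t₀ t₁ x₀ ρ (rp r) R
      (fun q => v q.1 q.2) V where
  N_nonneg := Bx.N_pos.le
  M_pos := Bx.M_pos
  B_nonneg := C.B_nonneg
  K_nonneg := C.K_nonneg.trans (le_max_left _ _)
  m_nonneg p _ := rp_nonneg r p
  m_le p hp := max_le ((le_abs_self _).trans (Bx.r_le p hp)) Bx.M_pos.le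
  R_le := C.R_le
  u_le p hp _ := Bx.v_le p hp
  V_le := C.V_le
  lip_m := (Bx.ptLip_rp H).mono_const ((le_max_left _ _).trans (le_max_right _ _))
  lip_R := C.lip_R.mono_const (le_max_left _ _)
  lip_V := C.lip_V.mono_const (le_max_left _ _)
  lip_u := by
    have h := (Bx.ptLip_v H).mono_const
      ((le_max_right (L + rateR d κ L Mv N M) _).trans (le_max_right K _))
    have hs : {p | 0 < rp r p} = {p : ℝ × 𝔼 d | 0 < r p.1 p.2} := by
      ext p; exact rp_pos_iff
    rwa [hs]
  eq_m := Bx.eq_m H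
  eq_R := C.eq_R

/-- Inside the gas the solution is its own comparison state. -/
lemma Box.comparison (Bx : Box T N M r v t₀ t₁ x₀ ρ) (H : Sol κ T L c Mv Mr r v)
    (hpos : ∀ p ∈ cyl t₀ t₁ x₀ ρ, 0 < r p.1 p.2) :
    Comparison κ M N 0 (max (L + rateR d κ L Mv N M) (Mv + (Mv * N + L))) t₀ t₁ x₀ ρ (rp r)
      (fun q => v q.1 q.2) where
  B_nonneg := le_rfl
  K_nonneg := le_max_of_le_left (add_nonneg H.L_nonneg (H.rateR_nonneg Bx.N_pos.le Bx.M_pos.le))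
  R_le p hp := by
    rw [abs_of_nonneg (rp_nonneg r p)]
    exact max_le ((le_abs_self _).trans (Bx.r_le p hp)) Bx.M_pos.le
  V_le p hp := Bx.v_le p hp
  lip_R := (Bx.ptLip_rp H).mono_const (le_max_left _ _)
  lip_V := ((Bx.ptLip_v H).mono fun p hp => ⟨hp, hpos p hp⟩).mono_const (le_max_right _ _)
  eq_R := by
    filter_upwards [Bx.eq_m H] with p h hp hp0
    obtain ⟨-, h1, h2⟩ := h hp hp0 (rp_pos_iff.2 (hpos p hp))
    refine ⟨fun ζ => ?_, ?_⟩
    · rw [h1]; simp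
    · rw [h2]; simp

/-- The vacuum as a comparison state. -/
lemma comparison_vacuum (hM : 1 ≤ M) (hN : 0 ≤ N) :
    Comparison κ M N 0 0 t₀ t₁ x₀ ρ (fun _ => -1) (fun _ => 0) where
  B_nonneg := le_rfl
  K_nonneg := le_rfl
  R_le p _ := by simpa using hM
  V_le p _ := by simpa using hN
  lip_R p _ := by simp
  lip_V p _ := by simp
  eq_R := by
    filter_upwards with p _ _
    simp [sdiv]

namespace Chart

/-- Almost every vacuum point is at positive distance from the gas. -/
lemma hit_pos_of_differentiableAt (Ch : Chart T N M ε a e r v t₀ t₁ x₀ P ρ s₀)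
    (H : Sol κ T L c Mv Mr r v) (hp : p ∈ cyl t₀ t₁ x₀ ρ) (hr : ¬ 0 < r p.1 p.2)
    (hd : DifferentiableAt ℝ (rp r) p) : 0 < hit r e s₀ p := by
  refine (hit_nonneg r e s₀ p).lt_of_ne fun h0 => ?_
  have hg := Ch.slope_pos.2
  have h1 : HasDerivAt (fun t : ℝ => rp r (p + t • ((0:ℝ), e))) (fderiv ℝ (rp r) p (0, e)) 0 :=
    hd.hasFDerivAt.hasLineDerivAt ((0:ℝ), e)
  rw [Sol.fderiv_rp_eq_zero hr, _root_.zero_apply] at h1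
  have hsub : Ioi (0:ℝ) ⊆ {0}ᶜ := fun x hx => (mem_Ioi.1 hx).ne'
  have h2 := (hasDerivAt_iff_tendsto_slope_zero.1 h1).mono_left (nhdsWithin_mono 0 hsub)
  simp only [zero_add, zero_smul, add_zero] at h2
  refine absurd (ge_of_tendsto (b := a - ε) h2 ?_) (not_le.2 hg)
  have hs : (0:ℝ) < 4 * s₀ := by linarith [Ch.s₀_pos]
  filter_upwards [Ioo_mem_nhdsGT hs] with s hs
  have h3 := Ch.slope_ge H hp (s := s) (by rw [← h0]; exact hs.1.le) hs.2.le
  have h4 : rp r p = 0 := max_eq_right (not_lt.1 hr)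
  have h5 : p + s • ((0:ℝ), e) = push e s p := by
    ext1 <;> simp [push]
  rw [h4, h5, sub_zero, smul_eq_mul, le_inv_mul_iff₀ hs.1]
  rw [← h0] at h3
  linarith

/-- The error constant of the extended state. -/
noncomputable def errB (d : ℕ) (κ L Mv Mr N M a ε s₀ : ℝ) (K : ℝ) : ℝ :=
  (2 * Mv * (2 * L * Mv / (a - ε) * √s₀) + (8 * Mr + 1) * √(a + ε) +
    3 * oscR Mr a ε * (1 + 4 * hitK L (rateR d κ L Mv N M) a ε)) / √(a - 3 * ε) +
  (3 * driftR d κ L Mv a ε + κ * (3 * (a + ε)) * (d * K)) / (a - 3 * ε)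

lemma extR_eventuallyEq (Ch : Chart T N M ε a e r v t₀ t₁ x₀ P ρ s₀)
    (H : Sol κ T L c Mv Mr r v) (hr : 0 < r p.1 p.2) :
    extR r e s₀ =ᶠ[𝓝 p] rp r ∧ extV r v e s₀ =ᶠ[𝓝 p] fun q => v q.1 q.2 := by
  have hev : ∀ᶠ q in 𝓝 p, 0 < r q.1 q.2 := H.rcont.continuousAt.eventually (lt_mem_nhds hr)
  constructor
  · filter_upwards [hev] with q hq
    rw [Ch.extR_of_pos hq, rp_of_pos hq]
  · filter_upwards [hev] with q hq using Ch.extV_of_pos hq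

/-- The extended state is a comparison state. -/
lemma exists_comparison (Ch : Chart T N M ε a e r v t₀ t₁ x₀ P ρ s₀)
    (H : Sol κ T L c Mv Mr r v) :
    ∃ B K, Comparison κ (3 * M) N B K t₀ t₁ x₀ ρ (extR r e s₀) (extV r v e s₀) := by
  have hg := Ch.slope_pos.2
  have hε := Ch.ε_pos
  have hag := Ch.a_ge
  have h3 : 0 < a - 3 * ε := by linarith
  have hL := H.L_nonneg
  have hMv := H.Mv_nonneg
  have hMr := H.Mr_nonneg
  have hκ := H.κ_pos
  have hN := Ch.bx.N_pos
  have hkk := Ch.hitK_nonneg H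
  set kk := hitK L (rateR d κ L Mv N M) a ε with hkkd
  have hrt : 0 ≤ rateR d κ L Mv N M := H.rateR_nonneg Ch.bx.N_pos.le Ch.bx.M_pos.le
  obtain ⟨K, hKR, hKV⟩ : ∃ K, 3 * (L + rateR d κ L Mv N M) + 8 * L * kk ≤ K ∧
      2 * Mv * (3 * kk + 1) + (Mv + (Mv * N + L)) ≤ K := ⟨_, le_max_left _ _, le_max_right _ _⟩
  have hK0 : 0 ≤ K := le_trans (by positivity) hKR
  have lipR : PtLip K (extR r e s₀) (cyl t₀ t₁ x₀ ρ) := fun p hp => by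
    filter_upwards [self_mem_nhdsWithin] with q hq
    exact (Ch.abs_extR_sub_le H hp hq).trans (mul_le_mul_of_nonneg_right hKR (norm_nonneg _))
  have lipV : PtLip K (extV r v e s₀) (cyl t₀ t₁ x₀ ρ) := (Ch.ptLip_extV H).mono_const hKV
  have hdr : 0 ≤ driftR d κ L Mv a ε := by
    have : 0 ≤ a + ε := by linarith
    unfold driftR
    positivity
  have hosc : 0 ≤ oscR Mr a ε := by
    unfold oscR
    positivity
  set B₁ := 2 * Mv * (2 * L * Mv / (a - ε) * √s₀) + (8 * Mr + 1) * √(a + ε) +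
    3 * oscR Mr a ε * (1 + 4 * kk) with hB₁
  set B₂ := 3 * driftR d κ L Mv a ε + κ * (3 * (a + ε)) * (d * K) with hB₂
  have hB₁0 : 0 ≤ B₁ := by positivity
  have hB₂0 : 0 ≤ B₂ := by
    have : 0 ≤ a + ε := by linarith
    positivity
  have hB : errB d κ L Mv Mr N M a ε s₀ K = B₁ / √(a - 3 * ε) + B₂ / (a - 3 * ε) := rfl
  have hB0 : 0 ≤ errB d κ L Mv Mr N M a ε s₀ K := by rw [hB]; positivity
  refine ⟨errB d κ L Mv Mr N M a ε s₀ K, K, hB0, hK0, fun p hp => Ch.abs_extR_le hp,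
    fun p hp => Ch.norm_extV_le hp, lipR, lipV, ?_⟩
  filter_upwards [Ch.bx.eq_m H, (Ch.bx.ptLip_rp H).ae_differentiableAt,
    lipR.ae_differentiableAt, lipV.ae_differentiableAt] with p g1 g2 g3 g4 hp hp0
  have hpP : p ∈ cyl t₀ t₁ x₀ P := by
    simpa [push] using Ch.push_mem hp (s := 0) ⟨le_rfl, by linarith [Ch.s₀_pos]⟩
  by_cases hr : 0 < r p.1 p.2
  · obtain ⟨eR, eV⟩ := Ch.extR_eventuallyEq H hr
    obtain ⟨-, h1, h2⟩ := g1 hpP hp0 (rp_pos_iff.2 hr)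
    rw [eR.fderiv_eq, eV.fderiv_eq, sdiv_congr eV, eR.eq_of_nhds, eV.eq_of_nhds]
    refine ⟨fun ζ => ?_, ?_⟩
    · rw [h1, abs_zero]
      positivity
    · rw [h2, neg_add_cancel, abs_zero]
      positivity
  · have hσ := Ch.hit_pos_of_differentiableAt H hp hr (g2 hpP hp0)
    have hR := Ch.extR_le H hp hr
    have hσm := Ch.hit_le_max hp
    have dR := g3 hp hp0
    have dV := g4 hp hp0
    have e1 := Ch.abs_fderiv_extR_le H hp hp0 hr hσ dR
    have e2 := Ch.abs_fderiv_extR_space_sub_le H hp hp0 hr hσ dR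
    have e3 := Ch.norm_fderiv_extV_add_le H hp hp0 hr hσ dV
    have e4 : ‖fderiv ℝ (extV r v e s₀) p‖ ≤ K :=
      lipV.norm_fderiv_le hK0 (cyl_mem_nhds hp hp0)
    have e5 := abs_sdiv_le e4
    set σ := hit r e s₀ p with hσd
    have hRm : (a - 3 * ε) * σ ≤ max (-(extR r e s₀ p)) 0 :=
      le_max_of_le_left (by linarith [hR.1])
    refine ⟨fun ζ => ?_, ?_⟩
    · set G := gradient (r p.1) (push e (2 * σ) p).2 with hG
      have hsq : √(a - 3 * ε) * √σ ≤ √(max (-(extR r e s₀ p)) 0) := by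
        rw [← Real.sqrt_mul h3.le]
        exact Real.sqrt_le_sqrt hRm
      have hs0 : σ ≤ √s₀ * √σ := by
        rw [← Real.sqrt_mul Ch.s₀_pos.le]
        exact Real.le_sqrt_of_sq_le (by nlinarith)
      have f1 : B₁ * √σ ≤ errB d κ L Mv Mr N M a ε s₀ K * √(max (-(extR r e s₀ p)) 0) := by
        have : B₁ * √σ = B₁ / √(a - 3 * ε) * (√(a - 3 * ε) * √σ) := by
          have := Real.sqrt_pos.2 h3
          field_simp
        rw [this, hB]
        refine mul_le_mul ?_ hsq (by positivity) (by positivity)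
        have : 0 ≤ B₂ / (a - 3 * ε) := by positivity
        linarith
      refine le_trans ?_ (mul_le_mul_of_nonneg_right f1 (norm_nonneg ζ))
      have f2 : @inner ℝ _ _ (fderiv ℝ (extV r v e s₀) p (1, extV r v e s₀ p)) ζ +
          fderiv ℝ (extR r e s₀) p (0, ζ) =
          @inner ℝ _ _ (fderiv ℝ (extV r v e s₀) p (1, extV r v e s₀ p) + G) ζ +
          (fderiv ℝ (extR r e s₀) p (0, ζ) - @inner ℝ _ _ G ζ) := by
        rw [inner_add_left]; ring
      rw [f2]
      refine (abs_add_le _ _).trans ?_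
      have f3 := (abs_real_inner_le_norm
        (fderiv ℝ (extV r v e s₀) p (1, extV r v e s₀ p) + G) ζ).trans
          (mul_le_mul_of_nonneg_right e3 (norm_nonneg ζ))
      rw [Real.sqrt_mul (by linarith)] at f3
      have f4 : 2 * Mv * (2 * L * Mv / (a - ε) * σ) ≤
          2 * Mv * (2 * L * Mv / (a - ε) * (√s₀ * √σ)) := by gcongr
      have f5 := mul_le_mul_of_nonneg_right f4 (norm_nonneg ζ)
      refine (add_le_add f3 (e2 ζ)).trans ?_
      rw [hB₁]
      linarith
    · have f1 : B₂ * σ ≤ errB d κ L Mv Mr N M a ε s₀ K * max (-(extR r e s₀ p)) 0 := by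
        have : B₂ * σ = B₂ / (a - 3 * ε) * ((a - 3 * ε) * σ) := by field_simp
        rw [this, hB]
        refine mul_le_mul ?_ hRm (by positivity) (by positivity)
        have : 0 ≤ B₁ / √(a - 3 * ε) := by positivity
        linarith
      refine le_trans ((abs_add_le _ _).trans ?_) f1
      have f2 : |κ * extR r e s₀ p * sdiv (extV r v e s₀) p| ≤
          κ * (3 * (a + ε) * σ) * (d * K) := by
        rw [abs_mul, abs_mul, abs_of_pos hκ]
        have h0 := (abs_nonneg _).trans hR.2
        exact mul_le_mul (mul_le_mul_of_nonneg_left hR.2 hκ.le) e5 (abs_nonneg _) (by positivity)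
      refine (add_le_add e1 f2).trans (le_of_eq ?_)
      rw [hB₂]
      ring

end Chart

end ComparisonStates

section LocalAgreement

variable {d : ℕ} {κ T L c Mv Mr N M B K t₀ t₁ ρ : ℝ} {r : ℝ → (𝔼 d) → ℝ}
  {v : ℝ → (𝔼 d) → 𝔼 d} {x₀ : 𝔼 d} {R : ℝ × (𝔼 d) → ℝ} {V : ℝ × (𝔼 d) → 𝔼 d}

lemma Comparison.mono (C : Comparison κ M N B K t₀ t₁ x₀ ρ R V) {t₁' ρ' : ℝ} {x' : 𝔼 d}
    (h1 : t₁' ≤ t₁) (h2 : ball x' ρ' ⊆ ball x₀ ρ) :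
    Comparison κ M N B K t₀ t₁' x' ρ' R V := by
  have hsub : cyl t₀ t₁' x' ρ' ⊆ cyl t₀ t₁ x₀ ρ := prod_mono (Ico_subset_Ico_right h1) h2
  exact ⟨C.B_nonneg, C.K_nonneg, fun p hp => C.R_le p (hsub hp), fun p hp => C.V_le p (hsub hp),
    C.lip_R.mono hsub, C.lip_V.mono hsub, C.eq_R.mono fun p h hp => h (hsub hp)⟩

lemma eventually_mul_time_lt (k : ℝ) {δ : ℝ} (hδ : 0 < δ) (t₀ : ℝ) (x₀ : 𝔼 d) :
    ∀ᶠ p : ℝ × 𝔼 d in 𝓝 (t₀, x₀), k * (p.1 - t₀) < δ := by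
  have hc : Continuous fun p : ℝ × 𝔼 d => k * (p.1 - t₀) := by fun_prop
  exact (hc.tendsto (t₀, x₀)).eventually (gt_mem_nhds (by simpa using hδ))

lemma eventually_dist_lt {δ : ℝ} (hδ : 0 < δ) (t₀ : ℝ) (x₀ : 𝔼 d) :
    ∀ᶠ p : ℝ × 𝔼 d in 𝓝 (t₀, x₀), dist p.2 x₀ < δ := by
  have hc : Continuous fun p : ℝ × 𝔼 d => dist p.2 x₀ := by fun_prop
  exact (hc.tendsto (t₀, x₀)).eventually (gt_mem_nhds (by simpa using hδ))

/-- A solution that agrees with a comparison state on the base of a short cone agrees with it at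
the points inside the cone. -/
lemma Comparison.eventually_agree (C : Comparison κ M N B K t₀ t₁ x₀ ρ R V)
    (Bx : Box T N M r v t₀ t₁ x₀ ρ) (H : Sol κ T L c Mv Mr r v) (h01 : t₀ < t₁) (hρ : 0 < ρ)
    {S : ℝ} (hS0 : 0 ≤ S) (hS : 3 * N + 3 + cEnt (1 / κ) * M / 2 ≤ S) :
    ∀ᶠ p in 𝓝 (t₀, x₀), t₀ < p.1 →
      (∀ y ∈ ball p.2 (2 * S * (p.1 - t₀)), rp r (t₀, y) = max (R (t₀, y)) 0 ∧
        (0 < rp r (t₀, y) → v t₀ y = V (t₀, y))) →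
      rp r p = max (R p) 0 ∧ (0 < rp r p → v p.1 p.2 = V p) := by
  set K' := max K (max (L + rateR d κ L Mv N M) (Mv + (Mv * N + L))) with hK'
  have hSpos : 0 < S := by
    have := cEnt_pos (one_div_pos.2 H.κ_pos)
    have := Bx.N_pos
    have := Bx.M_pos
    have : 0 < 3 * N + 3 + cEnt (1 / κ) * M / 2 := by positivity
    linarith
  filter_upwards [eventually_dist_lt (half_pos hρ) t₀ x₀,
    eventually_mul_time_lt (2 * S) (half_pos hρ) t₀ x₀,
    eventually_mul_time_lt (2 * S) one_pos t₀ x₀,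
    eventually_mul_time_lt ((2 * B + 2 * K' + d * K' * κ) * (2 * S)) one_pos t₀ x₀,
    eventually_mul_time_lt 2 (sub_pos.2 h01) t₀ x₀] with p h1 h2 h3 h4 h5 hp hbase
  have hh : 0 < p.1 - t₀ := sub_pos.2 hp
  have hsub : ball p.2 (ρ / 2) ⊆ ball x₀ ρ := ball_subset_ball' (by linarith)
  have core := (C.mono le_rfl hsub).core (Bx.mono le_rfl hsub) H
  refine core.agree (S := S) (ρ' := 2 * S * (p.1 - t₀)) H.κ_pos (by positivity) h2.le h3.le
    (by linarith) hS (by nlinarith) ?_ hp.le ?_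
  · intro q hq hcone
    have hq' : q = (t₀, q.2) := by rw [← hq]
    have hmem : q.2 ∈ ball p.2 (2 * S * (p.1 - t₀)) := by
      rw [cone, lt_max_iff, hq, sub_self, mul_zero] at hcone
      rw [mem_ball, dist_eq_norm]
      rcases hcone with h | h
      · linarith
      · exact absurd h (lt_irrefl _)
    rw [hq']
    exact hbase q.2 hmem
  · rw [cone, sub_self, norm_zero, lt_max_iff]
    left
    nlinarith

end LocalAgreement

section DomainOfDependence

variable {d : ℕ} {κ T L c Mv Mr N M ε a t₀ t₁ P ρ s₀ : ℝ} {r : ℝ → (𝔼 d) → ℝ}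
  {v : ℝ → (𝔼 d) → 𝔼 d} {e x₀ : 𝔼 d} {p q : ℝ × 𝔼 d}

/-- Near `(t₀, x₀)`, each gas point has gas points at time `t₀` at distance at most `D` per unit
of elapsed time, and at these the size `‖x‖ + ‖v‖` has changed by at most `C` per unit of time. -/
def Controlled (r : ℝ → (𝔼 d) → ℝ) (v : ℝ → (𝔼 d) → 𝔼 d) (t₀ : ℝ) (x₀ : 𝔼 d) (D C : ℝ) : Prop :=
  ∀ᶠ p in 𝓝 (t₀, x₀), t₀ < p.1 → 0 < r p.1 p.2 →
    (∃ y ∈ ball p.2 (D * (p.1 - t₀)), 0 < r t₀ y) ∧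
    ∀ y ∈ ball p.2 (D * (p.1 - t₀)), 0 < r t₀ y →
      1 + ‖y‖ + ‖v t₀ y‖ ≤ 1 + ‖p.2‖ + ‖v p.1 p.2‖ + C * (p.1 - t₀)

/-- The rate of change of `‖x‖ + ‖v‖` over a domain of dependence of speed `D`. -/
noncomputable def rateW (L Mv Cr g D : ℝ) : ℝ :=
  D + 2 * Mv * ((L * D + Cr) / g + 1) + Mv * D + (Mv + L)

lemma size_le {x y w z : 𝔼 d} {δ b : ℝ} (h : y ∈ ball x δ) (hv : ‖z - w‖ ≤ b) :
    1 + ‖y‖ + ‖z‖ ≤ 1 + ‖x‖ + ‖w‖ + (δ + b) := by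
  rw [mem_ball, dist_eq_norm] at h
  have h1 := norm_sub_norm_le y x
  have h2 := norm_sub_norm_le z w
  linarith

lemma Box.controlled (Bx : Box T N M r v t₀ t₁ x₀ ρ) (H : Sol κ T L c Mv Mr r v) (h01 : t₀ < t₁)
    (hρ : 0 < ρ) (hpos : ∀ p ∈ cyl t₀ t₁ x₀ ρ, 0 < r p.1 p.2) {D Cr g ψ : ℝ} (hD : 0 < D)
    (hCr : 0 ≤ Cr) (hg : 0 < g) (hψ : 1 ≤ ψ) (hN : N ≤ ψ) :
    Controlled r v t₀ x₀ (D * ψ) (rateW L Mv Cr g D * ψ) := by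
  filter_upwards [eventually_dist_lt (half_pos hρ) t₀ x₀,
    eventually_mul_time_lt (D * ψ) (half_pos hρ) t₀ x₀,
    eventually_mul_time_lt 1 (sub_pos.2 h01) t₀ x₀] with p h1 h2 h3 hp hr
  have hh : 0 < p.1 - t₀ := sub_pos.2 hp
  have hx : ∀ y ∈ ball p.2 (D * ψ * (p.1 - t₀)), (t₀, y) ∈ cyl t₀ t₁ x₀ ρ := fun y hy =>
    ⟨⟨le_rfl, h01⟩, ball_subset_ball' (by linarith) hy⟩
  have hpm : p ∈ cyl t₀ t₁ x₀ ρ := ⟨⟨hp.le, by linarith⟩, mem_ball.2 (by linarith)⟩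
  have hDψ : 0 < D * ψ := by positivity
  have hMv := H.Mv_nonneg
  have hL := H.L_nonneg
  refine ⟨⟨p.2, mem_ball_self (by positivity), ?_⟩, fun y hy _ => ?_⟩
  · exact hpos _ (hx p.2 (mem_ball_self (by positivity)))
  · have hym := hx y hy
    have hv := Bx.norm_v_sub_le H hpm hym
      (fun z hz => hpos (p.1, z) ⟨hpm.1, (convex_ball x₀ ρ).segment_subset hpm.2 hym.2 hz⟩)
      (fun τ hτ => hpos (τ, y) (mem_of_uIcc hpm hym hτ))
    refine (size_le hy hv).trans (add_le_add_right ?_ _)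
    have hy' : ‖y - p.2‖ ≤ D * ψ * (p.1 - t₀) := by
      rw [← dist_eq_norm]; exact (mem_ball.1 hy).le
    have e1 : |t₀ - p.1| = p.1 - t₀ := by rw [abs_sub_comm, abs_of_pos hh]
    simp only [e1]
    have e2 : Mv * N + L ≤ (Mv + L) * ψ := by nlinarith
    have e3 := mul_le_mul_of_nonneg_left hy' hMv
    have e4 := mul_le_mul_of_nonneg_right e2 hh.le
    have e5 : 0 ≤ 2 * Mv * ((L * D + Cr) / g + 1) * ψ * (p.1 - t₀) := by positivity
    unfold rateW
    linarith

namespace Chart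

lemma norm_v_sub_le_of_pos (Ch : Chart T N M ε a e r v t₀ t₁ x₀ P ρ s₀)
    (H : Sol κ T L c Mv Mr r v) (hp : p ∈ cyl t₀ t₁ x₀ ρ) (hq : q ∈ cyl t₀ t₁ x₀ ρ)
    (hrp : 0 < r p.1 p.2) (hrq : 0 < r q.1 q.2) {s : ℝ}
    (hs : (L * ‖q.2 - p.2‖ + rateR d κ L Mv N M * |q.1 - p.1|) / (a - ε) < s)
    (hs4 : s ≤ 4 * s₀) :
    ‖v q.1 q.2 - v p.1 p.2‖ ≤
      2 * Mv * s + Mv * ‖q.2 - p.2‖ + (Mv * N + L) * |q.1 - p.1| := by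
  have hg := Ch.slope_pos.2
  have hL := H.L_nonneg
  have hrt := H.rateR_nonneg Ch.bx.N_pos.le Ch.bx.M_pos.le
  have hν : 0 ≤ (L * ‖q.2 - p.2‖ + rateR d κ L Mv N M * |q.1 - p.1|) / (a - ε) := by positivity
  have hp0 := Ch.hit_eq_zero hrp
  have hq0 := Ch.hit_eq_zero hrq
  have h1 := Ch.norm_v_push_sub_le H hp (s := 0) (s' := s) hp0.le (by linarith) hs4
  have h2 := Ch.norm_v_push_sub_le H hq (s := 0) (s' := s) hq0.le (by linarith) hs4
  have h3 := Ch.norm_v_push_push_sub_le H hp hq (s := s) (by linarith) (by linarith) hs4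
  rw [zero_smul, add_zero, sub_zero] at h1 h2
  rw [norm_sub_rev] at h2
  have e1 : v q.1 q.2 - v p.1 p.2 = (v q.1 q.2 - v q.1 (q.2 + s • e)) +
      (v q.1 (q.2 + s • e) - v p.1 (p.2 + s • e)) + (v p.1 (p.2 + s • e) - v p.1 p.2) := by abel
  rw [e1]
  refine (norm_add₃_le).trans ?_
  linarith

lemma controlled (Ch : Chart T N M ε a e r v t₀ t₁ x₀ P ρ s₀) (H : Sol κ T L c Mv Mr r v)
    {D Cr g ψ : ℝ} (hg : 0 < g) (hga : g ≤ a - ε) (hψ : 1 ≤ ψ) (hN : N ≤ ψ)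
    (hrt : rateR d κ L Mv N M ≤ Cr * ψ) (hD : Cr / g < D) :
    Controlled r v t₀ x₀ (D * ψ) (rateW L Mv Cr g D * ψ) := by
  have hrt0 := H.rateR_nonneg Ch.bx.N_pos.le Ch.bx.M_pos.le
  have hCr : 0 ≤ Cr := by
    by_contra hc
    nlinarith
  have hD0 : 0 < D := lt_of_le_of_lt (by positivity) hD
  have hDψ : 0 < D * ψ := by positivity
  have hMv := H.Mv_nonneg
  have hL := H.L_nonneg
  set k := (L * D + Cr) / g + 1 with hk
  have hk1 : 1 ≤ k := by
    have : 0 ≤ (L * D + Cr) / g := by positivity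
    linarith
  filter_upwards [eventually_dist_lt (half_pos Ch.ρ_pos) t₀ x₀,
    eventually_mul_time_lt (D * ψ) (half_pos Ch.ρ_pos) t₀ x₀,
    eventually_mul_time_lt 1 (sub_pos.2 Ch.t₀_lt) t₀ x₀,
    eventually_mul_time_lt (k * ψ) Ch.s₀_pos t₀ x₀,
    eventually_mul_time_lt (D * ψ) Ch.s₀_pos t₀ x₀] with p h1 h2 h3 h4 h5 hp hr
  have hs0 := Ch.s₀_pos
  have hh : 0 < p.1 - t₀ := sub_pos.2 hp
  have hx : ∀ y ∈ ball p.2 (D * ψ * (p.1 - t₀)), (t₀, y) ∈ cyl t₀ t₁ x₀ ρ := fun y hy =>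
    ⟨⟨le_rfl, Ch.t₀_lt⟩, ball_subset_ball' (by linarith) hy⟩
  have hpm : p ∈ cyl t₀ t₁ x₀ ρ :=
    ⟨⟨hp.le, by linarith⟩, mem_ball.2 (by linarith [Ch.ρ_pos])⟩
  have hpx := hx p.2 (mem_ball_self (by positivity))
  have e1 : |t₀ - p.1| = p.1 - t₀ := by rw [abs_sub_comm, abs_of_pos hh]
  refine ⟨?_, fun y hy hry => ?_⟩
  · have hit1 := Ch.hit_le_add H hpm hpx
    rw [Ch.hit_eq_zero hr] at hit1
    simp only [sub_self, norm_zero, mul_zero, zero_add, e1] at hit1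
    have hlt : rateR d κ L Mv N M * (p.1 - t₀) / (a - ε) < D * ψ * (p.1 - t₀) := by
      rw [div_lt_iff₀ (hg.trans_le hga)]
      rw [div_lt_iff₀ hg] at hD
      have i1 : Cr * ψ < D * ψ * (a - ε) := by
        have : Cr < D * (a - ε) := hD.trans_le (by gcongr)
        nlinarith
      nlinarith
    obtain ⟨s, hs1, hs2⟩ := exists_between (hit1.trans_lt hlt)
    have hs0' := (hit_nonneg r e s₀ (t₀, p.2)).trans hs1.le
    refine ⟨p.2 + s • e, ?_, Ch.pos_of_hit_lt H hpx hs1 (by linarith)⟩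
    rw [mem_ball, dist_eq_norm, add_sub_cancel_left, norm_smul, Ch.norm_e, mul_one,
      Real.norm_of_nonneg hs0']
    exact hs2
  · have hym := hx y hy
    have hy' : ‖y - p.2‖ < D * ψ * (p.1 - t₀) := by
      rw [← dist_eq_norm]; exact mem_ball.1 hy
    have hv := Ch.norm_v_sub_le_of_pos H hpm hym hr hry (s := k * ψ * (p.1 - t₀)) (by
      simp only [e1]
      rw [div_lt_iff₀ (hg.trans_le hga)]
      have i1 : (L * D + Cr) * (ψ * (p.1 - t₀)) < k * (ψ * (p.1 - t₀)) * (a - ε) := by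
        have i2 : L * D + Cr < k * (a - ε) := by
          have : L * D + Cr = (k - 1) * g := by rw [hk]; field_simp; ring
          nlinarith
        have : 0 < ψ * (p.1 - t₀) := by positivity
        nlinarith
      have i3 := mul_le_mul_of_nonneg_left hy'.le hL
      have i4 := mul_le_mul_of_nonneg_right hrt hh.le
      linarith) (by linarith)
    refine (size_le hy hv).trans (add_le_add_right ?_ _)
    simp only [e1]
    have e2 : Mv * N + L ≤ (Mv + L) * ψ := by nlinarith
    have e3 := mul_le_mul_of_nonneg_left hy'.le hMv
    have e4 := mul_le_mul_of_nonneg_right e2 hh.le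
    unfold rateW
    rw [← hk]
    linarith

end Chart

end DomainOfDependence

section Propagation

variable {d : ℕ} {κ T L c Mv Mr N M t₀ t₁ : ℝ} {r r' : ℝ → (𝔼 d) → ℝ}
  {v v' : ℝ → (𝔼 d) → 𝔼 d} {x₀ : 𝔼 d}

lemma exists_cyl_subset {U : Set (ℝ × 𝔼 d)} (hU : U ∈ 𝓝 (t₀, x₀)) :
    ∃ δ > 0, cyl t₀ (t₀ + δ) x₀ δ ⊆ U := by
  obtain ⟨δ, hδ, hsub⟩ := Metric.mem_nhds_iff.1 hU
  refine ⟨δ, hδ, fun p hp => hsub ?_⟩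
  have h1 : p.1 ∈ ball t₀ δ := by
    rw [mem_ball, Real.dist_eq, abs_of_nonneg (sub_nonneg.2 hp.1.1)]
    linarith [hp.1.2]
  exact mk_mem_ball (p := (t₀, x₀)) h1 hp.2

lemma Sol.eventually_bounds (H : Sol κ T L c Mv Mr r v) (t₀ : ℝ) (x₀ : 𝔼 d) :
    ∀ᶠ p : ℝ × 𝔼 d in 𝓝 (t₀, x₀),
      ‖v p.1 p.2‖ ≤ ‖v t₀ x₀‖ + 1 ∧ |r p.1 p.2| ≤ |r t₀ x₀| + 1 := by
  have h1 := (H.vcont.norm.tendsto (t₀, x₀)).eventually (gt_mem_nhds (lt_add_one _))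
  have h2 := (H.rcont.abs.tendsto (t₀, x₀)).eventually (gt_mem_nhds (lt_add_one _))
  filter_upwards [h1, h2] with p h1 h2 using ⟨h1.le, h2.le⟩

lemma Sol.exists_box (H : Sol κ T L c Mv Mr r v) (ht₀ : t₀ ∈ Ico 0 T) {U : Set (ℝ × 𝔼 d)}
    (hU : U ∈ 𝓝 (t₀, x₀)) : ∃ δ > 0, cyl t₀ (t₀ + δ) x₀ δ ⊆ U ∧
      Box T (‖v t₀ x₀‖ + 1) (|r t₀ x₀| + 1) r v t₀ (t₀ + δ) x₀ δ := by
  obtain ⟨δ, hδ, hsub⟩ := exists_cyl_subset (inter_mem hU (H.eventually_bounds t₀ x₀))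
  have hm : 0 < min δ (T - t₀) := lt_min hδ (sub_pos.2 ht₀.2)
  have hle := min_le_left δ (T - t₀)
  have hsub' : cyl t₀ (t₀ + min δ (T - t₀)) x₀ (min δ (T - t₀)) ⊆ cyl t₀ (t₀ + δ) x₀ δ :=
    prod_mono (Ico_subset_Ico_right (by linarith)) (ball_subset_ball hle)
  refine ⟨min δ (T - t₀), hm, fun p hp => (hsub (hsub' hp)).1, ht₀.1, ?_, by positivity,
    by positivity, fun p hp => (hsub (hsub' hp)).2.1, fun p hp => (hsub (hsub' hp)).2.2⟩
  linarith [min_le_right δ (T - t₀)]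

/-- The size of the point `x` and of the velocity there. -/
noncomputable def size (v : ℝ → (𝔼 d) → 𝔼 d) (t : ℝ) (x : 𝔼 d) : ℝ := 1 + ‖x‖ + ‖v t x‖

lemma one_le_size (v : ℝ → (𝔼 d) → 𝔼 d) (t : ℝ) (x : 𝔼 d) : 1 ≤ size v t x := by
  unfold size
  linarith [norm_nonneg x, norm_nonneg (v t x)]

/-- A gas point whose size is at most `A`, with a margin growing in time at rate `K`. -/
def Within (K A t₀ : ℝ) (r : ℝ → (𝔼 d) → ℝ) (v : ℝ → (𝔼 d) → 𝔼 d) (p : ℝ × 𝔼 d) : Prop :=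
  t₀ < p.1 ∧ 0 < r p.1 p.2 ∧ Real.exp (K * (p.1 - t₀)) * size v p.1 p.2 ≤ A

/-- Two pairs `(r, v)`, `(r', v')` agree at `(t, x)`. -/
def Agree (r r' : ℝ → (𝔼 d) → ℝ) (v v' : ℝ → (𝔼 d) → 𝔼 d) (t : ℝ) (x : 𝔼 d) : Prop :=
  r t x = r' t x ∧ v t x = v' t x

/-- Agreement on the part of the initial time slice in the domain of dependence. -/
def BaseAgree (r r' : ℝ → (𝔼 d) → ℝ) (v v' : ℝ → (𝔼 d) → 𝔼 d) (t₀ D : ℝ) (p : ℝ × 𝔼 d) : Prop :=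
  (∃ y ∈ ball p.2 (D * (p.1 - t₀)), 0 < r t₀ y) ∧
    ∀ y ∈ ball p.2 (D * (p.1 - t₀)), 0 < r t₀ y → Agree r r' v v' t₀ y

lemma Controlled.eventually_baseAgree {D C A : ℝ} (H : Sol κ T L c Mv Mr r v)
    (hC : Controlled r v t₀ x₀ (D * size v t₀ x₀) (C * size v t₀ x₀)) (hC0 : 0 ≤ C)
    (hgood : ∀ y, 0 < r t₀ y → size v t₀ y ≤ A → Agree r r' v v' t₀ y) :
    ∀ᶠ p in 𝓝 (t₀, x₀), Within (2 * C) A t₀ r v p →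
      BaseAgree r r' v v' t₀ (D * size v t₀ x₀) p := by
  have hcont : Continuous fun p : ℝ × 𝔼 d => 2 * size v p.1 p.2 := by
    have := H.vcont
    unfold size
    fun_prop
  have h1 := one_le_size v t₀ x₀
  have hev := (hcont.tendsto (t₀, x₀)).eventually
    (lt_mem_nhds (show size v t₀ x₀ < 2 * size v t₀ x₀ by linarith))
  filter_upwards [hev, hC] with p h2 h3 hp
  obtain ⟨hp1, hp2, hp3⟩ := hp
  refine ⟨(h3 hp1 hp2).1, fun y hy hry => hgood y hry ?_⟩
  have h4 := (h3 hp1 hp2).2 y hy hry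
  refine le_trans ?_ hp3
  have hh : 0 < p.1 - t₀ := sub_pos.2 hp1
  have h5 := Real.add_one_le_exp (2 * C * (p.1 - t₀))
  have h6 := mul_le_mul_of_nonneg_right h5 (zero_le_one.trans (one_le_size v p.1 p.2))
  have h7 := mul_le_mul_of_nonneg_left h2.le (mul_nonneg hC0 hh.le)
  change size v t₀ y ≤ size v p.1 p.2 + _ at h4
  linarith

lemma frequently_ball {Q : ℝ × (𝔼 d) → Prop} {D : ℝ} (hfreq : ∃ᶠ p in 𝓝 (t₀, x₀), Q p)
    (hQ : ∀ᶠ p in 𝓝 (t₀, x₀), Q p → BaseAgree r r' v v' t₀ D p) {δ : ℝ} (hδ : 0 < δ) :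
    ∃ y ∈ ball x₀ δ, 0 < r t₀ y ∧ ∀ᶠ z in 𝓝 y, 0 < r t₀ z → Agree r r' v v' t₀ z := by
  obtain ⟨p, hp, h1, h2, h3⟩ := (hfreq.and_eventually (hQ.and
    ((eventually_dist_lt (half_pos hδ) t₀ x₀).and
      (eventually_mul_time_lt D (half_pos hδ) t₀ x₀)))).exists
  obtain ⟨⟨y, hy, hry⟩, hall⟩ := h1 hp
  refine ⟨y, ball_subset_ball' (by linarith) hy, hry, ?_⟩
  filter_upwards [isOpen_ball.mem_nhds hy] with z hz using hall z hz

lemma agree_of_frequently (H : Sol κ T L c Mv Mr r v) (H' : Sol κ T L c Mv Mr r' v')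
    {Q : ℝ × (𝔼 d) → Prop} {D : ℝ} (hfreq : ∃ᶠ p in 𝓝 (t₀, x₀), Q p)
    (hQ : ∀ᶠ p in 𝓝 (t₀, x₀), Q p → BaseAgree r r' v v' t₀ D p) :
    Agree r r' v v' t₀ x₀ := by
  have hc : Continuous fun x : 𝔼 d => (t₀, x) := by fun_prop
  have h1 : IsClosed {x | Agree r r' v v' t₀ x} :=
    (isClosed_eq (H.rcont.comp hc) (H'.rcont.comp hc)).inter
      (isClosed_eq (H.vcont.comp hc) (H'.vcont.comp hc))
  refine h1.closure_subset (Metric.mem_closure_iff.2 fun δ hδ => ?_)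
  obtain ⟨y, hy, hry, hev⟩ := frequently_ball hfreq hQ hδ
  exact ⟨y, hev.self_of_nhds hry, by rw [dist_comm]; exact hy⟩

/-- No gas enters a vacuum region instantly. -/
lemma Sol.eventually_not_pos (H : Sol κ T L c Mv Mr r v) (ht₀ : t₀ ∈ Ico 0 T)
    (hx₀ : x₀ ∉ closure {x | 0 < r t₀ x}) :
    ∀ᶠ p in 𝓝 (t₀, x₀), t₀ < p.1 → ¬ 0 < r p.1 p.2 := by
  obtain ⟨δ, hδ, -, Bx⟩ := H.exists_box (x₀ := x₀) ht₀ univ_mem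
  obtain ⟨η, hη, hsub⟩ := Metric.isOpen_iff.1 isClosed_closure.isOpen_compl x₀ hx₀
  have C : Comparison κ (|r t₀ x₀| + 1) (‖v t₀ x₀‖ + 1) 0 0 t₀ (t₀ + δ) x₀ δ (fun _ => -1)
    (fun _ => 0) := comparison_vacuum (by linarith [abs_nonneg (r t₀ x₀)]) Bx.N_pos.le
  have hS := le_max_left (3 * (‖v t₀ x₀‖ + 1) + 3 + cEnt (1 / κ) * (|r t₀ x₀| + 1) / 2) 0
  set S := max (3 * (‖v t₀ x₀‖ + 1) + 3 + cEnt (1 / κ) * (|r t₀ x₀| + 1) / 2) 0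
  filter_upwards [C.eventually_agree Bx H (lt_add_of_pos_right _ hδ) hδ (le_max_right _ _) hS,
    eventually_dist_lt (half_pos hη) t₀ x₀,
    eventually_mul_time_lt (2 * S) (half_pos hη) t₀ x₀] with p h h1 h2 hp hr
  have h3 := (h hp fun y hy => ?_).1
  · rw [← rp_pos_iff, h3] at hr
    norm_num at hr
  · have hy' : ¬ 0 < r t₀ y := fun h' =>
      hsub (ball_subset_ball' (by linarith) hy) (subset_closure h')
    have h0 : rp r (t₀, y) = 0 := max_eq_right (not_lt.1 hy')
    rw [h0]
    exact ⟨by norm_num, fun h => absurd h (lt_irrefl _)⟩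

lemma agree_of_rp (h0 : 0 < r t₁ x₀) (h1 : rp r' (t₁, x₀) = r t₁ x₀)
    (h2 : 0 < rp r' (t₁, x₀) → v' t₁ x₀ = v t₁ x₀) : Agree r r' v v' t₁ x₀ := by
  have h3 : 0 < rp r' (t₁, x₀) := by rwa [h1]
  exact ⟨by rw [← h1, rp_of_pos (rp_pos_iff.1 h3)], (h2 h3).symm⟩

/-- Agreement propagates at points inside the gas. -/
lemma eventually_agree_of_pos (H : Sol κ T L c Mv Mr r v) (H' : Sol κ T L c Mv Mr r' v')
    (ht₀ : t₀ ∈ Ico 0 T) (hx₀ : 0 < r t₀ x₀) (hag : Agree r r' v v' t₀ x₀) {S : ℝ} (hS0 : 0 ≤ S)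
    (hS : 3 * (‖v t₀ x₀‖ + 1) + 3 + cEnt (1 / κ) * (|r t₀ x₀| + 1) / 2 ≤ S) :
    ∀ᶠ p in 𝓝 (t₀, x₀), t₀ < p.1 → BaseAgree r r' v v' t₀ (2 * S) p →
      Agree r r' v v' p.1 p.2 := by
  have hU : {p : ℝ × 𝔼 d | 0 < r p.1 p.2} ∈ 𝓝 (t₀, x₀) :=
    (isOpen_lt continuous_const H.rcont).mem_nhds hx₀
  obtain ⟨δ, hδ, hpos, Bx⟩ := H.exists_box (v := v) ht₀ hU
  obtain ⟨δ', hδ', hsub', Bx'⟩ := H'.exists_box (v := v') ht₀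
    (inter_mem hU (H.eventually_bounds t₀ x₀))
  rw [← hag.1, ← hag.2] at Bx'
  have Bs : Box T (‖v t₀ x₀‖ + 1) (|r t₀ x₀| + 1) r v t₀ (t₀ + δ') x₀ δ' :=
    ⟨ht₀.1, Bx'.t₁_le, Bx.N_pos, Bx.M_pos, fun p hp => (hsub' hp).2.1, fun p hp => (hsub' hp).2.2⟩
  have C := Bs.comparison H fun p hp => (hsub' hp).1
  filter_upwards [C.eventually_agree Bx' H' (lt_add_of_pos_right _ hδ') hδ' hS0 hS,
    eventually_dist_lt (half_pos hδ') t₀ x₀, eventually_mul_time_lt (2 * S) (half_pos hδ') t₀ x₀,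
    hU] with p h h1 h2 h3 hp hb
  have h4 := h hp fun y hy => ?_
  · rw [max_eq_left (rp_nonneg r p), rp_of_pos h3] at h4
    exact agree_of_rp h3 h4.1 h4.2
  · have hry : 0 < r t₀ y := (hsub' (show (t₀, y) ∈ cyl t₀ (t₀ + δ') x₀ δ' from
      ⟨⟨le_rfl, lt_add_of_pos_right _ hδ'⟩, ball_subset_ball' (by linarith) hy⟩)).1
    obtain ⟨e1, e2⟩ := hb.2 y hy hry
    refine ⟨?_, fun _ => e2.symm⟩
    rw [max_eq_left (rp_nonneg r _)]
    simp only [rp, e1]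

end Propagation

section BoundaryPropagation

variable {d : ℕ} {κ T L c Mv Mr N M ε a t₀ t₁ P ρ s₀ : ℝ} {r r' : ℝ → (𝔼 d) → ℝ}
  {v v' : ℝ → (𝔼 d) → 𝔼 d} {x₀ e : 𝔼 d}

/-- Near a boundary point, the gradient of `r'` is close to that of `r` if `r'` agrees with `r` on
open sets accumulating there. -/
lemma Sol.gradient_near (H' : Sol κ T L c Mv Mr r' v') (ht₀ : t₀ ∈ Icc 0 T) (h0 : r' t₀ x₀ = 0)
    {b : 𝔼 d} (hP : 0 < P) (hε : 0 < ε)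
    (hosc : ∀ z ∈ ball x₀ P, 0 < r t₀ z → ‖gradient (r t₀) z - b‖ ≤ ε)
    (hr : IsOpen {x | 0 < r t₀ x})
    (hball : ∀ δ > 0, ∃ y ∈ ball x₀ δ, 0 < r t₀ y ∧
      ∀ᶠ z in 𝓝 y, 0 < r t₀ z → Agree r r' v v' t₀ z) :
    ∃ P' > 0, ∀ z ∈ ball x₀ P', 0 < r' t₀ z → ‖gradient (r' t₀) z - b‖ ≤ 2 * ε := by
  have hc : Continuous fun q : (𝔼 d) × 𝔼 d =>
      Mr * (√(r' t₀ q.1) + √(r' t₀ q.2) + √‖q.1 - q.2‖) := by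
    have h1 := (H'.continuous_slice t₀).comp (continuous_fst (X := 𝔼 d) (Y := 𝔼 d))
    have h2 := (H'.continuous_slice t₀).comp (continuous_snd (X := 𝔼 d) (Y := 𝔼 d))
    have h3 : Continuous fun q : (𝔼 d) × 𝔼 d => √‖q.1 - q.2‖ := by fun_prop
    exact continuous_const.mul ((h1.sqrt.add h2.sqrt).add h3)
  have h00 : Mr * (√(r' t₀ x₀) + √(r' t₀ x₀) + √‖x₀ - x₀‖) < ε := by simp [h0, hε]
  have hev := (hc.tendsto (x₀, x₀)).eventually (gt_mem_nhds h00)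
  obtain ⟨P', hP', hsub⟩ := Metric.mem_nhds_iff.1 hev
  refine ⟨P', hP', fun z hz hrz => ?_⟩
  obtain ⟨y, hy, hry, hag⟩ := hball (min P P') (lt_min hP hP')
  have heq : r t₀ =ᶠ[𝓝 y] r' t₀ := by
    filter_upwards [hag, hr.mem_nhds hry] with w h1 h2 using (h1 h2).1
  have hgrad : gradient (r t₀) y = gradient (r' t₀) y := by
    rw [gradient, gradient, heq.fderiv_eq]
  have h1 : ‖gradient (r' t₀) y - b‖ ≤ ε :=
    hgrad ▸ hosc y (ball_subset_ball (min_le_left _ _) hy) hry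
  have h2 := H'.gradr t₀ ht₀ z hrz y (heq.self_of_nhds ▸ hry)
  have h3 := hsub (mk_mem_ball (p := (x₀, x₀)) hz (ball_subset_ball (min_le_right _ _) hy))
  have h4 : Mr * (√(r' t₀ z) + √(r' t₀ y) + √‖z - y‖) < ε := h3
  calc ‖gradient (r' t₀) z - b‖
      = ‖(gradient (r' t₀) z - gradient (r' t₀) y) + (gradient (r' t₀) y - b)‖ := by
        rw [sub_add_sub_cancel]
    _ ≤ _ := norm_add_le _ _
    _ ≤ _ := by linarith

namespace Chart

/-- The gas of `r'` does not reach below the free boundary of `r` if the two agree just above. -/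
lemma not_pos_of_agree (Ch : Chart T N M ε a e r v t₀ t₁ x₀ P ρ s₀) (H : Sol κ T L c Mv Mr r v)
    (H' : Sol κ T L c Mv Mr r' v') {P' : ℝ}
    (hosc : ∀ z ∈ ball x₀ P', 0 < r' t₀ z → ‖gradient (r' t₀) z - a • e‖ ≤ 2 * ε) {y : 𝔼 d}
    (hy : y ∈ ball x₀ ρ) (hry : ¬ 0 < r t₀ y)
    (hseg : ∀ s ∈ Icc 0 (hit r e s₀ (t₀, y)), y + s • e ∈ ball x₀ P')
    (hag : ∀ᶠ s in 𝓝[>] (hit r e s₀ (t₀, y)), r t₀ (y + s • e) = r' t₀ (y + s • e)) :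
    ¬ 0 < r' t₀ y := by
  intro hpos
  set σ := hit r e s₀ (t₀, y) with hσ
  have hp : (t₀, y) ∈ cyl t₀ t₁ x₀ ρ := ⟨⟨le_rfl, Ch.t₀_lt⟩, hy⟩
  have hε := Ch.ε_pos
  have ha := Ch.a_ge
  have h1 := (H'.growth (Ch.bx.mem_time (Ch.push_mem hp ⟨le_rfl, by linarith [Ch.s₀_pos]⟩))
    isOpen_ball Ch.norm_e (by linarith : 2 * ε ≤ a) hosc hseg hpos
    (right_mem_Icc.2 (hit_nonneg r e s₀ (t₀, y)))).1
  have h2 : rp r (t₀, y + σ • e) = 0 := by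
    have := rp_push_hit H Ch hp hry
    simpa only [push] using this
  have hline : Continuous fun s : ℝ => y + s • e := by fun_prop
  have hc := ((H.continuous_slice t₀).comp hline).tendsto σ
  have hc' := ((H'.continuous_slice t₀).comp hline).tendsto σ
  have h3 : r t₀ (y + σ • e) = r' t₀ (y + σ • e) :=
    tendsto_nhds_unique_of_eventuallyEq (hc.mono_left nhdsWithin_le_nhds)
      (hc'.mono_left nhdsWithin_le_nhds) hag
  change 0 < r' t₀ (y + σ • e) at h1
  rw [← h3] at h1
  exact (rp_pos_iff.2 (show 0 < r (t₀, y + σ • e).1 (t₀, y + σ • e).2 from h1)).ne' h2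

/-- Agreement propagates at points of the free boundary. -/
lemma eventually_agree (Ch : Chart T N M ε a e r v t₀ t₁ x₀ P ρ s₀) (H : Sol κ T L c Mv Mr r v)
    (H' : Sol κ T L c Mv Mr r' v') (Bx' : Box T N M r' v' t₀ t₁ x₀ ρ) {P' : ℝ} (hP' : 0 < P')
    (hosc : ∀ z ∈ ball x₀ P', 0 < r' t₀ z → ‖gradient (r' t₀) z - a • e‖ ≤ 2 * ε)
    {S D : ℝ} (hS0 : 0 ≤ S) (hS : 3 * N + 3 + cEnt (1 / κ) * (3 * M) / 2 ≤ S)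
    (hD : 2 * S + (L * (2 * S) + rateR d κ L Mv N M) / (a - ε) ≤ D) :
    ∀ᶠ p in 𝓝 (t₀, x₀), t₀ < p.1 → 0 < r p.1 p.2 → BaseAgree r r' v v' t₀ D p →
      Agree r r' v v' p.1 p.2 := by
  obtain ⟨B, K, C⟩ := Ch.exists_comparison H
  have hM := Ch.bx.M_pos
  have hL := H.L_nonneg
  have hg := Ch.slope_pos.2
  have hrt := H.rateR_nonneg Ch.bx.N_pos.le hM.le
  have hq : 0 ≤ (L * (2 * S) + rateR d κ L Mv N M) / (a - ε) := by positivity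
  have hD0 : 0 ≤ D := by linarith
  filter_upwards [C.eventually_agree (Bx'.mono_M (by linarith)) H' Ch.t₀_lt Ch.ρ_pos hS0 hS,
    eventually_dist_lt (half_pos Ch.ρ_pos) t₀ x₀,
    eventually_dist_lt (half_pos hP') t₀ x₀,
    eventually_mul_time_lt D (half_pos Ch.ρ_pos) t₀ x₀,
    eventually_mul_time_lt D (half_pos hP') t₀ x₀,
    eventually_mul_time_lt D (mul_pos (by norm_num : (0:ℝ) < 4) Ch.s₀_pos) t₀ x₀,
    eventually_mul_time_lt 1 (sub_pos.2 Ch.t₀_lt) t₀ x₀] with p h h1 h2 h3 h4 h5 h6 hp hr hb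
  have hh : 0 < p.1 - t₀ := sub_pos.2 hp
  have hpm : p ∈ cyl t₀ t₁ x₀ ρ :=
    ⟨⟨hp.le, by linarith⟩, mem_ball.2 (by linarith [Ch.ρ_pos])⟩
  have h7 := h hp fun y hy => ?_
  · rw [Ch.extR_of_pos hr, Ch.extV_of_pos hr, max_eq_left hr.le] at h7
    exact agree_of_rp hr h7.1 h7.2
  · have hyd : dist y p.2 < 2 * S * (p.1 - t₀) := hy
    have hDh : 2 * S * (p.1 - t₀) +
        (L * (2 * S) + rateR d κ L Mv N M) / (a - ε) * (p.1 - t₀) ≤ D * (p.1 - t₀) := by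
      rw [← add_mul]
      exact mul_le_mul_of_nonneg_right hD hh.le
    have hq' := mul_nonneg hq hh.le
    have hyρ : y ∈ ball x₀ ρ := by
      refine ball_subset_ball' ?_ hy
      linarith
    have hym : (t₀, y) ∈ cyl t₀ t₁ x₀ ρ := ⟨⟨le_rfl, Ch.t₀_lt⟩, hyρ⟩
    by_cases hry : 0 < r t₀ y
    · obtain ⟨e1, e2⟩ := hb.2 y (ball_subset_ball (by linarith) hy) hry
      rw [Ch.extR_of_pos (p := (t₀, y)) hry, Ch.extV_of_pos (p := (t₀, y)) hry]
      exact ⟨by simp only [rp, e1], fun _ => e2.symm⟩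
    · have hR : max (extR r e s₀ (t₀, y)) 0 = 0 := by
        refine max_eq_right ((Ch.extR_le H hym hry).1.trans ?_)
        have := Ch.a_ge
        have := Ch.ε_pos
        have := mul_nonneg (by linarith : 0 ≤ a - 3 * ε) (hit_nonneg r e s₀ (t₀, y))
        linarith
      set σ := hit r e s₀ (t₀, y) with hσ
      have hσ0 : 0 ≤ σ := hit_nonneg _ _ _ _
      have hσle : σ ≤ (L * (2 * S) + rateR d κ L Mv N M) / (a - ε) * (p.1 - t₀) := by
        have h8 := Ch.hit_le_add H hpm hym
        rw [Ch.hit_eq_zero hr, zero_add] at h8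
        refine h8.trans ?_
        rw [div_mul_eq_mul_div]
        have e1 : |t₀ - p.1| = p.1 - t₀ := by rw [abs_sub_comm, abs_of_pos hh]
        have e2 : ‖y - p.2‖ ≤ 2 * S * (p.1 - t₀) := by rw [← dist_eq_norm]; exact hyd.le
        have e3 := mul_le_mul_of_nonneg_left e2 hL
        simp only [e1]
        gcongr
        linarith
      have hdist : ∀ s, 0 ≤ s → dist (y + s • e) p.2 ≤ dist y p.2 + s := fun s hs => by
        refine (dist_triangle _ y _).trans (le_of_eq ?_)
        rw [dist_eq_norm, add_sub_cancel_left, norm_smul, Ch.norm_e, mul_one,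
          Real.norm_of_nonneg hs, add_comm]
      have hnot : ¬ 0 < r' t₀ y := by
        refine Ch.not_pos_of_agree H H' hosc hyρ hry (fun s hs => ?_) ?_
        · have := hdist s hs.1
          have := dist_triangle (y + s • e) p.2 x₀
          rw [mem_ball]
          have := hs.2
          linarith
        · have hlt : σ < D * (p.1 - t₀) - dist y p.2 := by linarith
          filter_upwards [Ioo_mem_nhdsGT hlt] with s hs
          have hs0 : 0 ≤ s := hσ0.trans hs.1.le
          have := hdist s hs0
          refine (hb.2 (y + s • e) (mem_ball.2 (by linarith [hs.2])) ?_).1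
          exact Ch.pos_of_hit_lt H hym hs.1 (by linarith [hs.2, dist_nonneg (x := y) (y := p.2)])
      have h0 : rp r' (t₀, y) = 0 := max_eq_right (not_lt.1 hnot)
      rw [h0, hR]
      exact ⟨rfl, fun h => absurd h (lt_irrefl _)⟩

end Chart

end BoundaryPropagation

section LocalUniqueness

variable {d : ℕ} {κ T L c Mv Mr N M ε a t₀ t₁ P ρ s₀ : ℝ} {r r' : ℝ → (𝔼 d) → ℝ}
  {v v' : ℝ → (𝔼 d) → 𝔼 d} {x₀ e : 𝔼 d}

lemma Chart.mono (Ch : Chart T N M ε a e r v t₀ t₁ x₀ P ρ s₀) {t₁' ρ' : ℝ} (h : t₀ < t₁')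
    (ht : t₁' ≤ t₁) (hρ' : 0 < ρ') (hρ : ρ' ≤ ρ) :
    Chart T N M ε a e r v t₀ t₁' x₀ P ρ' s₀ where
  bx := Ch.bx.mono ht subset_rfl
  t₀_lt := h
  ρ_pos := hρ'
  s₀_pos := Ch.s₀_pos
  P_ge := by linarith [Ch.P_ge]
  ε_pos := Ch.ε_pos
  a_ge := Ch.a_ge
  norm_e := Ch.norm_e
  osc t ht' := Ch.osc t ⟨ht'.1, ht'.2.trans_le ht⟩
  reach t ht' x hx := Ch.reach t ⟨ht'.1, ht'.2.trans_le ht⟩ x (ball_subset_ball hρ hx)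

/-- Agreement at time `t₀` of all gas points up to a given size implies agreement at slightly later
times, with a loss in the size that is exponential at a uniform rate. -/
lemma Sol.exists_rate (H : Sol κ T L c Mv Mr r v) (H' : Sol κ T L c Mv Mr r' v') {R₀ : ℝ}
    (hR₀ : ∀ t ∈ Icc 0 T, |r t 0| ≤ R₀) :
    ∃ K, 0 ≤ K ∧ ∀ t₀ ∈ Ico 0 T, ∀ A x₀,
      (∀ y, 0 < r t₀ y → size v t₀ y ≤ A → Agree r r' v v' t₀ y) →
      ∀ᶠ p in 𝓝 (t₀, x₀), Within K A t₀ r v p → Agree r r' v v' p.1 p.2 := by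
  have hκ := H.κ_pos
  have hL := H.L_nonneg
  have hMv := H.Mv_nonneg
  have hcE := cEnt_pos (one_div_pos.2 hκ)
  set M₀ := max R₀ 0 + L + 1 with hM₀
  have hM₀0 : 0 < M₀ := by positivity
  set Cr := L + κ * M₀ * (d * Mv) with hCr
  have hCr0 : 0 ≤ Cr := by positivity
  set g := 14 * (c / 16) with hg
  have hg0 : 0 < g := by have := H.c_pos; positivity
  set S₀ := 6 + cEnt (1 / κ) * (3 * M₀) / 2 with hS₀
  have hS₀0 : 0 < S₀ := by positivity
  set D := 2 * S₀ + (L * (2 * S₀) + Cr) / g with hD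
  have hq0 : 0 ≤ L * (2 * S₀) / g := by positivity
  have hDq : D = 2 * S₀ + L * (2 * S₀) / g + Cr / g := by rw [hD]; ring
  have hCg : 0 ≤ Cr / g := by positivity
  have hD0 : 0 < D := by linarith
  have hC0 : 0 ≤ rateW L Mv Cr g D := by unfold rateW; positivity
  refine ⟨2 * rateW L Mv Cr g D, by positivity, fun t₀ ht₀ A x₀ hgood => ?_⟩
  have ht₀' : t₀ ∈ Icc 0 T := ⟨ht₀.1, ht₀.2.le⟩
  set ψ := size v t₀ x₀ with hψ
  have hψ1 : 1 ≤ ψ := one_le_size v t₀ x₀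
  have hψx : ψ = 1 + ‖x₀‖ + ‖v t₀ x₀‖ := hψ
  have hNψ : ‖v t₀ x₀‖ + 1 ≤ ψ := by linarith [norm_nonneg x₀]
  have hMψ : |r t₀ x₀| + 1 ≤ M₀ * ψ := by
    have h1 := H.lip t₀ ht₀' x₀ 0
    rw [sub_zero] at h1
    have h2 := abs_sub_abs_le_abs_sub (r t₀ x₀) (r t₀ 0)
    have h3 := (hR₀ t₀ ht₀').trans (le_max_left R₀ 0)
    have h4 : L * ‖x₀‖ ≤ L * ψ := mul_le_mul_of_nonneg_left (by linarith [norm_nonneg (v t₀ x₀)]) hL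
    have h5 : max R₀ 0 * 1 ≤ max R₀ 0 * ψ := mul_le_mul_of_nonneg_left hψ1 (le_max_right _ _)
    rw [hM₀]
    linarith
  have hrt : rateR d κ L Mv (‖v t₀ x₀‖ + 1) (|r t₀ x₀| + 1) ≤ Cr * ψ := by
    have h1 := mul_le_mul_of_nonneg_right hNψ hL
    have h2 : κ * (|r t₀ x₀| + 1) * (d * Mv) ≤ κ * (M₀ * ψ) * (d * Mv) := by gcongr
    rw [rateR, hCr]
    linarith
  have hS : 3 * (‖v t₀ x₀‖ + 1) + 3 + cEnt (1 / κ) * (3 * (|r t₀ x₀| + 1)) / 2 ≤ S₀ * ψ := by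
    have h1 := mul_le_mul_of_nonneg_left hMψ hcE.le
    rw [hS₀]
    linarith
  by_cases hcl : x₀ ∈ closure {x | 0 < r t₀ x}
  swap
  · filter_upwards [H.eventually_not_pos ht₀ hcl] with p h hp using absurd hp.2.1 (h hp.1)
  by_cases hx : 0 < r t₀ x₀
  · have hU : {p : ℝ × 𝔼 d | 0 < r p.1 p.2} ∈ 𝓝 (t₀, x₀) :=
      (isOpen_lt continuous_const H.rcont).mem_nhds hx
    obtain ⟨δ, hδ, hpos, Bx⟩ := H.exists_box (v := v) ht₀ hU
    have hbase := (Bx.controlled H (lt_add_of_pos_right _ hδ) hδ hpos hD0 hCr0 hg0 hψ1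
      hNψ).eventually_baseAgree H hC0 hgood
    by_cases hfreq : ∃ᶠ p in 𝓝 (t₀, x₀), Within (2 * rateW L Mv Cr g D) A t₀ r v p
    swap
    · filter_upwards [not_frequently.1 hfreq] with p h hp using absurd hp h
    have hag := agree_of_frequently H H' hfreq hbase
    have hS' : S₀ * ψ ≤ D * ψ / 2 := by nlinarith
    filter_upwards [hbase, eventually_agree_of_pos H H' ht₀ hx hag (S := D * ψ / 2) (by positivity)
      (by
        have : 0 ≤ cEnt (1 / κ) * (|r t₀ x₀| + 1) := by positivity
        linarith)] with p h1 h2 hp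
    refine h2 hp.1 ?_
    rw [mul_div_cancel₀ _ (two_ne_zero)]
    exact h1 hp
  · have hx0 : r t₀ x₀ = 0 := by
      refine le_antisymm (not_lt.1 hx) ?_
      have : IsClosed {x | 0 ≤ r t₀ x} := isClosed_le continuous_const (H.continuous_slice t₀)
      exact closure_minimal (fun x (h : 0 < r t₀ x) => h.le) this hcl
    obtain ⟨δ, hδ, -, Bx⟩ := H.exists_box (x₀ := x₀) ht₀ univ_mem
    obtain ⟨a, e, t₂, P, ρ, s₀, -, Ch⟩ :=
      H.exists_chart Bx (lt_add_of_pos_right _ hδ) hδ hx0 hcl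
    have hga : g ≤ a - c / 16 := Ch.slope_pos.1
    have hbase := (Ch.controlled H (D := D) hg0 hga hψ1 hNψ hrt
      (by linarith)).eventually_baseAgree H hC0 hgood
    by_cases hfreq : ∃ᶠ p in 𝓝 (t₀, x₀), Within (2 * rateW L Mv Cr g D) A t₀ r v p
    swap
    · filter_upwards [not_frequently.1 hfreq] with p h hp using absurd hp h
    have hag := agree_of_frequently H H' hfreq hbase
    obtain ⟨δ', hδ', -, Bx'⟩ := H'.exists_box (x₀ := x₀) ht₀ univ_mem
    rw [← hag.1, ← hag.2] at Bx'
    have hP : 0 < P := by linarith [Ch.P_ge, Ch.ρ_pos, Ch.s₀_pos]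
    obtain ⟨P', hP', hosc⟩ := H'.gradient_near ht₀' (hag.1 ▸ hx0) hP Ch.ε_pos
      (Ch.osc t₀ ⟨le_rfl, Ch.t₀_lt⟩) (H.isOpen_slice t₀)
      fun η hη => frequently_ball hfreq hbase hη
    have ht : t₀ < min t₂ (t₀ + δ') := lt_min Ch.t₀_lt (lt_add_of_pos_right _ hδ')
    have Ch' := Ch.mono ht (min_le_left _ _) (lt_min Ch.ρ_pos hδ') (min_le_left ρ δ')
    have Bs := Bx'.mono (min_le_right t₂ (t₀ + δ')) (ball_subset_ball (min_le_right ρ δ'))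
    filter_upwards [hbase, Ch'.eventually_agree H H' Bs hP' hosc (S := S₀ * ψ) (D := D * ψ)
      (by positivity) hS (by
        have h1 : L * (2 * (S₀ * ψ)) + rateR d κ L Mv (‖v t₀ x₀‖ + 1) (|r t₀ x₀| + 1) ≤
          (L * (2 * S₀) + Cr) * ψ := by linarith
        have h2 : (L * (2 * (S₀ * ψ)) + rateR d κ L Mv (‖v t₀ x₀‖ + 1) (|r t₀ x₀| + 1)) /
            (a - c / 16) ≤ (L * (2 * S₀) + Cr) * ψ / g := by gcongr
        rw [hD]
        refine (add_le_add_right h2 _).trans (le_of_eq ?_)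
        ring)] with p h1 h2 hp
    exact h2 hp.1 hp.2.1 (h1 hp)

end LocalUniqueness

section Global

variable {d : ℕ} {κ T L c Mv Mr K A t : ℝ} {r r' : ℝ → (𝔼 d) → ℝ}
  {v v' : ℝ → (𝔼 d) → 𝔼 d} {x : 𝔼 d}

lemma Sol.eventually_size_le (H : Sol κ T L c Mv Mr r v) (ht : t ∈ Ioc 0 T) (hx : 0 < r t x)
    (hK : Mv + L ≤ K) : ∀ᶠ s in 𝓝[<] t, 0 ≤ s ∧ 0 < r s x ∧
      Real.exp (K * s) * size v s x ≤ Real.exp (K * t) * size v t x := by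
  have hr : Continuous fun s => r s x := H.rcont.comp (by fun_prop : Continuous fun s => (s, x))
  have hv : Continuous fun s => v s x := H.vcont.comp (by fun_prop : Continuous fun s => (s, x))
  have h1 : ∀ᶠ s in 𝓝 t, 0 < s ∧ 0 < r s x ∧ ‖v s x‖ < ‖v t x‖ + 1 :=
    (lt_mem_nhds ht.1).and ((hr.continuousAt.eventually (lt_mem_nhds hx)).and
      (hv.norm.continuousAt.eventually (gt_mem_nhds (lt_add_one _))))
  obtain ⟨ε, hε, hball⟩ := Metric.eventually_nhds_iff_ball.1 h1
  filter_upwards [Ioo_mem_nhdsLT (sub_lt_self t hε)] with s hs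
  have hin : ∀ u ∈ Icc s t, u ∈ ball t ε := fun u hu => by
    rw [Real.ball_eq_Ioo]
    exact ⟨hs.1.trans_le hu.1, by linarith [hu.2]⟩
  have hs' := hball s (hin s (left_mem_Icc.2 hs.2.le))
  refine ⟨hs'.1.le, hs'.2.1, ?_⟩
  have h2 := H.norm_v_time_le (N := ‖v t x‖ + 1) hs.2.le hs'.1.le ht.2 (x := x) fun u hu =>
    ⟨(hball u (hin u hu)).2.1, (hball u (hin u hu)).2.2.le⟩
  have h3 : ‖v s x‖ ≤ ‖v t x‖ + (Mv * (‖v t x‖ + 1) + L) * (t - s) := by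
    have := norm_sub_norm_le (v s x) (v t x)
    rw [norm_sub_rev] at this
    linarith
  have hd : 0 ≤ t - s := by linarith [hs.2]
  have hsz := one_le_size v t x
  have h4 : Mv * (‖v t x‖ + 1) + L ≤ K * size v t x := by
    have e1 : Mv * (‖v t x‖ + 1) ≤ Mv * size v t x :=
      mul_le_mul_of_nonneg_left (by unfold size; linarith [norm_nonneg x]) H.Mv_nonneg
    have e2 : L ≤ L * size v t x := le_mul_of_one_le_right H.L_nonneg hsz
    have e3 : (Mv + L) * size v t x ≤ K * size v t x :=
      mul_le_mul_of_nonneg_right hK (by linarith)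
    linarith
  have h5 : size v s x ≤ size v t x * Real.exp (K * (t - s)) := by
    have e1 : size v s x ≤ size v t x * (K * (t - s) + 1) := by
      have := mul_le_mul_of_nonneg_right h4 hd
      unfold size at this ⊢
      linarith
    exact e1.trans (mul_le_mul_of_nonneg_left (Real.add_one_le_exp _) (by linarith))
  calc Real.exp (K * s) * size v s x
      ≤ Real.exp (K * s) * (size v t x * Real.exp (K * (t - s))) := by gcongr
    _ = Real.exp (K * t) * size v t x := by
      rw [mul_left_comm, ← Real.exp_add, mul_comm]
      ring_nf

lemma agree_of_eventually_lt (H : Sol κ T L c Mv Mr r v) (H' : Sol κ T L c Mv Mr r' v')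
    (h : ∀ᶠ s in 𝓝[<] t, Agree r r' v v' s x) : Agree r r' v v' t x := by
  have hc : Continuous fun s : ℝ => (s, x) := by fun_prop
  have hcl : IsClosed {s | Agree r r' v v' s x} :=
    (isClosed_eq (H.rcont.comp hc) (H'.rcont.comp hc)).inter
      (isClosed_eq (H.vcont.comp hc) (H'.vcont.comp hc))
  have hcl' := hcl.mem_of_frequently_of_tendsto (b := 𝓝[<] t) (f := fun s => s) (x := t)
    h.frequently (tendsto_id.mono_left nhdsWithin_le_nhds)
  exact hcl'

lemma agree_of_size_le (H : Sol κ T L c Mv Mr r v) (H' : Sol κ T L c Mv Mr r' v')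
    (h0 : ∀ x, Agree r r' v v' 0 x) (hK0 : 0 ≤ K) (hK : Mv + L ≤ K)
    (hloc : ∀ t₀ ∈ Ico 0 T, ∀ A x₀,
      (∀ y, 0 < r t₀ y → size v t₀ y ≤ A → Agree r r' v v' t₀ y) →
      ∀ᶠ p in 𝓝 (t₀, x₀), Within K A t₀ r v p → Agree r r' v v' p.1 p.2) (A : ℝ) :
    ∀ t ∈ Ico 0 T, ∀ x, 0 < r t x → Real.exp (K * t) * size v t x ≤ A →
      Agree r r' v v' t x := by
  by_contra! hbad
  set B := {t | t ∈ Ico 0 T ∧ ∃ x, 0 < r t x ∧ Real.exp (K * t) * size v t x ≤ A ∧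
    ¬ Agree r r' v v' t x} with hB
  have hne : B.Nonempty := by
    obtain ⟨t, ht, x, h⟩ := hbad
    exact ⟨t, ht, x, h⟩
  have hbdd : BddBelow B := ⟨0, fun t ht => ht.1.1⟩
  set τ := sInf B with hτ
  have hτ0 : 0 ≤ τ := le_csInf hne fun t ht => ht.1.1
  have hτT : τ < T := by
    obtain ⟨t, ht⟩ := hne
    exact (csInf_le hbdd ht).trans_lt ht.1.2
  have hlt : ∀ s, 0 ≤ s → s < τ → ∀ x, 0 < r s x → Real.exp (K * s) * size v s x ≤ A →
      Agree r r' v v' s x := fun s hs0 hs x hx hA => by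
    by_contra hag
    exact (csInf_le hbdd (show s ∈ B from ⟨⟨hs0, hs.trans hτT⟩, x, hx, hA, hag⟩)).not_gt hs
  have hat : ∀ x, 0 < r τ x → Real.exp (K * τ) * size v τ x ≤ A → Agree r r' v v' τ x := by
    intro x hx hA
    rcases hτ0.eq_or_lt with h | h
    · rw [← h]
      exact h0 x
    · refine agree_of_eventually_lt H H' ?_
      filter_upwards [H.eventually_size_le ⟨h, hτT.le⟩ hx hK, self_mem_nhdsWithin] with s hs hsτ
      exact hlt s hs.1 hsτ x hs.2.1 (hs.2.2.trans hA)
  have hev : ∀ x₀ ∈ closedBall (0 : 𝔼 d) A, ∀ᶠ p : ℝ × 𝔼 d in 𝓝 (τ, x₀),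
      Within K (Real.exp (-(K * τ)) * A) τ r v p → Agree r r' v v' p.1 p.2 := fun x₀ _ => by
    refine hloc τ ⟨hτ0, hτT⟩ _ x₀ fun y hy hs => hat y hy ?_
    have := mul_le_mul_of_nonneg_left hs (Real.exp_pos (K * τ)).le
    rwa [← mul_assoc, ← Real.exp_add, add_neg_cancel, Real.exp_zero, one_mul] at this
  have hall := (isCompact_closedBall (0 : 𝔼 d) A).eventually_forall_of_forall_eventually
    (P := fun s x => Within K (Real.exp (-(K * τ)) * A) τ r v (s, x) → Agree r r' v v' s x) hev
  obtain ⟨ε, hε, hball⟩ := Metric.eventually_nhds_iff_ball.1 hall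
  obtain ⟨t, ht, htτ⟩ := exists_lt_of_csInf_lt hne (show sInf B < τ + ε by linarith)
  have hle : τ ≤ t := csInf_le hbdd ht
  obtain ⟨ht0, x, hx, hA, hag⟩ := ht
  rcases hle.eq_or_lt with h | h
  · rw [← h] at hx hA hag
    exact hag (hat x hx hA)
  · refine hag (hball t ?_ x ?_ ⟨h, hx, ?_⟩)
    · rw [Real.ball_eq_Ioo]
      exact ⟨by linarith, htτ⟩
    · rw [mem_closedBall_zero_iff]
      have e1 : size v t x ≤ Real.exp (K * t) * size v t x :=
        le_mul_of_one_le_left (by linarith [one_le_size v t x])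
          (Real.one_le_exp (mul_nonneg hK0 ht0.1))
      have e2 : ‖x‖ ≤ size v t x := by
        unfold size
        linarith [norm_nonneg (v t x)]
      linarith
    · have := mul_le_mul_of_nonneg_left hA (Real.exp_pos (-(K * τ))).le
      rw [← mul_assoc, ← Real.exp_add] at this
      rwa [show K * (t - τ) = -(K * τ) + K * t by ring]

lemma Sol.agree (H : Sol κ T L c Mv Mr r v) (H' : Sol κ T L c Mv Mr r' v')
    (h0 : ∀ x, Agree r r' v v' 0 x) (ht : t ∈ Icc 0 T) (hx : 0 < r t x) :
    Agree r r' v v' t x := by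
  have hc : Continuous fun s : ℝ => r s 0 :=
    H.rcont.comp (by fun_prop : Continuous fun s : ℝ => (s, (0 : 𝔼 d)))
  obtain ⟨R₀, hR₀⟩ := (isCompact_Icc (a := (0 : ℝ)) (b := T)).exists_bound_of_continuousOn
    hc.continuousOn
  obtain ⟨K₀, hK₀, hloc⟩ := H.exists_rate H' hR₀
  have key := agree_of_size_le H H' h0 (K := max K₀ (Mv + L)) (hK₀.trans (le_max_left _ _))
    (le_max_right _ _) fun t₀ ht₀ A x₀ hag => by
      filter_upwards [hloc t₀ ht₀ A x₀ hag] with p hp hw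
      refine hp ⟨hw.1, hw.2.1, le_trans ?_ hw.2.2⟩
      refine mul_le_mul_of_nonneg_right (Real.exp_le_exp.2 ?_)
        (by linarith [one_le_size v p.1 p.2])
      exact mul_le_mul_of_nonneg_right (le_max_left _ _) (by linarith [hw.1])
  rcases ht.1.eq_or_lt with h | h
  · rw [← h]
    exact h0 x
  · refine agree_of_eventually_lt H H' ?_
    filter_upwards [H.eventually_size_le ⟨h, ht.2⟩ hx le_rfl, self_mem_nhdsWithin] with s hs hst
    exact key _ s ⟨hs.1, lt_of_lt_of_le hst ht.2⟩ x hs.2.1 le_rfl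

end Global

end PhysicalVacuum

/-- **Uniqueness for the physical-vacuum free boundary problem** (Theorem 1.1 of
Ifrim–Tataru): two solutions `(rᵢ, vᵢ)` (`i = 0, 1`) of the free-boundary compressible
Euler system `∂ₜ r + v·∇r + κ r (∇·v) = 0`, `∂ₜ v + (v·∇)v + ∇r = 0` on the moving
domains `Ω_t^i = {r_i(t,·) > 0}`, lying in the uniqueness class (`r` uniformly Lipschitz
and nondegenerate, `v ∈ C¹` with bounded gradient, `∇r` in the adapted Hölder space
`C̃^{0,1/2}` with weight `r`), which agree at time `0`, agree on `[0,T]`: the moving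
domains coincide and `(r, v)` coincide on them. -/
theorem euler_physical_vacuum_uniqueness
    {d : ℕ} (hd : 1 ≤ d) {κ T : ℝ} (hκ : 0 < κ) (hT : 0 < T)
    (r : Fin 2 → ℝ → EuclideanSpace ℝ (Fin d) → ℝ)
    (v : Fin 2 → ℝ → EuclideanSpace ℝ (Fin d) → EuclideanSpace ℝ (Fin d))
    -- continuity in (t, x)
    (hrcont : ∀ i, Continuous fun p : ℝ × EuclideanSpace ℝ (Fin d) => r i p.1 p.2)
    (hvcont : ∀ i, Continuous fun p : ℝ × EuclideanSpace ℝ (Fin d) => v i p.1 p.2)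
    -- (i) uniform Lipschitz regularity and nondegeneracy of the defining functions
    (L : ℝ≥0) (hLip : ∀ i, ∀ t ∈ Icc (0:ℝ) T, LipschitzWith L (r i t))
    (c C : ℝ) (hc : 0 < c) (hcC : c ≤ C)
    (hnondeg : ∀ i, ∀ t ∈ Icc (0:ℝ) T, ∀ x, 0 < r i t x →
        c * infDist x {y | ¬ 0 < r i t y} ≤ r i t x ∧
        r i t x ≤ C * infDist x {y | ¬ 0 < r i t y})
    -- (ii) regularity of the uniqueness class: `v ∈ C¹_x` with bounded gradient,
    --      and `∇r ∈ C̃^{0,1/2}_x` (adapted Hölder norm with weight `r`)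
    (hvC1 : ∀ i, ∀ t ∈ Icc (0:ℝ) T, ContDiffOn ℝ 1 (v i t) {x | 0 < r i t x})
    (Mv : ℝ) (hgradv : ∀ i, ∀ t ∈ Icc (0:ℝ) T, ∀ x, 0 < r i t x →
        ‖fderiv ℝ (v i t) x‖ ≤ Mv)
    (Mr : ℝ)
    (hgradr : ∀ i, ∀ t ∈ Icc (0:ℝ) T, ∀ x, 0 < r i t x → ∀ y, 0 < r i t y →
        ‖gradient (r i t) x - gradient (r i t) y‖ ≤
          Mr * (Real.sqrt (r i t x) + Real.sqrt (r i t y) + Real.sqrt ‖x - y‖))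
    -- (iii) the compressible Euler equations hold on the moving domains
    (heqr : ∀ i, ∀ t ∈ Icc (0:ℝ) T, ∀ x, 0 < r i t x →
        HasDerivWithinAt (fun τ => r i τ x)
          (-(@inner ℝ _ _ (v i t x) (gradient (r i t) x) + κ * r i t x * vdiv (v i t) x))
          (Icc 0 T) t)
    (heqv : ∀ i, ∀ t ∈ Icc (0:ℝ) T, ∀ x, 0 < r i t x →
        HasDerivWithinAt (fun τ => v i τ x)
          (-(fderiv ℝ (v i t) x (v i t x) + gradient (r i t) x))
          (Icc 0 T) t)
    -- coincidence of the initial data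
    (hr0 : r 0 0 = r 1 0) (hv0 : v 0 0 = v 1 0) :
    ∀ t ∈ Icc (0:ℝ) T,
      {x | 0 < r 0 t x} = {x | 0 < r 1 t x} ∧
      ∀ x, 0 < r 0 t x → r 0 t x = r 1 t x ∧ v 0 t x = v 1 t x := by
  have sol : ∀ i, PhysicalVacuum.Sol κ T L c (max Mv 0) (max Mr 0) (r i) (v i) := fun i =>
    { κ_pos := hκ
      L_nonneg := L.2
      c_pos := hc
      Mv_nonneg := le_max_right _ _
      Mr_nonneg := le_max_right _ _
      rcont := hrcont i
      vcont := hvcont i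
      lip := fun t ht x y => by
        have h := (hLip i t ht).dist_le_mul x y
        rwa [Real.dist_eq, dist_eq_norm] at h
      nondeg := fun t ht x hx => (hnondeg i t ht x hx).1
      vdiff := fun t ht x hx => ((hvC1 i t ht).differentiableOn one_ne_zero).differentiableAt
        ((isOpen_lt continuous_const
          ((hrcont i).comp (Continuous.prodMk_right t))).mem_nhds hx)
      gradv := fun t ht x hx => (hgradv i t ht x hx).trans (le_max_left _ _)
      gradr := fun t ht x hx y hy => (hgradr i t ht x hx y hy).trans
        (mul_le_mul_of_nonneg_right (le_max_left _ _) (by positivity))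
      eqr := heqr i
      eqv := heqv i }
  intro t ht
  have h01 : ∀ x, 0 < r 0 t x → r 0 t x = r 1 t x ∧ v 0 t x = v 1 t x := fun x hx =>
    (sol 0).agree (sol 1) (fun y => ⟨congrFun hr0 y, congrFun hv0 y⟩) ht hx
  have h10 : ∀ x, 0 < r 1 t x → r 1 t x = r 0 t x ∧ v 1 t x = v 0 t x := fun x hx =>
    (sol 1).agree (sol 0) (fun y => ⟨congrFun hr0.symm y, congrFun hv0.symm y⟩) ht hx
  refine ⟨Set.ext fun x => ⟨fun hx => ?_, fun hx => ?_⟩, h01⟩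
  · exact hx.trans_eq (h01 x hx).1
  · exact hx.trans_eq (h10 x hx).1
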